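/- arXiv:2603.11822 — 2 statements merged into one kernel-verified Lean document; each statement's English description precedes it below -/
import Mathlib

section
/- Let (Σ, d[a,b]) be a symbolic Barański carpet over a nonempty alphabet Γ ⊆ Γ₁ × Γ₂, and assume that a_i ≠ b_j for some (i,j) ∈ Γ. Then for every real t < dim_H(Σ, d[a,b]) there exists p ∈ 𝒫°(Γ) such that λ₁(p,a) ≠ λ₂(p,b) and dim_H ν_p > t, where all Hausdorff dimensions are computed with respect to d[a,b]. -/
open Set Filter MeasureTheory Metric
open scoped ENNReal NNReal

noncomputable section

/-- `p` is a probability vector indexed by `A` (entries outside `A` vanish). -/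
def IsProbVec {Γ₁ Γ₂ : Type*} [Fintype Γ₁] [Fintype Γ₂] (A : Set (Γ₁ × Γ₂))
    (p : Γ₁ × Γ₂ → ℝ) : Prop :=
  (∀ ij, 0 ≤ p ij) ∧ (∀ ij ∉ A, p ij = 0) ∧ ∑ ij : Γ₁ × Γ₂, p ij = 1

/-- Column sums `q_i(p)`. -/
def colSum {Γ₁ Γ₂ : Type*} [Fintype Γ₂] (p : Γ₁ × Γ₂ → ℝ) (i : Γ₁) : ℝ := ∑ j : Γ₂, p (i, j)

/-- Row sums `r_j(p)`. -/
def rowSum {Γ₁ Γ₂ : Type*} [Fintype Γ₁] (p : Γ₁ × Γ₂ → ℝ) (j : Γ₂) : ℝ := ∑ i : Γ₁, p (i, j)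

/-- The first Lyapunov exponent `λ₁(p,a)`. -/
def lyap1 {Γ₁ Γ₂ : Type*} [Fintype Γ₁] [Fintype Γ₂] (p : Γ₁ × Γ₂ → ℝ) (a : Γ₁ → ℝ) : ℝ :=
  ∑ ij : Γ₁ × Γ₂, p ij * Real.log (a ij.1)

/-- The second Lyapunov exponent `λ₂(p,b)`. -/
def lyap2 {Γ₁ Γ₂ : Type*} [Fintype Γ₁] [Fintype Γ₂] (p : Γ₁ × Γ₂ → ℝ) (b : Γ₂ → ℝ) : ℝ :=
  ∑ ij : Γ₁ × Γ₂, p ij * Real.log (b ij.2)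

/-- `g₁(p,a,b)`. -/
def gOne {Γ₁ Γ₂ : Type*} [Fintype Γ₁] [Fintype Γ₂] (p : Γ₁ × Γ₂ → ℝ) (a : Γ₁ → ℝ)
    (b : Γ₂ → ℝ) : ℝ :=
  (∑ ij : Γ₁ × Γ₂, p ij * Real.log (colSum p ij.1)) / lyap1 p a +
    ((∑ ij : Γ₁ × Γ₂, p ij * Real.log (p ij)) -
      ∑ ij : Γ₁ × Γ₂, p ij * Real.log (colSum p ij.1)) / lyap2 p b

/-- `g₂(p,a,b)`. -/
def gTwo {Γ₁ Γ₂ : Type*} [Fintype Γ₁] [Fintype Γ₂] (p : Γ₁ × Γ₂ → ℝ) (a : Γ₁ → ℝ)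
    (b : Γ₂ → ℝ) : ℝ :=
  (∑ ij : Γ₁ × Γ₂, p ij * Real.log (rowSum p ij.2)) / lyap2 p b +
    ((∑ ij : Γ₁ × Γ₂, p ij * Real.log (p ij)) -
      ∑ ij : Γ₁ × Γ₂, p ij * Real.log (rowSum p ij.2)) / lyap1 p a

/-- `g(p,a,b)`: equal to `g₁` when `λ₁(p,a) ≥ λ₂(p,b)` and to `g₂` otherwise. -/
noncomputable def gFun {Γ₁ Γ₂ : Type*} [Fintype Γ₁] [Fintype Γ₂] (p : Γ₁ × Γ₂ → ℝ)
    (a : Γ₁ → ℝ) (b : Γ₂ → ℝ) : ℝ :=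
  if lyap2 p b ≤ lyap1 p a then gOne p a b else gTwo p a b

/-- Generic "longest common prefix" distance on sequences: `0` for equal sequences, and
otherwise the value `val` of the longest common initial segment. -/
noncomputable def rhoDist {Γ : Type*} (val : List Γ → ℝ) (u v : ℕ → Γ) : ℝ := by
  classical
  exact if h : u = v then 0
    else val (List.ofFn fun k : Fin (Nat.find (Function.ne_iff.mp h)) => u k.val)

/-- The Barański distance `d[a,b]` on `Γ^ℕ` for `Γ = A ⊆ Γ₁ × Γ₂`:
`d[a,b]((𝚒₁,𝚓₁),(𝚒₂,𝚓₂)) = max {a_{𝚒₁∧𝚒₂}, b_{𝚓₁∧𝚓₂}}`. -/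
noncomputable def baranskiDist {Γ₁ Γ₂ : Type*} (A : Set (Γ₁ × Γ₂)) (a : Γ₁ → ℝ) (b : Γ₂ → ℝ)
    (ω₁ ω₂ : ℕ → ↥A) : ℝ :=
  max
    (rhoDist (fun L => (L.map a).prod)
      (fun k => ((ω₁ k : Γ₁ × Γ₂)).1) (fun k => ((ω₂ k : Γ₁ × Γ₂)).1))
    (rhoDist (fun L => (L.map b).prod)
      (fun k => ((ω₁ k : Γ₁ × Γ₂)).2) (fun k => ((ω₂ k : Γ₁ × Γ₂)).2))

/-- Hausdorff dimension of a measure: the infimum of Hausdorff dimensions of Borel sets of full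
measure. -/
noncomputable def dimHMeasure {E : Type*} [EMetricSpace E] [MeasurableSpace E]
    (μ : MeasureTheory.Measure E) : ℝ≥0∞ :=
  sInf {s | ∃ B : Set E, MeasurableSet B ∧ μ B = 1 ∧ dimH B = s}

/-- `ν` is the Bernoulli measure associated to the probability vector `p`: it gives each
cylinder the product of the `p`-weights of its letters. -/
def IsBernoulli {Γ₁ Γ₂ : Type*} [Fintype Γ₁] [Fintype Γ₂] (A : Set (Γ₁ × Γ₂))
    (p : Γ₁ × Γ₂ → ℝ) [MeasurableSpace (ℕ → ↥A)] (ν : MeasureTheory.Measure (ℕ → ↥A)) : Prop :=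
  ∀ (m : ℕ) (w : Fin m → ↥A),
    ν {ω | ∀ k : Fin m, ω k.val = w k} = ENNReal.ofReal (∏ k : Fin m, p (w k : Γ₁ × Γ₂))

/-! ### Auxiliary notions on a finite alphabet -/

/-- Birkhoff sum of `h` along the sequence `u`. -/
def bS {X : Type*} (h : X → ℝ) (u : ℕ → X) (n : ℕ) : ℝ := ∑ k ∈ Finset.range n, h (u k)

/-- Expectation of `h` with respect to the vector `p`. -/
def bE {X : Type*} [Fintype X] (p h : X → ℝ) : ℝ := ∑ x, p x * h x

open Classical in
/-- Push-forward of the vector `p` by `g`. -/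
def bPush {X Y : Type*} [Fintype X] (g : X → Y) (p : X → ℝ) (y : Y) : ℝ :=
  ∑ x, if g x = y then p x else 0

/-- Entropy. -/
def bEnt {X : Type*} [Fintype X] (p : X → ℝ) : ℝ := ∑ x, Real.negMulLog (p x)

/-- Entropy of the projection divided by the exponent. -/
def bPhi {X Y : Type*} [Fintype X] [Fintype Y] (g : X → Y) (β : X → ℝ) (p : X → ℝ) : ℝ :=
  bEnt (bPush g p) / bE p β

/-- The dimension functional. -/
def bG {X Y : Type*} [Fintype X] [Fintype Y] (g : X → Y) (α β : X → ℝ) (p : X → ℝ) : ℝ :=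
  (bEnt p - bEnt (bPush g p)) / bE p α + bPhi g β p

open Classical in
/-- Number of occurrences of `x` among the first `n` letters. -/
def bCount {X : Type*} (u : ℕ → X) (n : ℕ) (x : X) : ℕ :=
  ((Finset.range n).filter (fun k => u k = x)).card

/-- Empirical frequencies. -/
def bF {X : Type*} (u : ℕ → X) (n : ℕ) (x : X) : ℝ := (bCount u n x : ℝ) / n

lemma bS_succ {X : Type*} (h : X → ℝ) (u : ℕ → X) (n : ℕ) :
    bS h u (n + 1) = bS h u n + h (u n) := by
  simp [bS, Finset.sum_range_succ]

lemma bS_zero {X : Type*} (h : X → ℝ) (u : ℕ → X) : bS h u 0 = 0 := by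
  simp [bS]

lemma bS_eq_count {X : Type*} [Fintype X] (h : X → ℝ) (u : ℕ → X) (n : ℕ) :
    bS h u n = ∑ x, (bCount u n x : ℝ) * h x := by
  classical
  unfold bS bCount
  rw [← Finset.sum_fiberwise (Finset.range n) u]
  refine Finset.sum_congr rfl fun x _ => ?_
  rw [Finset.sum_congr rfl (g := fun _ => h x)]
  · simp
  · intro k hk
    rw [(Finset.mem_filter.mp hk).2]

lemma bS_eq {X : Type*} [Fintype X] (h : X → ℝ) (u : ℕ → X) {n : ℕ} (hn : 0 < n) :
    bS h u n = n * bE (bF u n) h := by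
  have hn' : (n : ℝ) ≠ 0 := by positivity
  rw [bS_eq_count, bE, Finset.mul_sum]
  refine Finset.sum_congr rfl fun x _ => ?_
  unfold bF
  field_simp

lemma bCount_le {X : Type*} (u : ℕ → X) (n : ℕ) (x : X) : bCount u n x ≤ n := by
  classical
  unfold bCount
  exact (Finset.card_filter_le _ _).trans (by simp)

lemma bF_mem {X : Type*} [Fintype X] (u : ℕ → X) {n : ℕ} (hn : 0 < n) :
    bF u n ∈ stdSimplex ℝ X := by
  have hn' : (n : ℝ) ≠ 0 := by positivity
  refine ⟨fun x => by unfold bF; positivity, ?_⟩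
  have h1 := bS_eq (fun _ => (1 : ℝ)) u hn
  simp only [bS, bE, mul_one, Finset.sum_const, Finset.card_range, nsmul_eq_mul] at h1
  have : (n : ℝ) * (∑ x, bF u n x - 1) = 0 := by rw [mul_sub, ← h1]; ring
  rcases mul_eq_zero.mp this with h | h
  · exact absurd h hn'
  · linarith

lemma bF_pos {X : Type*} (u : ℕ → X) {n k : ℕ} (hk : k < n) : 0 < bF u n (u k) := by
  classical
  unfold bF
  have hn : 0 < n := by omega
  have : 0 < bCount u n (u k) := by
    unfold bCount
    exact Finset.card_pos.mpr ⟨k, by simp [hk]⟩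
  positivity

lemma bPush_nonneg {X Y : Type*} [Fintype X] (g : X → Y) {p : X → ℝ} (hp : ∀ x, 0 ≤ p x) (y : Y) :
    0 ≤ bPush g p y := by
  classical
  unfold bPush
  exact Finset.sum_nonneg fun x _ => by split_ifs; exacts [hp x, le_rfl]

lemma le_bPush {X Y : Type*} [Fintype X] (g : X → Y) {p : X → ℝ} (hp : ∀ x, 0 ≤ p x) (x : X) :
    p x ≤ bPush g p (g x) := by
  classical
  unfold bPush
  have := Finset.single_le_sum (f := fun x' => if g x' = g x then p x' else 0) (s := Finset.univ)
    (fun x' _ => by split_ifs; exacts [hp x', le_rfl]) (Finset.mem_univ x)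
  simpa using this

lemma bE_comp {X Y : Type*} [Fintype X] [Fintype Y] (g : X → Y) (p : X → ℝ) (h : Y → ℝ) :
    bE p (fun x => h (g x)) = ∑ y, bPush g p y * h y := by
  classical
  unfold bE bPush
  simp_rw [Finset.sum_mul]
  rw [Finset.sum_comm]
  refine Finset.sum_congr rfl fun x _ => ?_
  simp [ite_mul]

lemma bPush_sum {X Y : Type*} [Fintype X] [Fintype Y] (g : X → Y) (p : X → ℝ) :
    ∑ y, bPush g p y = ∑ x, p x := by
  have := bE_comp g p (fun _ => 1)
  simpa [bE] using this.symm

lemma bPush_mem {X Y : Type*} [Fintype X] [Fintype Y] (g : X → Y) {p : X → ℝ}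
    (hp : p ∈ stdSimplex ℝ X) : bPush g p ∈ stdSimplex ℝ Y :=
  ⟨bPush_nonneg g hp.1, by rw [bPush_sum]; exact hp.2⟩

lemma stdSimplex_le_one' {X : Type*} [Fintype X] {p : X → ℝ} (hp : p ∈ stdSimplex ℝ X) (x : X) :
    p x ≤ 1 := by
  rw [← hp.2]
  exact Finset.single_le_sum (fun x _ => hp.1 x) (Finset.mem_univ x)

lemma bEnt_nonneg {X : Type*} [Fintype X] {p : X → ℝ} (hp : p ∈ stdSimplex ℝ X) : 0 ≤ bEnt p :=
  Finset.sum_nonneg fun x _ => Real.negMulLog_nonneg (hp.1 x) (stdSimplex_le_one' hp x)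

lemma bEnt_eq {X : Type*} [Fintype X] (p : X → ℝ) :
    bEnt p = bE p (fun x => -Real.log (p x)) := by
  unfold bEnt bE Real.negMulLog
  exact Finset.sum_congr rfl fun x _ => by ring

lemma bEnt_push_eq {X Y : Type*} [Fintype X] [Fintype Y] (g : X → Y) (p : X → ℝ) :
    bEnt (bPush g p) = bE p (fun x => -Real.log (bPush g p (g x))) := by
  rw [bEnt_eq, bE_comp g p (fun y => -Real.log (bPush g p y))]
  rfl

lemma bE_pos {X : Type*} [Fintype X] {p h : X → ℝ} (hp : p ∈ stdSimplex ℝ X) (hh : ∀ x, 0 < h x) :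
    0 < bE p h := by
  unfold bE
  have h0 : ∃ x, 0 < p x := by
    by_contra hcon
    push Not at hcon
    have : ∑ x, p x ≤ 0 := Finset.sum_nonpos fun x _ => hcon x
    rw [hp.2] at this
    linarith
  obtain ⟨x, hx⟩ := h0
  exact Finset.sum_pos' (fun x _ => mul_nonneg (hp.1 x) (hh x).le) ⟨x, Finset.mem_univ _, mul_pos hx (hh x)⟩

lemma continuous_bE {X : Type*} [Fintype X] (h : X → ℝ) : Continuous (fun p : X → ℝ => bE p h) := by
  unfold bE; fun_prop

lemma continuous_bPush {X Y : Type*} [Fintype X] (g : X → Y) :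
    Continuous (fun p : X → ℝ => bPush g p) := by
  classical
  unfold bPush
  refine continuous_pi fun y => continuous_finsetSum _ fun x _ => ?_
  split_ifs <;> fun_prop

lemma continuous_bEnt {X : Type*} [Fintype X] : Continuous (fun p : X → ℝ => bEnt p) := by
  unfold bEnt
  exact continuous_finsetSum _ fun x _ => Real.continuous_negMulLog.comp (continuous_apply x)

lemma continuousOn_bPhi {X Y : Type*} [Fintype X] [Fintype Y] (g : X → Y) {β : X → ℝ}
    (hβ : ∀ x, 0 < β x) : ContinuousOn (bPhi g β) (stdSimplex ℝ X) := by
  unfold bPhi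
  exact ContinuousOn.div (continuous_bEnt.comp (continuous_bPush g)).continuousOn
    (continuous_bE β).continuousOn fun p hp => (bE_pos hp hβ).ne'

lemma continuousOn_bG {X Y : Type*} [Fintype X] [Fintype Y] (g : X → Y) {α β : X → ℝ}
    (hα : ∀ x, 0 < α x) (hβ : ∀ x, 0 < β x) : ContinuousOn (bG g α β) (stdSimplex ℝ X) := by
  unfold bG
  refine ContinuousOn.add (ContinuousOn.div ?_
    (continuous_bE α).continuousOn fun p hp => (bE_pos hp hα).ne') (continuousOn_bPhi g hβ)
  exact (continuous_bEnt.sub (continuous_bEnt.comp (continuous_bPush g))).continuousOn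

lemma bPhi_nonneg {X Y : Type*} [Fintype X] [Fintype Y] (g : X → Y) {β : X → ℝ}
    (hβ : ∀ x, 0 < β x) {p : X → ℝ} (hp : p ∈ stdSimplex ℝ X) : 0 ≤ bPhi g β p :=
  div_nonneg (bEnt_nonneg (bPush_mem g hp)) (bE_pos hp hβ).le

lemma bPhi_bdd {X Y : Type*} [Fintype X] [Fintype Y] (g : X → Y) {β : X → ℝ}
    (hβ : ∀ x, 0 < β x) : ∃ M : ℝ, 0 ≤ M ∧ ∀ p ∈ stdSimplex ℝ X, bPhi g β p ≤ M := by
  obtain ⟨M, hM⟩ := (isCompact_stdSimplex ℝ X).exists_bound_of_continuousOn (continuousOn_bPhi g hβ)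
  exact ⟨max M 0, le_max_right _ _, fun p hp =>
    (le_abs_self _).trans ((hM p hp).trans (le_max_left _ _))⟩

lemma bF_succ_sub {X : Type*} (u : ℕ → X) {n : ℕ} (hn : 0 < n) (x : X) :
    |bF u (n + 1) x - bF u n x| ≤ 1 / (n : ℝ) := by
  classical
  have hn' : (0 : ℝ) < n := by positivity
  have h1 : (bCount u n x : ℝ) ≤ n := by exact_mod_cast bCount_le u n x
  have h0 : (0 : ℝ) ≤ bCount u n x := by positivity
  have h2 : bCount u (n + 1) x = bCount u n x + if u n = x then 1 else 0 := by
    unfold bCount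
    rw [Finset.range_add_one, Finset.filter_insert]
    split_ifs
    · rw [Finset.card_insert_of_notMem (by simp)]
    · simp
  unfold bF
  rw [h2]
  have h3 : (((bCount u n x + if u n = x then 1 else 0 : ℕ) : ℝ)) / ((n + 1 : ℕ) : ℝ)
      - (bCount u n x : ℝ) / n
      = ((if u n = x then 1 else 0 : ℝ) * n - bCount u n x) / (n * (n + 1)) := by
    push_cast
    field_simp
    ring
  rw [h3, abs_div, abs_of_pos (show (0 : ℝ) < n * (n + 1) by positivity), div_le_div_iff₀ (by positivity) hn']
  have h4 : |(if u n = x then 1 else 0 : ℝ) * n - bCount u n x| ≤ n := by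
    rw [abs_le]
    split_ifs <;> constructor <;> linarith
  nlinarith [abs_nonneg ((if u n = x then 1 else 0 : ℝ) * n - bCount u n x)]


lemma bS_lower {X : Type*} {h : X → ℝ} {c : ℝ} (hc : ∀ x, c ≤ h x) (u : ℕ → X) (n : ℕ) :
    c * n ≤ bS h u n := by
  unfold bS
  have := Finset.card_nsmul_le_sum (Finset.range n) (fun k => h (u k)) c (fun k _ => hc _)
  simpa [mul_comm] using this

lemma bS_upper {X : Type*} {h : X → ℝ} {c : ℝ} (hc : ∀ x, h x ≤ c) (u : ℕ → X) (n : ℕ) :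
    bS h u n ≤ c * n := by
  unfold bS
  have := Finset.sum_le_card_nsmul (Finset.range n) (fun k => h (u k)) c (fun k _ => hc _)
  simpa [mul_comm] using this

lemma bS_strictMono {X : Type*} {h : X → ℝ} (hh : ∀ x, 0 < h x) (u : ℕ → X) :
    StrictMono (bS h u) :=
  strictMono_nat_of_lt_succ fun n => by rw [bS_succ]; linarith [hh (u n)]

/-- The first time at which the Birkhoff sum reaches a level. -/
lemma bS_hit {X : Type*} {h : X → ℝ} {c C : ℝ} (hc0 : 0 < c) (hc : ∀ x, c ≤ h x)
    (hC : ∀ x, h x ≤ C) (u : ℕ → X) {R : ℝ} (hR : 0 ≤ R) :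
    ∃ m, R ≤ bS h u m ∧ bS h u m ≤ R + C ∧ ∀ k < m, bS h u k < R := by
  classical
  have hex : ∃ m, R ≤ bS h u m := by
    obtain ⟨m, hm⟩ := exists_nat_ge (R / c)
    refine ⟨m, le_trans ?_ (bS_lower hc u m)⟩
    rw [div_le_iff₀ hc0] at hm
    linarith
  refine ⟨Nat.find hex, Nat.find_spec hex, ?_, fun k hk => not_le.mp (Nat.find_min hex hk)⟩
  rcases Nat.eq_zero_or_pos (Nat.find hex) with h0 | h0
  · rw [h0, bS_zero]
    linarith [hc (u 0), hC (u 0)]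
  · obtain ⟨k, hk⟩ : ∃ k, Nat.find hex = k + 1 := ⟨Nat.find hex - 1, by omega⟩
    have h1 : bS h u k < R := not_le.mp (Nat.find_min hex (by omega))
    rw [hk, bS_succ]
    linarith [hC (u k)]

/-- Existence of good scales. -/
lemma exists_good {X Y : Type*} [Fintype X] [Fintype Y] (g : X → Y) {α β : X → ℝ} {c C : ℝ}
    (hc0 : 0 < c) (hcα : ∀ x, c ≤ α x) (hcβ : ∀ x, c ≤ β x)
    (hCβ : ∀ x, β x ≤ C) (u : ℕ → X)
    (hu : ∃ᶠ n in atTop, bS β u n ≤ bS α u n) {ε : ℝ} (hε : 0 < ε) :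
    ∃ᶠ n in atTop, 0 < n ∧ bS β u n ≤ bS α u n ∧ ∃ m, n ≤ m ∧ bS α u n ≤ bS β u m ∧
      bS β u m ≤ bS α u n + C ∧ bPhi g β (bF u m) ≤ bPhi g β (bF u n) + ε := by
  have hβ : ∀ x, 0 < β x := fun x => hc0.trans_le (hcβ x)
  have hα : ∀ x, 0 < α x := fun x => hc0.trans_le (hcα x)
  rw [Filter.frequently_atTop]
  intro N0
  by_contra hcon
  push Not at hcon
  -- times `m`
  have hstep : ∀ n, max N0 1 ≤ n → bS β u n ≤ bS α u n → ∃ m, n ≤ m ∧ bS α u n ≤ bS β u m ∧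
      (∀ k < m, bS β u k < bS α u n) ∧ bPhi g β (bF u n) + ε < bPhi g β (bF u m) := by
    intro n hn hle
    obtain ⟨m, hm1, hm2, hm3⟩ := bS_hit hc0 hcβ hCβ u (R := bS α u n)
      (le_trans (by positivity) (bS_lower hcα u n))
    have hnm : n ≤ m := by
      by_contra hlt
      push Not at hlt
      have := bS_strictMono hβ u hlt
      linarith
    exact ⟨m, hnm, hm1, hm3, hcon n ((le_max_left _ _).trans hn)
      (lt_of_lt_of_le (by norm_num) ((le_max_right _ _).trans hn)) hle m hnm hm1 hm2⟩
  by_cases hcase : ∃ N, ∀ n ≥ N, bS β u n ≤ bS α u n → bS β u (n + 1) ≤ bS α u (n + 1)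
  · obtain ⟨N, hN⟩ := hcase
    obtain ⟨n1, hn1, hn1'⟩ := (Filter.frequently_atTop.mp hu) (max N (max N0 1))
    have hall : ∀ n ≥ n1, bS β u n ≤ bS α u n := by
      intro n hn
      induction n, hn using Nat.le_induction with
      | base => exact hn1'
      | succ k hk ih => exact hN k (by have := le_max_left N (max N0 1); omega) ih
    obtain ⟨M, hM0, hM⟩ := bPhi_bdd g hβ
    have hiter : ∀ k : ℕ, ∃ n ≥ n1, bPhi g β (bF u n1) + k * ε ≤ bPhi g β (bF u n) := by
      intro k
      induction k with
      | zero => exact ⟨n1, le_rfl, by simp⟩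
      | succ k ih =>
        obtain ⟨n, hn, hle⟩ := ih
        obtain ⟨m, hm, -, -, hlt⟩ := hstep n
          (((le_max_right _ _).trans hn1).trans hn) (hall n hn)
        exact ⟨m, hn.trans hm, by push_cast; linarith⟩
    have hpos : 0 < n1 := by
      have h1 := le_max_right N (max N0 1)
      have h2 := le_max_right N0 1
      omega
    obtain ⟨k, hk⟩ := exists_nat_gt ((M - bPhi g β (bF u n1)) / ε)
    rw [div_lt_iff₀ hε] at hk
    obtain ⟨n, hn, hle⟩ := hiter k
    have := hM _ (bF_mem u (show 0 < n by omega))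
    linarith
  · push Not at hcase
    have huc := (isCompact_stdSimplex ℝ X).uniformContinuousOn_of_continuous (continuousOn_bPhi g hβ)
    rw [Metric.uniformContinuousOn_iff] at huc
    obtain ⟨δ, hδ, hδ'⟩ := huc ε hε
    obtain ⟨K, hK⟩ := exists_nat_gt (1 / δ)
    obtain ⟨n, hn, h1, h2⟩ := hcase (max K (max N0 1))
    have hn1 : max N0 1 ≤ n := (le_max_right _ _).trans hn
    have hn0 : 0 < n := by have := le_max_right N0 1; omega
    obtain ⟨m, hm, -, hm3, hlt⟩ := hstep n hn1 h1
    have hmle : m ≤ n + 1 := by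
      by_contra hlt
      push Not at hlt
      have h3 := hm3 (n + 1) hlt
      rw [bS_succ α] at h2
      linarith [hα (u n)]
    have hm' : m = n ∨ m = n + 1 := by omega
    rcases hm' with rfl | rfl
    · linarith
    · have hd : dist (bF u (n + 1)) (bF u n) < δ := by
        refine lt_of_le_of_lt ?_ (show 1 / (n : ℝ) < δ from ?_)
        · rw [dist_pi_le_iff (by positivity)]
          intro x
          rw [Real.dist_eq]
          exact bF_succ_sub u hn0 x
        · have hKn : (K : ℝ) ≤ n := by exact_mod_cast (le_max_left _ _).trans hn
          have hn0' : (0 : ℝ) < n := by exact_mod_cast hn0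
          rw [one_div_lt hn0' hδ]
          exact hK.trans_le hKn
      have := hδ' _ (bF_mem u (Nat.succ_pos n)) _ (bF_mem u hn0) hd
      rw [Real.dist_eq] at this
      have := (abs_lt.mp this).2
      linarith

/-- Number of nats needed to describe an approximate square. -/
def bBits {X Y : Type*} [Fintype X] [Fintype Y] (g : X → Y) (u : ℕ → X) (n m : ℕ) : ℝ :=
  n * (bEnt (bF u n) - bEnt (bPush g (bF u n))) + m * bEnt (bPush g (bF u m))

lemma bBits_le {X Y : Type*} [Fintype X] [Fintype Y] (g : X → Y) {α β : X → ℝ}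
    (hα : ∀ x, 0 < α x) (hβ : ∀ x, 0 < β x) {C D M ε : ℝ} (hC : 0 ≤ C)
    (hM : ∀ p ∈ stdSimplex ℝ X, bPhi g β p ≤ M)
    (hD : ∀ p ∈ stdSimplex ℝ X, bE p β ≤ bE p α → bG g α β p ≤ D) (u : ℕ → X) {n m : ℕ}
    (hn : 0 < n) (hle : bS β u n ≤ bS α u n) (hnm : n ≤ m)
    (h2 : bS β u m ≤ bS α u n + C) (h3 : bPhi g β (bF u m) ≤ bPhi g β (bF u n) + ε) :
    bBits g u n m ≤ bS α u n * (D + ε) + C * M := by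
  have hm : 0 < m := by omega
  have hnR : (0 : ℝ) < n := by exact_mod_cast hn
  have hFn := bF_mem u hn
  have hFm := bF_mem u hm
  have hαp := bE_pos hFn hα
  have hβp := bE_pos hFm hβ
  have e1 : (m : ℝ) * bEnt (bPush g (bF u m)) = bS β u m * bPhi g β (bF u m) := by
    rw [bS_eq β u hm, bPhi]; field_simp
  have e2 : (n : ℝ) * (bEnt (bF u n) - bEnt (bPush g (bF u n))) =
      bS α u n * ((bEnt (bF u n) - bEnt (bPush g (bF u n))) / bE (bF u n) α) := by
    rw [bS_eq α u hn]; field_simp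
  have hG : bG g α β (bF u n) ≤ D := by
    apply hD _ hFn
    rw [bS_eq α u hn, bS_eq β u hn] at hle
    exact le_of_mul_le_mul_left hle hnR
  unfold bG at hG
  have hS : 0 ≤ bS α u n := by rw [bS_eq α u hn]; positivity
  have hP0 := bPhi_nonneg g hβ hFm
  unfold bBits
  rw [e1, e2]
  have i1 : bS β u m * bPhi g β (bF u m) ≤ (bS α u n + C) * bPhi g β (bF u m) :=
    mul_le_mul_of_nonneg_right h2 hP0
  have i2 : bS α u n * bPhi g β (bF u m) ≤ bS α u n * (bPhi g β (bF u n) + ε) :=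
    mul_le_mul_of_nonneg_left h3 hS
  have i3 : C * bPhi g β (bF u m) ≤ C * M := mul_le_mul_of_nonneg_left (hM _ hFm) hC
  have i4 := mul_le_mul_of_nonneg_left hG hS
  nlinarith


lemma hausdorff_zero_of_infinite {Ω ι : Type*} [EMetricSpace Ω] [MeasurableSpace Ω] [BorelSpace Ω]
    [Countable ι] {s : ℝ} (hs : 0 < s) (V : ι → Set Ω) (hsum : ∑' i, ediam (V i) ^ s ≠ ⊤)
    (L : Set Ω) (hL : ∀ ω ∈ L, {i | ω ∈ V i}.Infinite) : Measure.hausdorffMeasure s L = 0 := by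
  have htail := ENNReal.tendsto_tsum_compl_atTop_zero hsum
  have hr : Tendsto (fun F : Finset ι => (∑' i : {i // i ∉ F}, ediam (V i) ^ s) ^ (1 / s)) atTop
      (nhds 0) := by
    have := (ENNReal.continuous_rpow_const (y := 1 / s)).tendsto (0 : ℝ≥0∞)
    rw [ENNReal.zero_rpow_of_pos (by positivity)] at this
    exact this.comp htail
  have := Measure.hausdorffMeasure_le_liminf_tsum (ι := fun F : Finset ι => {i // i ∉ F}) s L
    (l := atTop) _ hr (fun F i => V i) ?_ ?_
  · rw [htail.liminf_eq] at this
    exact le_antisymm this (zero_le)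
  · refine Eventually.of_forall fun F i => ?_
    have h1 : ediam (V i) ^ s ≤ ∑' i : {i // i ∉ F}, ediam (V i) ^ s :=
      ENNReal.le_tsum (f := fun i : {i // i ∉ F} => ediam (V i) ^ s) i
    calc ediam (V i) = (ediam (V i) ^ s) ^ (1 / s) := by
          rw [← ENNReal.rpow_mul, mul_one_div_cancel hs.ne', ENNReal.rpow_one]
      _ ≤ _ := ENNReal.rpow_le_rpow h1 (by positivity)
  · refine Eventually.of_forall fun F ω hω => ?_
    obtain ⟨i, hi, hiF⟩ := (hL ω hω).exists_notMem_finset F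
    exact mem_iUnion.mpr ⟨⟨i, hiF⟩, hi⟩

/-- Code of an approximate square. -/
def bCode {X Y : Type*} (g : X → Y) (n m : ℕ) (u : ℕ → X) (k : Fin m) : X ⊕ Y :=
  if k.val < n then Sum.inl (u k) else Sum.inr (g (u k))

/-- Weights on code letters. -/
def bTheta {X Y : Type*} [Fintype X] (g : X → Y) (n : ℕ) (p p' : X → ℝ) (k : ℕ) : X ⊕ Y → ℝ
  | Sum.inl x => if k < n then bPush g p' (g x) * (p x / bPush g p (g x)) else 0
  | Sum.inr y => if k < n then 0 else bPush g p' y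

lemma bTheta_nonneg {X Y : Type*} [Fintype X] (g : X → Y) (n : ℕ) {p p' : X → ℝ}
    (hp : ∀ x, 0 ≤ p x) (hp' : ∀ x, 0 ≤ p' x) (k : ℕ) (z : X ⊕ Y) : 0 ≤ bTheta g n p p' k z := by
  rcases z with x | y
  · simp only [bTheta]
    split_ifs
    · exact mul_nonneg (bPush_nonneg g hp' _) (div_nonneg (hp x) (bPush_nonneg g hp _))
    · exact le_rfl
  · simp only [bTheta]
    split_ifs
    · exact le_rfl
    · exact bPush_nonneg g hp' _

lemma bTheta_sum_le {X Y : Type*} [Fintype X] [Fintype Y] (g : X → Y) (n : ℕ) {p p' : X → ℝ}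
    (hp : p ∈ stdSimplex ℝ X) (hp' : p' ∈ stdSimplex ℝ X) (k : ℕ) :
    ∑ z, bTheta g n p p' k z ≤ 1 := by
  rw [Fintype.sum_sum_type]
  have hq := bPush_mem g hp'
  by_cases hk : k < n
  · simp only [bTheta, hk, if_true, Finset.sum_const_zero, add_zero]
    have h1 : ∑ x, bPush g p' (g x) * (p x / bPush g p (g x))
        = bE p (fun x => (fun y => bPush g p' y / bPush g p y) (g x)) := by
      unfold bE
      exact Finset.sum_congr rfl fun x _ => by ring
    rw [h1, bE_comp g p (fun y => bPush g p' y / bPush g p y), ← hq.2]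
    refine Finset.sum_le_sum fun y _ => ?_
    by_cases h0 : bPush g p y = 0
    · simp [h0, hq.1 y]
    · rw [mul_div_cancel₀ _ h0]
  · simp only [bTheta, hk, if_false, Finset.sum_const_zero, zero_add]
    exact hq.2.le

lemma bTheta_prod_sum_le {X Y : Type*} [Fintype X] [Fintype Y] (g : X → Y) (n m : ℕ)
    {p p' : X → ℝ} (hp : p ∈ stdSimplex ℝ X) (hp' : p' ∈ stdSimplex ℝ X) :
    ∑ z : Fin m → X ⊕ Y, ∏ k : Fin m, bTheta g n p p' k (z k) ≤ 1 := by
  classical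
  rw [← Fintype.piFinset_univ, ← Finset.prod_univ_sum (fun _ => Finset.univ)
    (fun (k : Fin m) z => bTheta g n p p' k z)]
  exact Finset.prod_le_one (fun k _ => Finset.sum_nonneg fun z _ => bTheta_nonneg g n hp.1 hp'.1 _ _)
    (fun k _ => bTheta_sum_le g n hp hp' k)

lemma bS_log_push {X Y : Type*} [Fintype X] [Fintype Y] (g : X → Y) (u : ℕ → X) {m : ℕ}
    (hm : 0 < m) : bS (fun x => -Real.log (bPush g (bF u m) (g x))) u m
      = m * bEnt (bPush g (bF u m)) := by
  rw [bS_eq _ u hm, bEnt_push_eq]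

lemma bS_log {X : Type*} [Fintype X] (u : ℕ → X) {m : ℕ}
    (hm : 0 < m) : bS (fun x => -Real.log (bF u m x)) u m = m * bEnt (bF u m) := by
  rw [bS_eq _ u hm, bEnt_eq]

lemma bTheta_prod {X Y : Type*} [Fintype X] [Fintype Y] (g : X → Y) (u : ℕ → X) {n m : ℕ}
    (hn : 0 < n) (hnm : n ≤ m) :
    ∏ k : Fin m, bTheta g n (bF u n) (bF u m) k (bCode g n m u k) = Real.exp (-bBits g u n m) := by
  have hm : 0 < m := by omega
  have hfac : ∀ k : Fin m, bTheta g n (bF u n) (bF u m) k (bCode g n m u k) =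
      Real.exp (-(-Real.log (bPush g (bF u m) (g (u k))) + if k.val < n then
        (-Real.log (bF u n (u k)) - -Real.log (bPush g (bF u n) (g (u k)))) else 0)) := by
    intro k
    have hq : 0 < bPush g (bF u m) (g (u k)) :=
      (bF_pos u k.2).trans_le (le_bPush g (bF_mem u hm).1 _)
    by_cases hk : k.val < n
    · have hp := bF_pos u hk
      have hp' : 0 < bPush g (bF u n) (g (u k)) := hp.trans_le (le_bPush g (bF_mem u hn).1 _)
      simp only [bTheta, bCode, hk, if_true]
      rw [show -(-Real.log (bPush g (bF u m) (g (u k))) +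
        (-Real.log (bF u n (u k)) - -Real.log (bPush g (bF u n) (g (u k))))) =
        Real.log (bPush g (bF u m) (g (u k))) + (Real.log (bF u n (u k)) -
          Real.log (bPush g (bF u n) (g (u k)))) by ring, Real.exp_add, Real.exp_sub,
        Real.exp_log hq, Real.exp_log hp, Real.exp_log hp']
    · simp only [bTheta, bCode, hk, if_false, add_zero, neg_neg]
      rw [Real.exp_log hq]
  rw [Finset.prod_congr rfl (fun k _ => hfac k), ← Real.exp_sum]
  congr 1
  rw [Finset.sum_neg_distrib, Finset.sum_add_distrib]
  congr 1
  unfold bBits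
  rw [add_comm]
  congr 1
  · rw [mul_sub, ← bS_log u hn, ← bS_log_push g u hn]
    unfold bS
    rw [← Finset.sum_sub_distrib, Finset.sum_fin_eq_sum_range, ← Finset.sum_subset
      (Finset.range_mono hnm)]
    · refine Finset.sum_congr rfl fun k hk => ?_
      have hk' := Finset.mem_range.mp hk
      simp [hk', lt_of_lt_of_le hk' hnm]
    · intro k _ hk
      have hk' : ¬ k < n := by simpa using hk
      simp [hk']
  · rw [← bS_log_push g u hm]
    unfold bS
    rw [Finset.sum_range]


/-- The elements of the cover. -/
def bV {X Y Ω : Type*} [Fintype X] [Fintype Y] (cd : Ω → ℕ → X) (g : X → Y) (α β : X → ℝ)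
    (C ε : ℝ) (n m : ℕ) (P P' : X → ℕ) (z : Fin m → X ⊕ Y) : Set Ω :=
  {ω | 0 < n ∧ bS β (cd ω) n ≤ bS α (cd ω) n ∧ n ≤ m ∧ bS α (cd ω) n ≤ bS β (cd ω) m ∧
    bS β (cd ω) m ≤ bS α (cd ω) n + C ∧
    bPhi g β (bF (cd ω) m) ≤ bPhi g β (bF (cd ω) n) + ε ∧
    bCount (cd ω) n = P ∧ bCount (cd ω) m = P' ∧ bCode g n m (cd ω) = z}

lemma bV_ediam {X Y Ω : Type*} [Fintype X] [Fintype Y] [MetricSpace Ω] (cd : Ω → ℕ → X)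
    (g : X → Y) {α β : X → ℝ} {C ε : ℝ}
    (hM1 : ∀ ω τ n m, (∀ k < n, cd ω k = cd τ k) → (∀ k < m, g (cd ω k) = g (cd τ k)) →
      dist ω τ ≤ max (Real.exp (-bS α (cd ω) n)) (Real.exp (-bS β (cd ω) m)))
    {n m : ℕ} {P P' : X → ℕ} {z : Fin m → X ⊕ Y} {ω₀ : Ω}
    (hω₀ : ω₀ ∈ bV cd g α β C ε n m P P' z) :
    ediam (bV cd g α β C ε n m P P' z) ≤ ENNReal.ofReal (Real.exp (-bS α (cd ω₀) n)) := by
  refine Metric.ediam_le fun ω hω τ hτ => ?_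
  rw [edist_dist]
  refine ENNReal.ofReal_le_ofReal ?_
  obtain ⟨-, -, hnm, h1, -, -, h2, -, h3⟩ := hω
  obtain ⟨-, -, -, -, -, -, -, -, h4⟩ := hτ
  obtain ⟨-, -, -, -, -, -, h5, -, -⟩ := hω₀
  have hcode : ∀ k (hk : k < m), bCode g n m (cd ω) ⟨k, hk⟩ = bCode g n m (cd τ) ⟨k, hk⟩ := by
    intro k hk; rw [h3, h4]
  have e1 : ∀ k < n, cd ω k = cd τ k := by
    intro k hk
    have := hcode k (hk.trans_le hnm)
    simpa [bCode, hk] using this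
  have e2 : ∀ k < m, g (cd ω k) = g (cd τ k) := by
    intro k hk
    by_cases hkn : k < n
    · rw [e1 k hkn]
    · have := hcode k hk
      simpa [bCode, hkn] using this
  refine (hM1 ω τ n m e1 e2).trans ?_
  have e3 : bS α (cd ω₀) n = bS α (cd ω) n := by
    rw [bS_eq_count, bS_eq_count, h2, h5]
  rw [e3]
  exact max_le le_rfl (Real.exp_le_exp.mpr (by linarith))

lemma bV_sum {X Y Ω : Type*} [Fintype X] [Fintype Y] [MetricSpace Ω] (cd : Ω → ℕ → X)
    (g : X → Y) {α β : X → ℝ} {c C D M ε s : ℝ} (hc0 : 0 < c) (hC : 0 ≤ C) (hs : 0 < s)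
    (hsD : D + ε ≤ s)
    (hcα : ∀ x, c ≤ α x) (hcβ : ∀ x, c ≤ β x)
    (hM : ∀ p ∈ stdSimplex ℝ X, bPhi g β p ≤ M)
    (hD : ∀ p ∈ stdSimplex ℝ X, bE p β ≤ bE p α → bG g α β p ≤ D)
    (hM1 : ∀ ω τ n m, (∀ k < n, cd ω k = cd τ k) → (∀ k < m, g (cd ω k) = g (cd τ k)) →
      dist ω τ ≤ max (Real.exp (-bS α (cd ω) n)) (Real.exp (-bS β (cd ω) m)))
    (n m : ℕ) (P P' : X → ℕ) :
    ∑ z, ediam (bV cd g α β C ε n m P P' z) ^ s ≤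
      ENNReal.ofReal (Real.exp (C * M - (s - D - ε) * c * n)) := by
  have hα : ∀ x, 0 < α x := fun x => hc0.trans_le (hcα x)
  have hβ : ∀ x, 0 < β x := fun x => hc0.trans_le (hcβ x)
  by_cases hne : ∃ z₁, (bV cd g α β C ε n m P P' z₁).Nonempty
  · obtain ⟨z₁, ω₁, hω₁⟩ := hne
    obtain ⟨hn, -, hnm, -, -, -, hP, hP', -⟩ := hω₁
    have hm : 0 < m := by omega
    set p := bF (cd ω₁) n with hp
    set p' := bF (cd ω₁) m with hp'
    have hpm : p ∈ stdSimplex ℝ X := bF_mem _ hn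
    have hpm' : p' ∈ stdSimplex ℝ X := bF_mem _ hm
    have key : ∀ z, ediam (bV cd g α β C ε n m P P' z) ^ s ≤
        ENNReal.ofReal ((∏ k : Fin m, bTheta g n p p' k (z k)) *
          Real.exp (C * M - (s - D - ε) * c * n)) := by
      intro z
      rcases (bV cd g α β C ε n m P P' z).eq_empty_or_nonempty with h0 | ⟨ω, hω⟩
      · rw [h0, Metric.ediam_empty, ENNReal.zero_rpow_of_pos hs]
        exact zero_le
      · have hd := bV_ediam cd g hM1 hω
        obtain ⟨-, h1, -, h3, h4, h5, h6, h7, h8⟩ := hω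
        have ep : p = bF (cd ω) n := by
          funext x; simp only [hp, bF, hP, h6]
        have ep' : p' = bF (cd ω) m := by
          funext x; simp only [hp', bF, hP', h7]
        have hbits := bBits_le g hα hβ hC hM hD (cd ω) hn h1 hnm h4 h5
        have hprod := bTheta_prod g (cd ω) hn hnm
        rw [h8] at hprod
        rw [ep, ep', hprod, ← Real.exp_add]
        refine (ENNReal.rpow_le_rpow hd hs.le).trans ?_
        rw [ENNReal.ofReal_rpow_of_pos (Real.exp_pos _), ← Real.exp_mul]
        refine ENNReal.ofReal_le_ofReal (Real.exp_le_exp.mpr ?_)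
        have hlow := bS_lower hcα (cd ω) n
        have := mul_le_mul_of_nonneg_left hlow (show 0 ≤ s - D - ε by linarith)
        nlinarith
    calc ∑ z, ediam (bV cd g α β C ε n m P P' z) ^ s
        ≤ ∑ z : Fin m → X ⊕ Y, ENNReal.ofReal ((∏ k : Fin m, bTheta g n p p' k (z k)) *
          Real.exp (C * M - (s - D - ε) * c * n)) := Finset.sum_le_sum fun z _ => key z
      _ = ENNReal.ofReal (∑ z : Fin m → X ⊕ Y, (∏ k : Fin m, bTheta g n p p' k (z k)) *
          Real.exp (C * M - (s - D - ε) * c * n)) := by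
          rw [ENNReal.ofReal_sum_of_nonneg]
          intro z _
          exact mul_nonneg (Finset.prod_nonneg fun k _ => bTheta_nonneg g n hpm.1 hpm'.1 _ _)
            (Real.exp_pos _).le
      _ ≤ _ := by
          refine ENNReal.ofReal_le_ofReal ?_
          rw [← Finset.sum_mul]
          exact mul_le_of_le_one_left (Real.exp_pos _).le (bTheta_prod_sum_le g n m hpm hpm')
  · push Not at hne
    rw [Finset.sum_eq_zero]
    · exact zero_le
    · intro z _
      rw [hne z, Metric.ediam_empty, ENNReal.zero_rpow_of_pos hs]

lemma bV_sum_sigma {X Y Ω : Type*} [Fintype X] [Fintype Y] [MetricSpace Ω] (cd : Ω → ℕ → X)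
    (g : X → Y) {α β : X → ℝ} {c C D M ε s : ℝ} (hc0 : 0 < c) (hC : 0 ≤ C) (hs : 0 < s)
    (hsD : D + ε ≤ s)
    (hcα : ∀ x, c ≤ α x) (hcβ : ∀ x, c ≤ β x)
    (hM : ∀ p ∈ stdSimplex ℝ X, bPhi g β p ≤ M)
    (hD : ∀ p ∈ stdSimplex ℝ X, bE p β ≤ bE p α → bG g α β p ≤ D)
    (hM1 : ∀ ω τ n m, (∀ k < n, cd ω k = cd τ k) → (∀ k < m, g (cd ω k) = g (cd τ k)) →
      dist ω τ ≤ max (Real.exp (-bS α (cd ω) n)) (Real.exp (-bS β (cd ω) m)))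
    (n K : ℕ) :
    ∑' j : (Σ m : Fin (K + 1), Σ _ : (X → Fin (n + 1)) × (X → Fin (K + 1)), (Fin m → X ⊕ Y)),
      ediam (bV cd g α β C ε n j.1 (fun x => (j.2.1.1 x : ℕ)) (fun x => (j.2.1.2 x : ℕ)) j.2.2) ^ s
    ≤ ENNReal.ofReal ((((K + 1) * ((n + 1) ^ Fintype.card X * (K + 1) ^ Fintype.card X) : ℕ) : ℝ) *
      Real.exp (C * M - (s - D - ε) * c * n)) := by
  classical
  rw [ENNReal.tsum_sigma']
  have h1 : ∀ m : Fin (K + 1), ∑' j : (Σ _ : (X → Fin (n + 1)) × (X → Fin (K + 1)),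
      (Fin m → X ⊕ Y)), ediam (bV cd g α β C ε n m (fun x => (j.1.1 x : ℕ))
        (fun x => (j.1.2 x : ℕ)) j.2) ^ s ≤
      ∑' _ : (X → Fin (n + 1)) × (X → Fin (K + 1)),
        ENNReal.ofReal (Real.exp (C * M - (s - D - ε) * c * n)) := by
    intro m
    rw [ENNReal.tsum_sigma']
    refine ENNReal.tsum_le_tsum fun PP => ?_
    have h2 := bV_sum cd g hc0 hC hs hsD hcα hcβ hM hD hM1 n m (fun x => (PP.1 x : ℕ))
        (fun x => (PP.2 x : ℕ))
    rw [← tsum_fintype (L := .unconditional _)] at h2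
    exact h2
  refine (ENNReal.tsum_le_tsum h1).trans ?_
  rw [tsum_fintype, tsum_fintype]
  simp only [Finset.sum_const, Finset.card_univ, Fintype.card_fin, Fintype.card_prod,
    Fintype.card_fun, nsmul_eq_mul]
  rw [← ENNReal.ofReal_natCast, ← ENNReal.ofReal_natCast, ← ENNReal.ofReal_mul (by positivity),
    ← ENNReal.ofReal_mul (by positivity)]
  refine ENNReal.ofReal_le_ofReal (le_of_eq ?_)
  push_cast
  ring

theorem upper_bound {X Y Ω : Type*} [Fintype X] [Fintype Y] [MetricSpace Ω] (cd : Ω → ℕ → X)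
    (g : X → Y) {α β : X → ℝ} {c C D : ℝ} (hc0 : 0 < c) (hC : 0 ≤ C) (hD0 : 0 ≤ D)
    (hcα : ∀ x, c ≤ α x) (hcβ : ∀ x, c ≤ β x)
    (hCα : ∀ x, α x ≤ C) (hCβ : ∀ x, β x ≤ C)
    (hD : ∀ p ∈ stdSimplex ℝ X, bE p β ≤ bE p α → bG g α β p ≤ D)
    (hM1 : ∀ ω τ n m, (∀ k < n, cd ω k = cd τ k) → (∀ k < m, g (cd ω k) = g (cd τ k)) →
      dist ω τ ≤ max (Real.exp (-bS α (cd ω) n)) (Real.exp (-bS β (cd ω) m))) :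
    dimH {ω : Ω | ∃ᶠ n in atTop, bS β (cd ω) n ≤ bS α (cd ω) n} ≤ ENNReal.ofReal D := by
  classical
  borelize Ω
  have hβ : ∀ x, 0 < β x := fun x => hc0.trans_le (hcβ x)
  refine le_of_forall_gt_imp_ge_of_dense fun s' hs' => ?_
  obtain ⟨s, hs1, hs2⟩ := ENNReal.lt_iff_exists_nnreal_btwn.mp hs'
  refine le_trans ?_ hs2.le
  have hsD : D < s := by
    rw [← ENNReal.ofReal_coe_nnreal] at hs1
    exact (ENNReal.ofReal_lt_ofReal_iff_of_nonneg hD0).mp hs1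
  have hs : (0 : ℝ) < s := hD0.trans_lt hsD
  obtain ⟨M, -, hM⟩ := bPhi_bdd g hβ
  set ε : ℝ := (s - D) / 2 with hε
  have hε0 : 0 < ε := by rw [hε]; linarith
  obtain ⟨κ, hκ⟩ := exists_nat_ge (C / c)
  rw [div_le_iff₀ hc0] at hκ
  let ι := Σ n : ℕ, Σ m : Fin (κ * (n + 1) + 1), Σ _ : (X → Fin (n + 1)) × (X → Fin (κ * (n + 1) + 1)),
    (Fin m → X ⊕ Y)
  let V : ι → Set Ω := fun i => bV cd g α β C ε i.1 i.2.1 (fun x => i.2.2.1.1 x)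
    (fun x => i.2.2.1.2 x) i.2.2.2
  apply dimH_le_of_hausdorffMeasure_ne_top
  have : Measure.hausdorffMeasure (s : ℝ) {ω : Ω | ∃ᶠ n in atTop, bS β (cd ω) n ≤ bS α (cd ω) n}
      = 0 := by
    refine hausdorff_zero_of_infinite hs V ?_ _ ?_
    · have hbound : ∀ n : ℕ, ∑' j : (Σ m : Fin (κ * (n + 1) + 1),
          Σ _ : (X → Fin (n + 1)) × (X → Fin (κ * (n + 1) + 1)), (Fin m → X ⊕ Y)), ediam (V ⟨n, j⟩) ^ (s : ℝ)
          ≤ ENNReal.ofReal (((κ + 1 : ℕ) : ℝ) ^ (1 + Fintype.card X) *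
            Real.exp (C * M + (s - D - ε) * c) * (((n + 1 : ℕ) : ℝ) ^ (1 + 2 * Fintype.card X) *
              Real.exp (-((s - D - ε) * c) * ((n + 1 : ℕ) : ℝ)))) := by
        intro n
        refine (bV_sum_sigma cd g hc0 hC hs (by rw [hε]; linarith) hcα hcβ hM hD hM1 n
          (κ * (n + 1))).trans ?_
        refine ENNReal.ofReal_le_ofReal ?_
        have e1 : Real.exp (C * M - (s - D - ε) * c * n) = Real.exp (C * M + (s - D - ε) * c) *
            Real.exp (-((s - D - ε) * c) * ((n + 1 : ℕ) : ℝ)) := by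
          rw [← Real.exp_add]; congr 1; push_cast; ring
        have e2 : ((κ * (n + 1) + 1 : ℕ) : ℝ) ≤ ((κ + 1 : ℕ) : ℝ) * ((n + 1 : ℕ) : ℝ) := by
          push_cast; nlinarith [show (0 : ℝ) ≤ n by positivity]
        rw [e1]
        set E1 := Real.exp (C * M + (s - D - ε) * c)
        set E2 := Real.exp (-((s - D - ε) * c) * ((n + 1 : ℕ) : ℝ))
        have hE1 : 0 < E1 := Real.exp_pos _
        have hE2 : 0 < E2 := Real.exp_pos _
        push_cast [Nat.cast_mul, Nat.cast_pow] at e2 ⊢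
        calc ((κ : ℝ) * (n + 1) + 1) * (((n : ℝ) + 1) ^ Fintype.card X *
              ((κ : ℝ) * (n + 1) + 1) ^ Fintype.card X) * (E1 * E2)
            ≤ (((κ : ℝ) + 1) * (n + 1)) * (((n : ℝ) + 1) ^ Fintype.card X *
              (((κ : ℝ) + 1) * (n + 1)) ^ Fintype.card X) * (E1 * E2) := by gcongr
          _ = _ := by rw [mul_pow]; ring
      rw [ENNReal.tsum_sigma']
      refine ne_top_of_le_ne_top ?_ (ENNReal.tsum_le_tsum hbound)
      have hsm := (Real.summable_pow_mul_exp_neg_nat_mul (1 + 2 * Fintype.card X)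
        (show 0 < (s - D - ε) * c by rw [hε]; apply mul_pos _ hc0; linarith))
      have hsm' := (((summable_nat_add_iff 1).mpr hsm).mul_left (((κ + 1 : ℕ) : ℝ) ^
        (1 + Fintype.card X) * Real.exp (C * M + (s - D - ε) * c)))
      exact hsm'.tsum_ofReal_ne_top
    · intro ω hω
      have hgood := exists_good g hc0 hcα hcβ hCβ (cd ω) hω hε0
      have hinf := Nat.frequently_atTop_iff_infinite.mp hgood
      refine Set.Infinite.of_image (fun i : ι => i.1) (hinf.mono ?_)
      rintro n ⟨hn, h1, m, hnm, h2, h3, h4⟩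
      have hmK : m < κ * (n + 1) + 1 := by
        have l1 := bS_lower hcβ (cd ω) m
        have l2 := bS_upper hCα (cd ω) n
        have : c * m ≤ c * (κ * (n + 1) : ℝ) := by
          nlinarith [show (0 : ℝ) ≤ n by positivity]
        have := le_of_mul_le_mul_left this hc0
        have : m ≤ κ * (n + 1) := by exact_mod_cast this
        omega
      refine ⟨⟨n, ⟨m, hmK⟩, ⟨fun x => ⟨bCount (cd ω) n x, by have := bCount_le (cd ω) n x; omega⟩,
        fun x => ⟨bCount (cd ω) m x, by have := bCount_le (cd ω) m x; omega⟩⟩,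
        bCode g n m (cd ω)⟩, ?_, rfl⟩
      exact ⟨hn, h1, hnm, h2, h3, h4, rfl, rfl, rfl⟩
  rw [this]
  exact ENNReal.zero_ne_top


lemma rect_measure {X Ω : Type*} [Fintype X] [MeasurableSpace Ω] (ν : Measure Ω) (cd : Ω → ℕ → X)
    {p : X → ℝ} (hp : ∀ x, 0 ≤ p x) (hmeas : ∀ k x, MeasurableSet {ω | cd ω k = x})
    (hcyl : ∀ (m : ℕ) (w : Fin m → X), ν {ω | ∀ k : Fin m, cd ω k = w k} =
      ENNReal.ofReal (∏ k : Fin m, p (w k))) (m : ℕ) (S : ℕ → Finset X) :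
    ν {ω | ∀ k < m, cd ω k ∈ S k} = ENNReal.ofReal (∏ k ∈ Finset.range m, ∑ x ∈ S k, p x) := by
  classical
  have h1 : {ω | ∀ k < m, cd ω k ∈ S k} =
      ⋃ w ∈ Fintype.piFinset (fun k : Fin m => S k), {ω | ∀ k : Fin m, cd ω k = w k} := by
    ext ω
    simp only [mem_ofPred_eq, mem_iUnion, Fintype.mem_piFinset, exists_prop]
    constructor
    · intro h
      exact ⟨fun k => cd ω k, fun k => h k k.2, fun k => rfl⟩
    · rintro ⟨w, hw, h⟩ k hk
      have := h ⟨k, hk⟩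
      simp only at this
      rw [this]
      exact hw ⟨k, hk⟩
  rw [h1, measure_biUnion_finset]
  · simp_rw [hcyl]
    rw [← ENNReal.ofReal_sum_of_nonneg (fun w _ => Finset.prod_nonneg fun k _ => hp _),
      ← Finset.prod_univ_sum (fun k : Fin m => S k) (fun _ x => p x), Finset.prod_range]
  · intro w _ w' _ hne
    rw [Function.onFun, Set.disjoint_left]
    intro ω h h'
    exact hne (funext fun k => (h k).symm.trans (h' k))
  · intro w _
    have : {ω | ∀ k : Fin m, cd ω k = w k} = ⋂ k : Fin m, {ω | cd ω k = w k} := by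
      ext; simp
    rw [this]
    exact MeasurableSet.iInter fun k => hmeas _ _

lemma slln {X Ω : Type*} [Fintype X] [MeasurableSpace Ω] (ν : Measure Ω) [IsProbabilityMeasure ν]
    (cd : Ω → ℕ → X)
    {p : X → ℝ} (hp : p ∈ stdSimplex ℝ X) (hmeas : ∀ k x, MeasurableSet {ω | cd ω k = x})
    (hcyl : ∀ (m : ℕ) (w : Fin m → X), ν {ω | ∀ k : Fin m, cd ω k = w k} =
      ENNReal.ofReal (∏ k : Fin m, p (w k))) (h : X → ℝ) :
    ∀ᵐ ω ∂ν, Tendsto (fun n : ℕ => bS h (cd ω) n / n) atTop (nhds (bE p h)) := by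
  classical
  let _ : MeasurableSpace X := ⊤
  have hX : ∀ k, Measurable (fun ω => cd ω k) := fun k => measurable_to_countable' fun x => hmeas k x
  have hrect := rect_measure ν cd hp.1 hmeas hcyl
  have h2 : ∀ k l, k ≠ l → ∀ s t : Set X, ν ((fun ω => cd ω k) ⁻¹' s ∩ (fun ω => cd ω l) ⁻¹' t) =
      ENNReal.ofReal ((∑ x ∈ s.toFinset, p x) * ∑ x ∈ t.toFinset, p x) := by
    intro k l hkl s t
    have := hrect (k + l + 1) (fun i => if i = k then s.toFinset else
      if i = l then t.toFinset else Finset.univ)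
    have e1 : {ω | ∀ i < k + l + 1, cd ω i ∈ (if i = k then s.toFinset else
      if i = l then t.toFinset else Finset.univ)} =
        ((fun ω => cd ω k) ⁻¹' s ∩ (fun ω => cd ω l) ⁻¹' t) := by
      ext ω
      simp only [mem_ofPred_eq, mem_inter_iff, mem_preimage]
      constructor
      · intro h
        have h1 := h k (by omega)
        have h2 := h l (by omega)
        rw [if_neg hkl.symm] at h2
        simp at h1 h2
        exact ⟨h1, h2⟩
      · rintro ⟨h1, h2⟩ i -
        split_ifs with hi hj
        · simpa [hi] using h1
        · simpa [hj] using h2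
        · simp
    rw [← e1, this]
    congr 1
    have e2 : ∀ i, ∑ x ∈ (if i = k then s.toFinset else
      if i = l then t.toFinset else Finset.univ), p x = (if i = k then ∑ x ∈ s.toFinset, p x else 1) *
        (if i = l then ∑ x ∈ t.toFinset, p x else 1) := by
      intro i
      split_ifs with hi hj hj
      · exact absurd (hi.symm.trans hj) hkl
      · simp
      · simp
      · simp [hp.2]
    simp_rw [e2]
    rw [Finset.prod_mul_distrib, Finset.prod_ite_eq', Finset.prod_ite_eq',
      if_pos (Finset.mem_range.mpr (by omega)), if_pos (Finset.mem_range.mpr (by omega))]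
  have h1 : ∀ k, ∀ s : Set X, ν ((fun ω => cd ω k) ⁻¹' s) =
      ENNReal.ofReal (∑ x ∈ s.toFinset, p x) := by
    intro k s
    have := h2 k (k + 1) (by omega) s univ
    simpa [hp.2] using this
  have hsn : ∀ s : Set X, 0 ≤ ∑ x ∈ s.toFinset, p x := fun s => Finset.sum_nonneg fun x _ => hp.1 x
  have hmapeq : ∀ k, ν.map (fun ω => cd ω k) = ν.map (fun ω => cd ω 0) := by
    intro k
    ext s hs
    rw [Measure.map_apply (hX k) hs, Measure.map_apply (hX 0) hs, h1, h1]
  have hh : Measurable h := fun _ _ => trivial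
  have hmean : ∫ ω, h (cd ω 0) ∂ν = bE p h := by
    have hprob : IsProbabilityMeasure (ν.map (fun ω => cd ω 0)) :=
      Measure.isProbabilityMeasure_map (hX 0).aemeasurable
    rw [← integral_map (φ := fun ω => cd ω 0) (hX 0).aemeasurable (f := h) hh.aestronglyMeasurable,
      integral_fintype (Integrable.of_finite)]
    unfold bE
    refine Finset.sum_congr rfl fun x _ => ?_
    rw [smul_eq_mul, Measure.real, Measure.map_apply (hX 0) trivial, h1]
    simp [hp.1 x]
  have := ProbabilityTheory.strong_law_ae_real (μ := ν) (fun k ω => h (cd ω k)) ?_ ?_ ?_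
  · rw [hmean] at this
    exact this
  · have hprob : IsProbabilityMeasure (ν.map (fun ω => cd ω 0)) :=
      Measure.isProbabilityMeasure_map (hX 0).aemeasurable
    have : Integrable h (ν.map (fun ω => cd ω 0)) := Integrable.of_finite
    exact this.comp_measurable (hX 0)
  · intro k l hkl
    have : ProbabilityTheory.IndepFun (fun ω => cd ω k) (fun ω => cd ω l) ν := by
      rw [ProbabilityTheory.indepFun_iff_measure_inter_preimage_eq_mul]
      intro s t _ _
      rw [h2 k l hkl, h1, h1, ENNReal.ofReal_mul (hsn s)]
    exact this.comp hh hh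
  · intro k
    have : ProbabilityTheory.IdentDistrib (fun ω => cd ω k) (fun ω => cd ω 0) ν ν :=
      ⟨(hX k).aemeasurable, (hX 0).aemeasurable, hmapeq k⟩
    exact this.comp hh

lemma ratio_tendsto {T : ℕ → ℝ} {a C : ℝ} (ha : 0 < a) (hC : 0 < C) (hT : ∀ n, T n ≤ C * n)
    (hlim : Tendsto (fun n : ℕ => T n / n) atTop (nhds a)) {N : ℝ → ℕ}
    (hN : ∀ R, 0 ≤ R → R ≤ T (N R) ∧ T (N R) ≤ R + C) :
    Tendsto N atTop atTop ∧ Tendsto (fun R => (N R : ℝ) / R) atTop (nhds (1 / a)) := by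
  have h1 : Tendsto N atTop atTop := by
    rw [← tendsto_natCast_atTop_iff (R := ℝ)]
    have : Tendsto (fun R : ℝ => R / C) atTop atTop := tendsto_id.atTop_div_const hC
    refine tendsto_atTop_mono' _ ?_ this
    filter_upwards [eventually_ge_atTop (0 : ℝ)] with R hR
    rw [div_le_iff₀ hC]
    linarith [(hN R hR).1, hT (N R)]
  refine ⟨h1, ?_⟩
  have h2 : Tendsto (fun R => T (N R) / (N R : ℝ)) atTop (nhds a) := hlim.comp h1
  have h3 : Tendsto (fun R => T (N R) / R) atTop (nhds 1) := by
    have hup : Tendsto (fun R : ℝ => 1 + C / R) atTop (nhds 1) := by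
      have := (tendsto_const_nhds (x := C)).div_atTop tendsto_id
      simpa using (tendsto_const_nhds (x := (1 : ℝ))).add this
    refine tendsto_of_tendsto_of_tendsto_of_le_of_le' tendsto_const_nhds hup ?_ ?_
    · filter_upwards [eventually_gt_atTop (0 : ℝ)] with R hR
      rw [le_div_iff₀ hR]
      linarith [(hN R hR.le).1]
    · filter_upwards [eventually_gt_atTop (0 : ℝ)] with R hR
      rw [div_le_iff₀ hR, add_mul, div_mul_cancel₀ _ hR.ne']
      linarith [(hN R hR.le).2]
  have h4 := h3.div h2 ha.ne'
  refine h4.congr' ?_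
  filter_upwards [eventually_gt_atTop (0 : ℝ)] with R hR
  have hTp : 0 < T (N R) := lt_of_lt_of_le hR (hN R hR.le).1
  have hNp : (0 : ℝ) < N R := by
    have := hT (N R)
    by_contra hcon
    push Not at hcon
    nlinarith
  simp only [Pi.div_apply]
  field_simp

lemma pointwise_lower {X Y : Type*} [Fintype X] [Fintype Y] (g : X → Y) {α β p : X → ℝ} {c C s : ℝ}
    (hc0 : 0 < c) (hC : 0 < C) (hcα : ∀ x, c ≤ α x) (hcβ : ∀ x, c ≤ β x)
    (hCα : ∀ x, α x ≤ C) (hCβ : ∀ x, β x ≤ C) (hp : p ∈ stdSimplex ℝ X)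
    (hlt : bE p β < bE p α) (hs : s < bG g α β p) (u : ℕ → X)
    (hu : ∀ h ∈ ({α, β, fun x => -Real.log (p x) - -Real.log (bPush g p (g x)),
      fun x => -Real.log (bPush g p (g x))} : Set (X → ℝ)),
      Tendsto (fun n : ℕ => bS h u n / n) atTop (nhds (bE p h))) :
    ∃ N : ℕ, ∀ R : ℝ, N ≤ R → ∃ n m, n ≤ m ∧ (∀ k < n, bS α u k < R) ∧ (∀ k < m, bS β u k < R) ∧
      s * R ≤ bS (fun x => -Real.log (p x) - -Real.log (bPush g p (g x))) u n +
        bS (fun x => -Real.log (bPush g p (g x))) u m := by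
  have hα : 0 < bE p α := bE_pos hp fun x => hc0.trans_le (hcα x)
  have hβ : 0 < bE p β := bE_pos hp fun x => hc0.trans_le (hcβ x)
  have exα : ∀ R : ℝ, ∃ n, 0 ≤ R → (R ≤ bS α u n ∧ bS α u n ≤ R + C) ∧ ∀ k < n, bS α u k < R := by
    intro R
    by_cases hR : 0 ≤ R
    · obtain ⟨n, h1, h2, h3⟩ := bS_hit hc0 hcα hCα u hR
      exact ⟨n, fun _ => ⟨⟨h1, h2⟩, h3⟩⟩
    · exact ⟨0, fun h => absurd h hR⟩
  have exβ : ∀ R : ℝ, ∃ n, 0 ≤ R → (R ≤ bS β u n ∧ bS β u n ≤ R + C) ∧ ∀ k < n, bS β u k < R := by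
    intro R
    by_cases hR : 0 ≤ R
    · obtain ⟨n, h1, h2, h3⟩ := bS_hit hc0 hcβ hCβ u hR
      exact ⟨n, fun _ => ⟨⟨h1, h2⟩, h3⟩⟩
    · exact ⟨0, fun h => absurd h hR⟩
  choose n hn using exα
  choose m hm using exβ
  obtain ⟨n1, n2⟩ := ratio_tendsto hα hC (bS_upper hCα u) (hu α (by simp)) (fun R hR => (hn R hR).1)
  obtain ⟨m1, m2⟩ := ratio_tendsto hβ hC (bS_upper hCβ u) (hu β (by simp)) (fun R hR => (hm R hR).1)
  have hw := hu (fun x => -Real.log (p x) - -Real.log (bPush g p (g x))) (by simp)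
  have hv := hu (fun x => -Real.log (bPush g p (g x))) (by simp)
  have ew : bE p (fun x => -Real.log (p x) - -Real.log (bPush g p (g x))) =
      bEnt p - bEnt (bPush g p) := by
    rw [bEnt_eq, bEnt_push_eq]
    unfold bE
    rw [← Finset.sum_sub_distrib]
    exact Finset.sum_congr rfl fun x _ => by ring
  rw [ew] at hw
  rw [← bEnt_push_eq] at hv
  have hsum := ((hw.comp n1).mul n2).add ((hv.comp m1).mul m2)
  have elim : (bEnt p - bEnt (bPush g p)) * (1 / bE p α) + bEnt (bPush g p) * (1 / bE p β) =
      bG g α β p := by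
    unfold bG bPhi; ring
  rw [elim] at hsum
  have ev1 := hsum.eventually (lt_mem_nhds hs)
  have ev2 := n2.eventually_lt m2 (one_div_lt_one_div_of_lt hβ hlt)
  have ev3 := n1.eventually_gt_atTop 0
  have ev4 := m1.eventually_gt_atTop 0
  obtain ⟨N, hN⟩ := Filter.eventually_atTop.mp
    (ev1.and (ev2.and (ev3.and (ev4.and (eventually_gt_atTop (0 : ℝ))))))
  obtain ⟨N', hN'⟩ := exists_nat_ge N
  refine ⟨N', fun R hR => ⟨n R, m R, ?_⟩⟩
  obtain ⟨a1, a2, a3, a4, a5⟩ := hN R (hN'.trans hR)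
  refine ⟨?_, (hn R a5.le).2, (hm R a5.le).2, ?_⟩
  · have := (div_lt_div_iff_of_pos_right a5).mp a2
    exact_mod_cast this.le
  · have hn' : (0 : ℝ) < n R := by exact_mod_cast a3
    have hm' : (0 : ℝ) < m R := by exact_mod_cast a4
    simp only [Function.comp] at a1
    rw [div_mul_div_cancel₀ hn'.ne', div_mul_div_cancel₀ hm'.ne', ← add_div, lt_div_iff₀ a5] at a1
    exact a1.le

lemma rect_exp {X Y Ω : Type*} [Fintype X] [Fintype Y] [MeasurableSpace Ω] (ν : Measure Ω)
    (cd : Ω → ℕ → X) (g : X → Y)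
    {p : X → ℝ} (hp : ∀ x, 0 < p x) (hmeas : ∀ k x, MeasurableSet {ω | cd ω k = x})
    (hcyl : ∀ (m : ℕ) (w : Fin m → X), ν {ω | ∀ k : Fin m, cd ω k = w k} =
      ENNReal.ofReal (∏ k : Fin m, p (w k))) {n m : ℕ} (hnm : n ≤ m) (u : ℕ → X) (U : Set Ω)
    (hU1 : ∀ τ ∈ U, ∀ k < n, cd τ k = u k) (hU2 : ∀ τ ∈ U, ∀ k < m, g (cd τ k) = g (u k)) :
    ν U ≤ ENNReal.ofReal (Real.exp (-(bS (fun x => -Real.log (p x) - -Real.log (bPush g p (g x))) u n +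
        bS (fun x => -Real.log (bPush g p (g x))) u m))) := by
  classical
  have hsub : U ⊆ {ω | ∀ k < m, cd ω k ∈ (fun k => if k < n then ({u k} : Finset X) else
      Finset.univ.filter (fun x => g x = g (u k))) k} := by
    intro τ hτ k hk
    by_cases hkn : k < n
    · simp [hkn, hU1 τ hτ k hkn]
    · simp [hkn, hU2 τ hτ k hk]
  refine (measure_mono hsub).trans ?_
  rw [rect_measure ν cd (fun x => (hp x).le) hmeas hcyl]
  refine ENNReal.ofReal_le_ofReal (le_of_eq ?_)
  have hfac : ∀ k, ∑ x ∈ (if k < n then ({u k} : Finset X) else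
      Finset.univ.filter (fun x => g x = g (u k))), p x =
      Real.exp (-((if k < n then (-Real.log (p (u k)) - -Real.log (bPush g p (g (u k)))) else 0) +
        -Real.log (bPush g p (g (u k))))) := by
    intro k
    have hq : 0 < bPush g p (g (u k)) := (hp _).trans_le (le_bPush g (fun x => (hp x).le) _)
    split_ifs with hk
    · rw [Finset.sum_singleton]
      ring_nf
      rw [Real.exp_log (hp _)]
    · rw [zero_add, neg_neg, Real.exp_log hq, Finset.sum_filter]
      rfl
  rw [Finset.prod_congr rfl fun k _ => hfac k, ← Real.exp_sum]
  congr 1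
  rw [Finset.sum_neg_distrib, Finset.sum_add_distrib]
  congr 2
  unfold bS
  rw [← Finset.sum_subset (Finset.range_mono hnm)]
  · refine Finset.sum_congr rfl fun k hk => ?_
    have hk' := Finset.mem_range.mp hk
    simp [hk']
  · intro k _ hk
    have hk' : ¬ k < n := by simpa using hk
    simp [hk']


lemma coord_measurable {X Y₁ Y₂ Ω : Type*} [MetricSpace Ω] [MeasurableSpace Ω]
    [BorelSpace Ω] (cd : Ω → ℕ → X) (f : X → Y₁) (g : X → Y₂) {α β : X → ℝ}
    (hinj : ∀ x x', f x = f x' → g x = g x' → x = x')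
    (hM2 : ∀ ω τ k, dist ω τ < Real.exp (-bS α (cd ω) k) → f (cd ω k) = f (cd τ k))
    (hM2' : ∀ ω τ k, dist ω τ < Real.exp (-bS β (cd ω) k) → g (cd ω k) = g (cd τ k))
    (k : ℕ) (x : X) : MeasurableSet {ω | cd ω k = x} := by
  refine IsOpen.measurableSet ?_
  rw [Metric.isOpen_iff]
  intro ω hω
  refine ⟨min (Real.exp (-bS α (cd ω) k)) (Real.exp (-bS β (cd ω) k)),
    lt_min (Real.exp_pos _) (Real.exp_pos _), fun τ hτ => ?_⟩
  rw [Metric.mem_ball, dist_comm] at hτ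
  have h1 := hM2 ω τ k (hτ.trans_le (min_le_left _ _))
  have h2 := hM2' ω τ k (hτ.trans_le (min_le_right _ _))
  have h3 := hinj _ _ h1 h2
  have h4 : cd ω k = x := hω
  exact h3.symm.trans h4

theorem lower_bound {X Y₁ Y₂ Ω : Type*} [Fintype X] [Fintype Y₂] [MetricSpace Ω] [MeasurableSpace Ω]
    [BorelSpace Ω] (cd : Ω → ℕ → X) (f : X → Y₁) (g : X → Y₂) {α β p : X → ℝ} {c C s : ℝ}
    (hc0 : 0 < c) (hC : 0 < C) (hcα : ∀ x, c ≤ α x) (hcβ : ∀ x, c ≤ β x)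
    (hCα : ∀ x, α x ≤ C) (hCβ : ∀ x, β x ≤ C)
    (hinj : ∀ x x', f x = f x' → g x = g x' → x = x')
    (hM2 : ∀ ω τ k, dist ω τ < Real.exp (-bS α (cd ω) k) → f (cd ω k) = f (cd τ k))
    (hM2' : ∀ ω τ k, dist ω τ < Real.exp (-bS β (cd ω) k) → g (cd ω k) = g (cd τ k))
    (hp : p ∈ stdSimplex ℝ X) (hp0 : ∀ x, 0 < p x)
    (hlt : bE p β < bE p α) (hs0 : 0 < s) (hs : s < bG g α β p)
    (ν : Measure Ω) [IsProbabilityMeasure ν]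
    (hcyl : ∀ (m : ℕ) (w : Fin m → X), ν {ω | ∀ k : Fin m, cd ω k = w k} =
      ENNReal.ofReal (∏ k : Fin m, p (w k)))
    (B : Set Ω) (hB : MeasurableSet B) (hνB : ν B = 1) : ENNReal.ofReal s ≤ dimH B := by
  have hmeas := coord_measurable cd f g hinj hM2 hM2'
  set w : X → ℝ := fun x => -Real.log (p x) - -Real.log (bPush g p (g x)) with hw
  set v : X → ℝ := fun x => -Real.log (bPush g p (g x)) with hv
  let E : ℕ → Set Ω := fun N => {ω | ω ∈ B ∧ ∀ R : ℝ, N ≤ R → ∃ n m, n ≤ m ∧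
    (∀ k < n, bS α (cd ω) k < R) ∧ (∀ k < m, bS β (cd ω) k < R) ∧
      s * R ≤ bS w (cd ω) n + bS v (cd ω) m}
  have hae : ∀ᵐ ω ∂ν, ω ∈ ⋃ N, E N := by
    have hB' : ∀ᵐ ω ∂ν, ω ∈ B := by
      rw [ae_iff]
      exact (prob_compl_eq_zero_iff hB).mpr hνB
    filter_upwards [hB', slln ν cd hp hmeas hcyl α, slln ν cd hp hmeas hcyl β,
      slln ν cd hp hmeas hcyl w, slln ν cd hp hmeas hcyl v] with ω h0 h1 h2 h3 h4
    obtain ⟨N, hN⟩ := pointwise_lower g hc0 hC hcα hcβ hCα hCβ hp hlt hs (cd ω) (by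
      intro h hh
      simp only [Set.mem_insert_iff, Set.mem_singleton_iff] at hh
      rcases hh with rfl | rfl | rfl | rfl
      exacts [h1, h2, h3, h4])
    exact mem_iUnion.mpr ⟨N, h0, hN⟩
  obtain ⟨N, hN⟩ : ∃ N, ν (E N) ≠ 0 := by
    by_contra hcon
    push Not at hcon
    have h1 : ν (⋃ N, E N) = 0 := measure_iUnion_null hcon
    have h2 : ν (⋃ N, E N)ᶜ = 0 := hae
    have h3 : ν univ ≤ ν (⋃ N, E N) + ν (⋃ N, E N)ᶜ := by
      rw [← Set.union_compl_self (⋃ N, E N)]; exact measure_union_le _ _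
    rw [h1, h2, measure_univ] at h3
    simp at h3
  have core : ∀ ω ∈ E N, ∀ U : Set Ω, ω ∈ U → ediam U ≤ ENNReal.ofReal (Real.exp (-(N : ℝ))) →
      ν U ≤ ediam U ^ s := by
    intro ω hω U hωU hdU
    have claim : ∀ R : ℝ, N ≤ R → ediam U ≤ ENNReal.ofReal (Real.exp (-R)) →
        ν U ≤ ENNReal.ofReal (Real.exp (-(s * R))) := by
      intro R hR hUR
      obtain ⟨n, m, hnm, h1, h2, h3⟩ := hω.2 R hR
      have hd : ∀ τ ∈ U, dist ω τ ≤ Real.exp (-R) := by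
        intro τ hτ
        have := (Metric.edist_le_ediam_of_mem hωU hτ).trans hUR
        rw [edist_dist] at this
        exact (ENNReal.ofReal_le_ofReal_iff (Real.exp_pos _).le).mp this
      have a2 : ∀ τ ∈ U, ∀ k < m, g (cd τ k) = g (cd ω k) := fun τ hτ k hk =>
        (hM2' ω τ k ((hd τ hτ).trans_lt (Real.exp_lt_exp.mpr (by linarith [h2 k hk])))).symm
      have a1 : ∀ τ ∈ U, ∀ k < n, cd τ k = cd ω k := fun τ hτ k hk =>
        hinj _ _ (hM2 ω τ k ((hd τ hτ).trans_lt
          (Real.exp_lt_exp.mpr (by linarith [h1 k hk])))).symm (a2 τ hτ k (hk.trans_le hnm))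
      refine (rect_exp ν cd g hp0 hmeas hcyl hnm (cd ω) U a1 a2).trans ?_
      exact ENNReal.ofReal_le_ofReal (Real.exp_le_exp.mpr (by linarith))
    by_cases h0 : ediam U = 0
    · rw [h0, ENNReal.zero_rpow_of_pos hs0]
      have hlim : Tendsto (fun R : ℝ => ENNReal.ofReal (Real.exp (-(s * R)))) atTop (nhds 0) := by
        rw [← ENNReal.ofReal_zero]
        refine ENNReal.tendsto_ofReal (Real.tendsto_exp_atBot.comp ?_)
        exact tendsto_neg_atTop_atBot.comp (tendsto_id.const_mul_atTop hs0)
      refine ge_of_tendsto hlim ?_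
      filter_upwards [eventually_ge_atTop (N : ℝ)] with R hR
      exact claim R hR (by rw [h0]; exact zero_le)
    · have htop : ediam U ≠ ⊤ := ne_top_of_le_ne_top ENNReal.ofReal_ne_top hdU
      have hd0 : 0 < (ediam U).toReal := ENNReal.toReal_pos h0 htop
      have hle : (ediam U).toReal ≤ Real.exp (-(N : ℝ)) :=
        ENNReal.toReal_le_of_le_ofReal (Real.exp_pos _).le hdU
      have := claim (-Real.log (ediam U).toReal) (by
        have := (Real.log_le_iff_le_exp hd0).mpr hle
        linarith) (by rw [neg_neg, Real.exp_log hd0, ENNReal.ofReal_toReal htop])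
      refine this.trans (le_of_eq ?_)
      rw [mul_neg, neg_neg, mul_comm, Real.exp_mul, Real.exp_log hd0,
        ← ENNReal.ofReal_rpow_of_pos hd0, ENNReal.ofReal_toReal htop]
  have hHaus : ν (E N) ≤ Measure.hausdorffMeasure s (E N) := by
    rw [Measure.hausdorffMeasure_apply]
    refine le_iSup₂_of_le (ENNReal.ofReal (Real.exp (-(N : ℝ))))
      (ENNReal.ofReal_pos.mpr (Real.exp_pos _)) ?_
    refine le_iInf fun t => le_iInf fun ht => le_iInf fun htd => ?_
    calc ν (E N) ≤ ν (⋃ n, t n ∩ E N) := by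
          refine measure_mono fun ω hω => ?_
          obtain ⟨n, hn⟩ := mem_iUnion.mp (ht hω)
          exact mem_iUnion.mpr ⟨n, hn, hω⟩
      _ ≤ ∑' n, ν (t n ∩ E N) := measure_iUnion_le _
      _ ≤ _ := by
          refine ENNReal.tsum_le_tsum fun n => ?_
          rcases (t n ∩ E N).eq_empty_or_nonempty with h0 | ⟨ω, h1, h2⟩
          · rw [h0, measure_empty]; exact zero_le
          · refine le_iSup_of_le ⟨ω, h1⟩ ?_
            exact (measure_mono inter_subset_left).trans (core ω h2 _ h1 (htd n))
  have hEB : E N ⊆ B := fun ω hω => hω.1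
  refine le_trans ?_ (dimH_mono hEB)
  have : ENNReal.ofReal s = ((s.toNNReal : ℝ≥0) : ℝ≥0∞) := rfl
  rw [this]
  apply le_dimH_of_hausdorffMeasure_ne_zero
  rw [Real.coe_toNNReal s hs0.le]
  intro h0
  rw [h0] at hHaus
  exact hN (le_antisymm hHaus zero_le)

/-- Perturbation to a strictly positive vector with distinct exponents. -/
lemma perturb {X Y₁ Y₂ : Type*} [Fintype X] [Fintype Y₁] [Fintype Y₂] (f : X → Y₁) (g : X → Y₂)
    {α β : X → ℝ} (hα : ∀ x, 0 < α x) (hβ : ∀ x, 0 < β x) (hne : ∃ x, α x ≠ β x) {t : ℝ}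
    {p₀ : X → ℝ} (hp₀ : p₀ ∈ stdSimplex ℝ X)
    (h2 : bE p₀ β ≤ bE p₀ α → t < bG g α β p₀)
    (h1 : bE p₀ α ≤ bE p₀ β → t < bG f β α p₀) :
    ∃ p ∈ stdSimplex ℝ X, (∀ x, 0 < p x) ∧ ((bE p β < bE p α ∧ t < bG g α β p) ∨
      (bE p α < bE p β ∧ t < bG f β α p)) := by
  classical
  obtain ⟨x₀, hx₀⟩ := hne
  have : Nonempty X := ⟨x₀⟩
  let Λ : (X → ℝ) → ℝ := fun p => bE p α - bE p β
  have hΛlin : ∀ (r : ℝ) (p q : X → ℝ), Λ (fun x => (1 - r) * p x + r * q x) =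
      (1 - r) * Λ p + r * Λ q := by
    intro r p q
    simp only [Λ, bE, ← Finset.sum_sub_distrib, Finset.mul_sum, ← Finset.sum_add_distrib]
    exact Finset.sum_congr rfl fun x _ => by ring
  have hmix : ∀ (r : ℝ) (p q : X → ℝ), 0 < r → r < 1 → p ∈ stdSimplex ℝ X → q ∈ stdSimplex ℝ X →
      (fun x => (1 - r) * p x + r * q x) ∈ stdSimplex ℝ X := by
    intro r p q h0 h1 hp hq
    refine ⟨fun x => add_nonneg (mul_nonneg (by linarith) (hp.1 x)) (mul_nonneg h0.le (hq.1 x)), ?_⟩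
    rw [Finset.sum_add_distrib, ← Finset.mul_sum, ← Finset.mul_sum, hp.2, hq.2]
    ring
  obtain ⟨q, hq, hq0, hqΛ⟩ : ∃ q ∈ stdSimplex ℝ X, (∀ x, 0 < q x) ∧ Λ q ≠ 0 := by
    have hcard : (0 : ℝ) < Fintype.card X := by exact_mod_cast Fintype.card_pos
    let q₀ : X → ℝ := fun _ => 1 / (Fintype.card X : ℝ)
    have hq₀ : q₀ ∈ stdSimplex ℝ X := by
      refine ⟨fun x => by positivity, ?_⟩
      simp only [q₀, Finset.sum_const, Finset.card_univ, nsmul_eq_mul]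
      field_simp
    have hq₀p : ∀ x, 0 < q₀ x := fun x => by positivity
    by_cases h0 : Λ q₀ = 0
    · let d : X → ℝ := Pi.single x₀ 1
      have hd : d ∈ stdSimplex ℝ X := single_mem_stdSimplex ℝ x₀
      refine ⟨_, hmix (1 / 2) q₀ d (by norm_num) (by norm_num) hq₀ hd, ?_, ?_⟩
      · intro x
        have := hd.1 x
        have := hq₀p x
        positivity
      · rw [hΛlin, h0]
        have : Λ d = α x₀ - β x₀ := by
          simp only [Λ, bE, d, Pi.single_apply, ite_mul, one_mul, zero_mul]
          simp
        rw [this]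
        have := sub_ne_zero.mpr hx₀
        simpa using this
    · exact ⟨q₀, hq₀, hq₀p, h0⟩
  let P : ℝ → X → ℝ := fun r x => (1 - r) * p₀ x + r * q x
  have hPcont : Continuous P := by
    refine continuous_pi fun x => ?_
    fun_prop
  have hP0 : P 0 = p₀ := by funext x; simp [P]
  have hPtend : Tendsto P (nhdsWithin 0 (Ioo 0 1)) (nhdsWithin p₀ (stdSimplex ℝ X)) := by
    refine tendsto_nhdsWithin_iff.mpr ⟨?_, ?_⟩
    · have := hPcont.tendsto 0
      rw [hP0] at this
      exact this.mono_left nhdsWithin_le_nhds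
    · filter_upwards [self_mem_nhdsWithin] with r hr
      exact hmix r p₀ q hr.1 hr.2 hp₀ hq
  have hΛcont : Continuous Λ := (continuous_bE α).sub (continuous_bE β)
  have hΛt : Tendsto (fun r => Λ (P r)) (nhdsWithin 0 (Ioo 0 1)) (nhds (Λ p₀)) :=
    (hΛcont.tendsto p₀).comp (hPtend.mono_right nhdsWithin_le_nhds)
  have g2 : bE p₀ β ≤ bE p₀ α → ∀ᶠ r in nhdsWithin 0 (Ioo 0 1), t < bG g α β (P r) := fun h =>
    (((continuousOn_bG g hα hβ) p₀ hp₀).tendsto.comp hPtend).eventually (lt_mem_nhds (h2 h))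
  have g1 : bE p₀ α ≤ bE p₀ β → ∀ᶠ r in nhdsWithin 0 (Ioo 0 1), t < bG f β α (P r) := fun h =>
    (((continuousOn_bG f hβ hα) p₀ hp₀).tendsto.comp hPtend).eventually (lt_mem_nhds (h1 h))
  have hneBot : (nhdsWithin (0 : ℝ) (Ioo 0 1)).NeBot := by
    rw [nhdsWithin_Ioo_eq_nhdsGT one_pos]; infer_instance
  have hself : ∀ᶠ r in nhdsWithin (0 : ℝ) (Ioo 0 1), r ∈ Ioo (0 : ℝ) 1 := self_mem_nhdsWithin
  have hfin : ∀ᶠ r in nhdsWithin (0 : ℝ) (Ioo 0 1), (bE (P r) β < bE (P r) α ∧ t < bG g α β (P r)) ∨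
      (bE (P r) α < bE (P r) β ∧ t < bG f β α (P r)) := by
    rcases lt_trichotomy (Λ p₀) 0 with h | h | h
    · have hh : bE p₀ α ≤ bE p₀ β := by simp only [Λ] at h; linarith
      filter_upwards [g1 hh, hΛt.eventually (gt_mem_nhds h)] with r a1 a2
      exact Or.inr ⟨by simp only [Λ] at a2; linarith, a1⟩
    · have hh1 : bE p₀ α ≤ bE p₀ β := by simp only [Λ] at h; linarith
      have hh2 : bE p₀ β ≤ bE p₀ α := by simp only [Λ] at h; linarith
      filter_upwards [g1 hh1, g2 hh2, hself] with r a1 a2 hr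
      have e : Λ (P r) = r * Λ q := by
        simp only [P]; rw [hΛlin, h]; ring
      have e' : Λ (P r) ≠ 0 := by rw [e]; exact mul_ne_zero hr.1.ne' hqΛ
      rcases lt_or_gt_of_ne e' with l | l
      · exact Or.inr ⟨by simp only [Λ] at l; linarith, a1⟩
      · exact Or.inl ⟨by simp only [Λ] at l; linarith, a2⟩
    · have hh : bE p₀ β ≤ bE p₀ α := by simp only [Λ] at h; linarith
      filter_upwards [g2 hh, hΛt.eventually (lt_mem_nhds h)] with r a1 a2
      exact Or.inl ⟨by simp only [Λ] at a2; linarith, a1⟩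
  obtain ⟨r, hr, hr'⟩ := (hself.and hfin).exists
  refine ⟨P r, hmix r p₀ q hr.1 hr.2 hp₀ hq, fun x => ?_, hr'⟩
  exact add_pos_of_nonneg_of_pos (mul_nonneg (by linarith [hr.2]) (hp₀.1 x)) (mul_pos hr.1 (hq0 x))



lemma bProd_exp {Γ : Type*} (a : Γ → ℝ) (ha : ∀ i, a i ∈ Set.Ioo (0:ℝ) 1) (u : ℕ → Γ) (n : ℕ) :
    ((List.ofFn fun k : Fin n => u k.val).map a).prod
      = Real.exp (-bS (fun i => -Real.log (a i)) u n) := by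
  rw [List.map_ofFn, List.prod_ofFn]
  unfold bS
  rw [Finset.sum_neg_distrib, neg_neg, Real.exp_sum]
  rw [← Fin.prod_univ_eq_prod_range (fun k => Real.exp (Real.log (a (u k)))) n]
  refine Finset.prod_congr rfl fun k _ => ?_
  simp only [Function.comp]
  rw [Real.exp_log (ha _).1]

lemma bS_mono_len {Γ : Type*} (h : Γ → ℝ) (hh : ∀ i, 0 ≤ h i) (u : ℕ → Γ) {m n : ℕ} (hmn : m ≤ n) :
    bS h u m ≤ bS h u n := by
  unfold bS
  exact Finset.sum_le_sum_of_subset_of_nonneg (Finset.range_subset_range.2 hmn)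
    (fun _ _ _ => hh _)

lemma rho_le {Γ : Type*} (a : Γ → ℝ) (ha : ∀ i, a i ∈ Set.Ioo (0:ℝ) 1) (u v : ℕ → Γ) (n : ℕ)
    (h : ∀ k < n, u k = v k) :
    rhoDist (fun L => (L.map a).prod) u v ≤ Real.exp (-bS (fun i => -Real.log (a i)) u n) := by
  classical
  unfold rhoDist
  by_cases huv : u = v
  · simp only [huv, dite_true]
    positivity
  · simp only [huv, dite_false]
    rw [bProd_exp a ha]
    apply Real.exp_le_exp.2
    apply neg_le_neg
    apply bS_mono_len
    · intro i
      have := Real.log_neg (ha i).1 (ha i).2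
      linarith
    · rw [Nat.le_find_iff]
      intro m hm
      simpa using h m hm

lemma rho_lt {Γ : Type*} (a : Γ → ℝ) (ha : ∀ i, a i ∈ Set.Ioo (0:ℝ) 1) (u v : ℕ → Γ) (n : ℕ)
    (h : rhoDist (fun L => (L.map a).prod) u v
      < Real.exp (-bS (fun i => -Real.log (a i)) u n)) : u n = v n := by
  classical
  unfold rhoDist at h
  by_cases huv : u = v
  · rw [huv]
  · simp only [huv, dite_false] at h
    rw [bProd_exp a ha] at h
    by_contra hne
    have hfind : Nat.find (Function.ne_iff.mp huv) ≤ n := Nat.find_min' _ hne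
    have h1 := Real.exp_lt_exp.1 h
    have h2 := bS_mono_len (fun i => -Real.log (a i)) (fun i => by
      have := Real.log_neg (ha i).1 (ha i).2
      linarith) u hfind
    linarith

lemma bG_swap {X Y₁ Y₂ : Type*} [Fintype X] [Fintype Y₁] [Fintype Y₂] (f : X → Y₁) (g : X → Y₂)
    {α β : X → ℝ} {p : X → ℝ} (h : bE p α = bE p β) : bG g α β p = bG f β α p := by
  unfold bG bPhi
  rw [h]
  ring

/-- Generic form of the main theorem. -/
lemma main_generic {X Y₁ Y₂ Ω : Type*} [Fintype X] [Nonempty X] [Fintype Y₁] [Fintype Y₂]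
    [MetricSpace Ω] [MeasurableSpace Ω] [BorelSpace Ω]
    (cd : Ω → ℕ → X) (f : X → Y₁) (g : X → Y₂) {α β : X → ℝ}
    (hα : ∀ x, 0 < α x) (hβ : ∀ x, 0 < β x) (hne : ∃ x, α x ≠ β x)
    (hinj : ∀ x x', f x = f x' → g x = g x' → x = x')
    (hd : ∀ ω τ n m, (∀ k < n, f (cd ω k) = f (cd τ k)) → (∀ k < m, g (cd ω k) = g (cd τ k)) →
      dist ω τ ≤ max (Real.exp (-bS α (cd ω) n)) (Real.exp (-bS β (cd ω) m)))
    (hM2 : ∀ ω τ k, dist ω τ < Real.exp (-bS α (cd ω) k) → f (cd ω k) = f (cd τ k))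
    (hM2' : ∀ ω τ k, dist ω τ < Real.exp (-bS β (cd ω) k) → g (cd ω k) = g (cd τ k))
    (t : ℝ) (ht : t < (dimH (univ : Set Ω)).toReal) :
    ∃ p ∈ stdSimplex ℝ X, (∀ x, 0 < p x) ∧ bE p α ≠ bE p β ∧
      ∀ ν : Measure Ω, IsProbabilityMeasure ν →
        (∀ (m : ℕ) (w : Fin m → X), ν {ω | ∀ k : Fin m, cd ω k = w k}
          = ENNReal.ofReal (∏ k, p (w k))) → t < (dimHMeasure ν).toReal := by
  classical
  obtain ⟨x1, hx1⟩ := Finite.exists_min α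
  obtain ⟨x2, hx2⟩ := Finite.exists_min β
  obtain ⟨y1, hy1⟩ := Finite.exists_max α
  obtain ⟨y2, hy2⟩ := Finite.exists_max β
  set c := min (α x1) (β x2) with hcdef
  set C := max (α y1) (β y2) with hCdef
  have hc0 : 0 < c := lt_min (hα _) (hβ _)
  have hC : 0 < C := lt_of_lt_of_le (hα y1) (le_max_left _ _)
  have hcα : ∀ x, c ≤ α x := fun x => (min_le_left _ _).trans (hx1 x)
  have hcβ : ∀ x, c ≤ β x := fun x => (min_le_right _ _).trans (hx2 x)
  have hCα : ∀ x, α x ≤ C := fun x => (hy1 x).trans (le_max_left _ _)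
  have hCβ : ∀ x, β x ≤ C := fun x => (hy2 x).trans (le_max_right _ _)
  rcases lt_or_ge t 0 with ht0 | ht0
  · obtain ⟨x0⟩ := ‹Nonempty X›
    obtain ⟨p, hp, hp0, hcase⟩ := perturb (t := min (bG g α β (Pi.single x0 1))
        (bG f β α (Pi.single x0 1)) - 1) f g hα hβ hne
      (single_mem_stdSimplex ℝ x0)
      (fun _ => by linarith [min_le_left (bG g α β (Pi.single x0 1)) (bG f β α (Pi.single x0 1))])
      (fun _ => by linarith [min_le_right (bG g α β (Pi.single x0 1)) (bG f β α (Pi.single x0 1))])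
    refine ⟨p, hp, hp0, ?_, fun ν _ _ => ht0.trans_le ENNReal.toReal_nonneg⟩
    rcases hcase with h | h
    · exact h.1.ne'
    · exact h.1.ne
  · have htop : dimH (univ : Set Ω) ≠ ⊤ := by
      intro h
      rw [h] at ht
      simp at ht
      linarith
    have hex : ∃ p₀ ∈ stdSimplex ℝ X, (bE p₀ β ≤ bE p₀ α ∧ t < bG g α β p₀) ∨
        (bE p₀ α ≤ bE p₀ β ∧ t < bG f β α p₀) := by
      by_contra hcon
      push Not at hcon
      have U1 := upper_bound cd g hc0 hC.le ht0 hcα hcβ hCα hCβ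
        (fun p hp h => (hcon p hp).1 h)
        (fun ω τ n m h1 h2 => hd ω τ n m (fun k hk => by rw [h1 k hk]) h2)
      have U2 := upper_bound cd f hc0 hC.le ht0 hcβ hcα hCβ hCα
        (fun p hp h => (hcon p hp).2 h)
        (fun ω τ n m h1 h2 => by
          rw [max_comm]
          exact hd ω τ m n h2 (fun k hk => by rw [h1 k hk]))
      have hun : (univ : Set Ω) = {ω | ∃ᶠ n in atTop, bS β (cd ω) n ≤ bS α (cd ω) n} ∪
          {ω | ∃ᶠ n in atTop, bS α (cd ω) n ≤ bS β (cd ω) n} := by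
        symm
        rw [Set.eq_univ_iff_forall]
        intro ω
        show (∃ᶠ n in atTop, bS β (cd ω) n ≤ bS α (cd ω) n) ∨
          (∃ᶠ n in atTop, bS α (cd ω) n ≤ bS β (cd ω) n)
        rw [← Filter.frequently_or_distrib]
        exact (Filter.Eventually.of_forall fun n => le_total _ _).frequently
      have : dimH (univ : Set Ω) ≤ ENNReal.ofReal t := by
        rw [hun, dimH_union]
        exact max_le U1 U2
      have h3 := ENNReal.toReal_mono ENNReal.ofReal_ne_top this
      rw [ENNReal.toReal_ofReal ht0] at h3
      linarith
    obtain ⟨p₀, hp₀, hp₀c⟩ := hex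
    obtain ⟨p, hp, hp0, hcase⟩ := perturb (t := t) f g hα hβ hne hp₀
      (by
        intro h
        rcases hp₀c with h' | h'
        · exact h'.2
        · rw [bG_swap f g (le_antisymm h'.1 h)]
          exact h'.2)
      (by
        intro h
        rcases hp₀c with h' | h'
        · rw [← bG_swap f g (le_antisymm h h'.1)]
          exact h'.2
        · exact h'.2)
    refine ⟨p, hp, hp0, ?_, ?_⟩
    · rcases hcase with h | h
      · exact h.1.ne'
      · exact h.1.ne
    · intro ν hν hcyl
      have key : ∃ s, t < s ∧ ∀ B : Set Ω, MeasurableSet B → ν B = 1 →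
          ENNReal.ofReal s ≤ dimH B := by
        rcases hcase with h | h
        · obtain ⟨s, hs1, hs2⟩ := exists_between h.2
          exact ⟨s, hs1, fun B hB hB1 => lower_bound cd f g hc0 hC hcα hcβ hCα hCβ hinj hM2 hM2'
            hp hp0 h.1 (ht0.trans_lt hs1) hs2 ν hcyl B hB hB1⟩
        · obtain ⟨s, hs1, hs2⟩ := exists_between h.2
          exact ⟨s, hs1, fun B hB hB1 => lower_bound cd g f hc0 hC hcβ hcα hCβ hCα
            (fun x x' h1 h2 => hinj x x' h2 h1) hM2' hM2
            hp hp0 h.1 (ht0.trans_lt hs1) hs2 ν hcyl B hB hB1⟩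
      obtain ⟨s, hts, hs⟩ := key
      have h1 : ENNReal.ofReal s ≤ dimHMeasure ν := by
        apply le_sInf
        rintro _ ⟨B, hB, hB1, rfl⟩
        exact hs B hB hB1
      have h2 : dimHMeasure ν ≤ dimH (univ : Set Ω) :=
        sInf_le ⟨univ, MeasurableSet.univ, measure_univ, rfl⟩
      have h3 : dimHMeasure ν ≠ ⊤ := ne_top_of_le_ne_top htop h2
      have h4 := ENNReal.toReal_mono h3 h1
      rw [ENNReal.toReal_ofReal (ht0.trans hts.le)] at h4
      linarith



/-- If some `a_i ≠ b_j` for `(i,j) ∈ Γ`, then for every `t` below the Hausdorff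
dimension of the symbolic Barański carpet there is a strictly positive probability vector with
distinct Lyapunov exponents whose Bernoulli measure has Hausdorff dimension exceeding `t`. -/
theorem stmt6 {Γ₁ Γ₂ : Type} [Fintype Γ₁] [Fintype Γ₂] [Nonempty Γ₁] [Nonempty Γ₂]
    (A : Set (Γ₁ × Γ₂)) (hA : A.Nonempty)
    (a : Γ₁ → ℝ) (b : Γ₂ → ℝ) (ha : ∀ i, a i ∈ Set.Ioo (0:ℝ) 1) (hb : ∀ j, b j ∈ Set.Ioo (0:ℝ) 1)
    (hab : ∃ ij ∈ A, a ij.1 ≠ b ij.2)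
    [MetricSpace (ℕ → ↥A)]
    (hdist : ∀ ω₁ ω₂ : ℕ → ↥A, dist ω₁ ω₂ = baranskiDist A a b ω₁ ω₂)
    [MeasurableSpace (ℕ → ↥A)] [BorelSpace (ℕ → ↥A)]
    (t : ℝ) (ht : t < (dimH (univ : Set (ℕ → ↥A))).toReal) :
    ∃ p, IsProbVec A p ∧ (∀ ij ∈ A, 0 < p ij) ∧ lyap1 p a ≠ lyap2 p b ∧
      ∀ ν : Measure (ℕ → ↥A), IsProbabilityMeasure ν → IsBernoulli A p ν →
        t < (dimHMeasure ν).toReal := by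
  classical
  have : Nonempty ↥A := hA.to_subtype
  have : Fintype ↥A := Fintype.ofFinite _
  have hsum : ∀ (p : ↥A → ℝ) (h : Γ₁ × Γ₂ → ℝ),
      ∑ ij : Γ₁ × Γ₂, (if hij : ij ∈ A then p ⟨ij, hij⟩ else 0) * h ij
        = ∑ x : ↥A, p x * h x := by
    intro p h
    rw [← Finset.sum_subset (Finset.subset_univ (Finset.univ.map (Function.Embedding.subtype
      (fun ij => ij ∈ A))))]
    · rw [Finset.sum_map]
      refine Finset.sum_congr rfl fun x _ => ?_
      simp
    · intro ij _ hij
      have : ij ∉ A := fun hA' => hij (by simpa using hA')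
      simp [this]
  obtain ⟨p, hp, hp0, hpne, hν⟩ := main_generic (X := ↥A) (Ω := ℕ → ↥A) (fun ω => ω)
    (fun x => (x : Γ₁ × Γ₂).1) (fun x => (x : Γ₁ × Γ₂).2)
    (α := fun x => -Real.log (a (x : Γ₁ × Γ₂).1)) (β := fun x => -Real.log (b (x : Γ₁ × Γ₂).2))
    (fun x => by have := Real.log_neg (ha (x : Γ₁ × Γ₂).1).1 (ha (x : Γ₁ × Γ₂).1).2; linarith)
    (fun x => by have := Real.log_neg (hb (x : Γ₁ × Γ₂).2).1 (hb (x : Γ₁ × Γ₂).2).2; linarith)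
    (by
      obtain ⟨ij, hij, hne⟩ := hab
      refine ⟨⟨ij, hij⟩, fun h => hne ?_⟩
      exact Real.log_injOn_pos (ha _).1 (hb _).1 (neg_injective h))
    (fun x x' h1 h2 => Subtype.ext (Prod.ext h1 h2))
    (fun ω τ n m h1 h2 => by
      rw [hdist]
      exact max_le_max (rho_le a ha _ _ n h1) (rho_le b hb _ _ m h2))
    (fun ω τ k h => by
      rw [hdist] at h
      exact rho_lt a ha _ _ k (lt_of_le_of_lt (le_max_left _ _) h))
    (fun ω τ k h => by
      rw [hdist] at h
      exact rho_lt b hb _ _ k (lt_of_le_of_lt (le_max_right _ _) h))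
    t ht
  refine ⟨fun ij => if hij : ij ∈ A then p ⟨ij, hij⟩ else 0, ⟨?_, ?_, ?_⟩, ?_, ?_, ?_⟩
  · intro ij
    by_cases hij : ij ∈ A
    · simp only [hij, dite_true]
      exact (hp0 _).le
    · simp [hij]
  · intro ij hij
    simp [hij]
  · have := hsum p (fun _ => 1)
    simp only [mul_one] at this
    rw [this]
    exact hp.2
  · intro ij hij
    simp only [hij, dite_true]
    exact hp0 _
  · intro h
    apply hpne
    unfold lyap1 lyap2 at h
    rw [hsum p (fun ij => Real.log (a ij.1)), hsum p (fun ij => Real.log (b ij.2))] at h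
    unfold bE
    simp only [mul_neg, Finset.sum_neg_distrib]
    rw [h]
  · intro ν hν1 hB
    refine hν ν hν1 fun m w => ?_
    have := hB m w
    simp only [Subtype.coe_prop, dite_true, Subtype.coe_eta] at this
    exact this

end
end

section
/- Let (Σ, d[a,b]) be a symbolic Barański carpet over a nonempty alphabet Γ ⊆ Γ₁ × Γ₂. Then dim_H(Σ, d[a,b]) = max_{p ∈ 𝒫(Γ)} g(p,a,b) (in particular the maximum is attained), and moreover there exists q ∈ 𝒫°(Γ) such that dim_H Σ = dim_H ν_q = g(q,a,b), where all Hausdorff dimensions are computed with respect to d[a,b]. -/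
open Set Filter MeasureTheory Metric
open scoped ENNReal NNReal

noncomputable section

set_option linter.unusedSectionVars false



/-- Unnormalised entropy of a nonnegative vector. -/
def bkEnt {Y : Type*} [Fintype Y] (N : Y → ℝ) : ℝ :=
  ∑ y, Real.negMulLog (N y) - Real.negMulLog (∑ y, N y)

/-- Push-forward of a weight vector. -/
def bkPush {X Y : Type*} [Fintype X] [DecidableEq Y] (f : X → Y) (N : X → ℝ) (y : Y) : ℝ :=
  ∑ x, if f x = y then N x else 0

/-- Linear functional. -/
def bkLin {X : Type*} [Fintype X] (α : X → ℝ) (N : X → ℝ) : ℝ := ∑ x, N x * α x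

lemma bk_gibbs {x z : ℝ} (hx : 0 ≤ x) (hz : 0 < z) :
    x * Real.log z + Real.negMulLog x ≤ z - x := by
  rcases hx.eq_or_lt with h | h
  · subst h; simp [hz.le]
  · have h1 := Real.log_le_sub_one_of_pos (div_pos hz h)
    rw [Real.log_div hz.ne' h.ne'] at h1
    have h2 : x * (Real.log z - Real.log x) ≤ x * (z / x - 1) :=
      mul_le_mul_of_nonneg_left h1 hx
    have h3 : x * (z / x - 1) = z - x := by field_simp
    rw [Real.negMulLog]; nlinarith

section
variable {X Y Z : Type*} [Fintype X] [Fintype Y] [Fintype Z] [DecidableEq Y] [DecidableEq Z]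

lemma bkPush_nonneg (f : X → Y) {N : X → ℝ} (hN : ∀ x, 0 ≤ N x) (y : Y) : 0 ≤ bkPush f N y :=
  Finset.sum_nonneg fun x _ => by split_ifs <;> simp [hN]

lemma bkPush_ge (f : X → Y) {N : X → ℝ} (hN : ∀ x, 0 ≤ N x) (x : X) :
    N x ≤ bkPush f N (f x) := by
  unfold bkPush
  refine le_trans (by simp) (Finset.single_le_sum (f := fun x' => if f x' = f x then N x' else 0)
    (fun x' _ => ?_) (Finset.mem_univ x))
  split_ifs <;> simp [hN]

lemma bkPush_sum_mul (f : X → Y) (N : X → ℝ) (g : Y → ℝ) :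
    ∑ y, bkPush f N y * g y = ∑ x, N x * g (f x) := by
  simp only [bkPush, Finset.sum_mul, ite_mul, zero_mul]
  rw [Finset.sum_comm]
  simp

lemma bkPush_sum (f : X → Y) (N : X → ℝ) : ∑ y, bkPush f N y = ∑ x, N x := by
  simpa using bkPush_sum_mul f N (fun _ => 1)

lemma bkPush_add (f : X → Y) (N N' : X → ℝ) :
    bkPush f (N + N') = bkPush f N + bkPush f N' := by
  funext y
  simp only [bkPush, Pi.add_apply, ← Finset.sum_add_distrib]
  exact Finset.sum_congr rfl fun x _ => by split_ifs <;> simp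

lemma bkPush_smul (f : X → Y) (c : ℝ) (N : X → ℝ) :
    bkPush f (c • N) = c • bkPush f N := by
  funext y
  simp [bkPush, Finset.mul_sum]

lemma bkLin_add (α : X → ℝ) (N N' : X → ℝ) : bkLin α (N + N') = bkLin α N + bkLin α N' := by
  simp [bkLin, add_mul, Finset.sum_add_distrib]

lemma bkLin_smul (α : X → ℝ) (c : ℝ) (N : X → ℝ) : bkLin α (c • N) = c * bkLin α N := by
  simp [bkLin, Finset.mul_sum, mul_assoc]

lemma bkEnt_smul {c : ℝ} (N : X → ℝ) : bkEnt (c • N) = c * bkEnt N := by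
  unfold bkEnt
  simp only [Pi.smul_apply, smul_eq_mul, Real.negMulLog_mul, ← Finset.mul_sum,
    Finset.sum_add_distrib, ← Finset.sum_mul]
  ring

lemma bkEnt_push_eq (f : X → Y) (N : X → ℝ) :
    ∑ y, Real.negMulLog (bkPush f N y) = - ∑ x, N x * Real.log (bkPush f N (f x)) := by
  rw [← bkPush_sum_mul f N (fun y => Real.log (bkPush f N y)), ← Finset.sum_neg_distrib]
  exact Finset.sum_congr rfl fun y _ => by rw [Real.negMulLog]; ring

lemma bkEnt_push_le (f : X → Y) {N : X → ℝ} (hN : ∀ x, 0 ≤ N x) :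
    bkEnt (bkPush f N) ≤ bkEnt N := by
  unfold bkEnt
  rw [bkEnt_push_eq, bkPush_sum, ← Finset.sum_neg_distrib]
  gcongr with x
  rcases (hN x).eq_or_lt with h | h
  · simp [← h]
  · have := Real.log_le_log h (bkPush_ge f hN x)
    rw [Real.negMulLog]; nlinarith

lemma bkEnt_nonneg {N : X → ℝ} (hN : ∀ x, 0 ≤ N x) : 0 ≤ bkEnt N := by
  refine le_trans (le_of_eq ?_) (bkEnt_push_le (fun _ => ()) hN)
  simp [bkEnt]

lemma bkEnt_superadd {N N' : X → ℝ} (hN : ∀ x, 0 ≤ N x) (hN' : ∀ x, 0 ≤ N' x) :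
    bkEnt N + bkEnt N' ≤ bkEnt (N + N') := by
  have h0 : 0 ≤ ∑ x, N x := Finset.sum_nonneg fun x _ => hN x
  have h0' : 0 ≤ ∑ x, N' x := Finset.sum_nonneg fun x _ => hN' x
  rcases h0.eq_or_lt with h | h
  · have : N = 0 := by
      funext x
      exact (Finset.sum_eq_zero_iff_of_nonneg fun x _ => hN x).1 h.symm x (Finset.mem_univ x)
    subst this; simp [bkEnt]
  rcases h0'.eq_or_lt with h' | h'
  · have : N' = 0 := by
      funext x
      exact (Finset.sum_eq_zero_iff_of_nonneg fun x _ => hN' x).1 h'.symm x (Finset.mem_univ x)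
    subst this; simp [bkEnt]
  set n := ∑ x, N x with hn
  set n' := ∑ x, N' x with hn'
  have key : ∀ x, Real.negMulLog (N x) + N x * (Real.log n - Real.log (n + n'))
      + (Real.negMulLog (N' x) + N' x * (Real.log n' - Real.log (n + n')))
      ≤ Real.negMulLog ((N + N') x) := by
    intro x
    rcases (add_nonneg (hN x) (hN' x)).eq_or_lt with hs | hs
    · have h1 : N x = 0 := by linarith [hN x, hN' x]
      have h2 : N' x = 0 := by linarith [hN x, hN' x]
      simp [h1, h2]
    · have hnn : 0 < n + n' := by linarith
      have e1 := bk_gibbs (hN x) (z := n / (n + n') * (N x + N' x)) (by positivity)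
      have e2 := bk_gibbs (hN' x) (z := n' / (n + n') * (N x + N' x)) (by positivity)
      rw [Real.log_mul (by positivity) hs.ne', Real.log_div h.ne' hnn.ne'] at e1
      rw [Real.log_mul (by positivity) hs.ne', Real.log_div h'.ne' hnn.ne'] at e2
      have e3 : n / (n + n') * (N x + N' x) + n' / (n + n') * (N x + N' x) = N x + N' x := by
        field_simp
      simp only [Pi.add_apply]
      rw [show Real.negMulLog (N x + N' x) = -(N x + N' x) * Real.log (N x + N' x) from rfl]
      nlinarith
  have := Finset.sum_le_sum fun x (_ : x ∈ Finset.univ) => key x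
  simp only [Finset.sum_add_distrib, ← Finset.sum_mul] at this
  unfold bkEnt
  simp only [Pi.add_apply, Finset.sum_add_distrib, ← hn, ← hn'] at this ⊢
  simp only [Real.negMulLog] at this ⊢
  nlinarith

lemma bkEnt_subadd (f : X → Y) (g : X → Z) (hfg : ∀ x x', f x = f x' → g x = g x' → x = x')
    {N : X → ℝ} (hN : ∀ x, 0 ≤ N x) :
    bkEnt N ≤ bkEnt (bkPush f N) + bkEnt (bkPush g N) := by
  have h0 : 0 ≤ ∑ x, N x := Finset.sum_nonneg fun x _ => hN x
  rcases h0.eq_or_lt with h | h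
  · have : N = 0 := by
      funext x
      exact (Finset.sum_eq_zero_iff_of_nonneg fun x _ => hN x).1 h.symm x (Finset.mem_univ x)
    subst this; simp [bkEnt, bkPush]
  unfold bkEnt
  simp only [bkPush_sum, bkEnt_push_eq]
  set n := ∑ x, N x with hn
  have key : ∀ x, N x * (Real.log (bkPush f N (f x)) + Real.log (bkPush g N (g x)) - Real.log n)
      + Real.negMulLog (N x) ≤ bkPush f N (f x) * bkPush g N (g x) / n - N x := by
    intro x
    rcases (hN x).eq_or_lt with hs | hs
    · rw [← hs]; simp
      exact div_nonneg (mul_nonneg (bkPush_nonneg f hN _) (bkPush_nonneg g hN _)) h.le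
    · have h1 := hs.trans_le (bkPush_ge f hN x)
      have h2 := hs.trans_le (bkPush_ge g hN x)
      have e1 := bk_gibbs (hN x) (z := bkPush f N (f x) * bkPush g N (g x) / n) (by positivity)
      rwa [Real.log_div (by positivity) h.ne', Real.log_mul h1.ne' h2.ne'] at e1
  have hs := Finset.sum_le_sum fun x (_ : x ∈ Finset.univ) => key x
  have hprod : ∑ x, bkPush f N (f x) * bkPush g N (g x) ≤ n * n := by
    have : ∑ yz : Y × Z, bkPush f N yz.1 * bkPush g N yz.2 = n * n := by
      rw [Fintype.sum_prod_type]
      simp only [← Finset.mul_sum, ← Finset.sum_mul, bkPush_sum, hn]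
    rw [← this, ← Finset.sum_image (s := Finset.univ) (g := fun x => (f x, g x))
      (f := fun yz => bkPush f N yz.1 * bkPush g N yz.2)]
    · refine Finset.sum_le_sum_of_subset_of_nonneg (Finset.subset_univ _) fun i _ _ => ?_
      exact mul_nonneg (bkPush_nonneg f hN _) (bkPush_nonneg g hN _)
    · intro x _ x' _ hxx
      simp only [Prod.mk.injEq] at hxx
      exact hfg x x' hxx.1 hxx.2
  have hdiv : (∑ x, bkPush f N (f x) * bkPush g N (g x)) / n ≤ n := by
    rw [div_le_iff₀ h]; exact hprod
  simp only [Finset.sum_add_distrib, Finset.sum_sub_distrib, ← Finset.sum_div, mul_sub, mul_add,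
    ← Finset.sum_mul, ← hn] at hs
  simp only [Real.negMulLog] at hs ⊢
  nlinarith

end

/-- letter counts of a word -/
def bkCnt {Y : Type*} [DecidableEq Y] (u : ℕ → Y) (n : ℕ) (y : Y) : ℝ :=
  ∑ k ∈ Finset.range n, if u k = y then 1 else 0

/-- letter counts of a finite word -/
def bkWcnt {Y : Type*} [DecidableEq Y] {n : ℕ} (w : Fin n → Y) (y : Y) : ℝ :=
  ∑ k : Fin n, if w k = y then 1 else 0

section
variable {X Y : Type*} [Fintype X] [Fintype Y] [DecidableEq X] [DecidableEq Y]

lemma bkCnt_eq (u : ℕ → Y) (n : ℕ) : bkCnt u n = bkWcnt (fun k : Fin n => u k) := by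
  funext y; exact Finset.sum_range _

lemma bkCnt_nonneg (u : ℕ → Y) (n : ℕ) (y : Y) : 0 ≤ bkCnt u n y :=
  Finset.sum_nonneg fun k _ => by split_ifs <;> simp

lemma bkCnt_sum_mul (u : ℕ → Y) (n : ℕ) (g : Y → ℝ) :
    ∑ y, bkCnt u n y * g y = ∑ k ∈ Finset.range n, g (u k) := by
  simp only [bkCnt, Finset.sum_mul, ite_mul, zero_mul, one_mul]
  rw [Finset.sum_comm]; simp

lemma bkLin_cnt (u : ℕ → Y) (n : ℕ) (g : Y → ℝ) :
    bkLin g (bkCnt u n) = ∑ k ∈ Finset.range n, g (u k) := bkCnt_sum_mul u n g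

lemma bkPush_cnt (f : X → Y) (u : ℕ → X) (n : ℕ) :
    bkPush f (bkCnt u n) = bkCnt (fun k => f (u k)) n := by
  funext y
  have := bkCnt_sum_mul u n (fun x => if f x = y then 1 else 0)
  simpa [bkPush, bkCnt] using this

lemma bkCnt_add (u : ℕ → Y) (n l : ℕ) :
    bkCnt u (n + l) = bkCnt u n + bkCnt (fun k => u (n + k)) l := by
  funext y; simp only [bkCnt, Finset.sum_range_add, Pi.add_apply]

lemma bkWcnt_sum_mul {n : ℕ} (w : Fin n → Y) (g : Y → ℝ) :
    ∑ y, bkWcnt w y * g y = ∑ k, g (w k) := by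
  simp only [bkWcnt, Finset.sum_mul, ite_mul, zero_mul, one_mul]
  rw [Finset.sum_comm]; simp

lemma bkWcnt_pos {n : ℕ} (w : Fin n → Y) (k : Fin n) : 0 < bkWcnt w (w k) := by
  unfold bkWcnt
  refine lt_of_lt_of_le one_pos (le_trans (by simp) (Finset.single_le_sum
    (f := fun k' => if w k' = w k then (1 : ℝ) else 0) (fun k' _ => ?_) (Finset.mem_univ k)))
  split_ifs <;> simp

lemma bkWcnt_sum {n : ℕ} (w : Fin n → Y) : ∑ y, bkWcnt w y = n := by
  simpa using bkWcnt_sum_mul w (fun _ => 1)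

lemma bk_exp_neg_ent {n : ℕ} (w : Fin n → Y) :
    Real.exp (-bkEnt (bkWcnt w)) = ∏ k, (bkWcnt w (w k) / n) := by
  rcases Nat.eq_zero_or_pos n with h | h
  · subst h; simp [bkEnt, bkWcnt]
  have hn : (0 : ℝ) < n := by exact_mod_cast h
  have : -bkEnt (bkWcnt w) = ∑ k, Real.log (bkWcnt w (w k) / n) := by
    rw [← bkWcnt_sum_mul w (fun y => Real.log (bkWcnt w y / n))]
    unfold bkEnt
    have e : ∀ y, bkWcnt w y * Real.log (bkWcnt w y / n) =
        - Real.negMulLog (bkWcnt w y) - bkWcnt w y * Real.log n := by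
      intro y
      by_cases h0 : bkWcnt w y = 0
      · simp [h0]
      · rw [Real.log_div h0 hn.ne', Real.negMulLog]; ring
    simp only [e, Finset.sum_sub_distrib, ← Finset.sum_mul, bkWcnt_sum, Finset.sum_neg_distrib]
    rw [show Real.negMulLog (n : ℝ) = - n * Real.log n from rfl]; ring
  rw [this, Real.exp_sum]
  exact Finset.prod_congr rfl fun k _ => Real.exp_log (div_pos (bkWcnt_pos w k) hn)

lemma bk_count {n : ℕ} :
    ∑ w : Fin n → Y, Real.exp (-bkEnt (bkWcnt w)) ≤ ((n : ℝ) + 1) ^ Fintype.card Y := by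
  let ty : (Fin n → Y) → (Y → Fin (n + 1)) := fun w y =>
    ⟨(Finset.univ.filter fun k => w k = y).card,
      Nat.lt_succ_of_le ((Finset.card_le_univ _).trans (by simp))⟩
  have hty : ∀ w y, bkWcnt w y = ((ty w y : ℕ) : ℝ) := by
    intro w y; simp [bkWcnt, ty]
  rw [← Finset.sum_fiberwise (s := Finset.univ) (g := ty)]
  calc _ ≤ ∑ t : Y → Fin (n + 1), (1 : ℝ) := by
        refine Finset.sum_le_sum fun t _ => ?_
        by_cases hne : ∃ w0, ty w0 = t
        · obtain ⟨w0, hw0⟩ := hne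
          have hs : ∑ y, ((t y : ℕ) : ℝ) = n := by
            rw [← bkWcnt_sum w0]
            exact Finset.sum_congr rfl fun y _ => by rw [hty, hw0]
          have e : ∀ w ∈ Finset.univ.filter (fun w => ty w = t),
              Real.exp (-bkEnt (bkWcnt w)) = ∏ k, (((t (w k) : ℕ) : ℝ) / n) := by
            intro w hw
            rw [bk_exp_neg_ent]
            refine Finset.prod_congr rfl fun k _ => ?_
            rw [hty, (Finset.mem_filter.1 hw).2]
          rw [Finset.sum_congr rfl e]
          calc _ ≤ ∑ w : Fin n → Y, ∏ k, (((t (w k) : ℕ) : ℝ) / n) :=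
                Finset.sum_le_sum_of_subset_of_nonneg (Finset.filter_subset _ _)
                  fun w _ _ => Finset.prod_nonneg fun k _ => by positivity
            _ = ∏ k : Fin n, ∑ y : Y, (((t y : ℕ) : ℝ) / n) := by
                rw [Finset.prod_univ_sum, Fintype.piFinset_univ]
            _ ≤ 1 := by
                rw [← Finset.sum_div, hs]
                refine Finset.prod_le_one (fun _ _ => by positivity) fun _ _ => ?_
                exact div_self_le_one _
        · rw [Finset.sum_eq_zero]; · exact zero_le_one
          intro w hw
          exact absurd ⟨w, (Finset.mem_filter.1 hw).2⟩ hne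
    _ = _ := by simp
end




section
variable {X Y Z : Type*} [Fintype X] [Fintype Y] [Fintype Z] [DecidableEq X] [DecidableEq Y]
  [DecidableEq Z]

/-- The set of points having infinitely many good approximate squares. -/
def bkGood (f : X → Y) (α β : X → ℝ) (K : ℕ) (s' : ℝ) : Set (ℕ → X) :=
  {ω | ∃ᶠ n in atTop, ∃ l ≤ K * (n + 1),
    bkEnt (bkCnt ω n) + bkEnt (bkCnt (fun k => f (ω (n + k))) l) ≤
      s' * min (bkLin α (bkCnt ω (n + l))) (bkLin β (bkCnt ω n))}

lemma bk_lin_cnt_ge {α : X → ℝ} {c : ℝ} (hα : ∀ x, c ≤ α x) (ω : ℕ → X) (n : ℕ) :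
    c * n ≤ bkLin α (bkCnt ω n) := by
  rw [bkLin_cnt]
  calc c * n = ∑ k ∈ Finset.range n, c := by simp; ring
    _ ≤ _ := Finset.sum_le_sum fun k _ => hα _

lemma bk_lin_cnt_le {α : X → ℝ} {c : ℝ} (hα : ∀ x, α x ≤ c) (ω : ℕ → X) (n : ℕ) :
    bkLin α (bkCnt ω n) ≤ c * n := by
  rw [bkLin_cnt]
  calc _ ≤ ∑ k ∈ Finset.range n, c := Finset.sum_le_sum fun k _ => hα _
    _ = c * n := by simp; ring

lemma bk_summable (A : ℕ) {x : ℝ} (h0 : 0 ≤ x) (h1 : x < 1) :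
    Summable fun n : ℕ => ((n : ℝ) + 1) ^ A * x ^ n := by
  rcases h0.eq_or_lt with h | h
  · subst h
    refine summable_of_ne_finset_zero (s := {0}) fun n hn => ?_
    simp at hn; simp [hn]
  have h2 := summable_pow_mul_geometric_of_norm_lt_one (R := ℝ) A (r := x)
    (by rw [Real.norm_eq_abs, abs_of_nonneg h0]; exact h1)
  have h3 := ((summable_nat_add_iff 1).2 h2).mul_left x⁻¹
  refine h3.congr fun n => ?_
  push_cast
  rw [pow_succ]; field_simp

set_option maxHeartbeats 1000000 in
theorem bk_good_null [MetricSpace (ℕ → X)] [MeasurableSpace (ℕ → X)] [BorelSpace (ℕ → X)]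
    (f : X → Y) (α β : X → ℝ) {c : ℝ} (hc : 0 < c) (hα : ∀ x, c ≤ α x) (hβ : ∀ x, c ≤ β x)
    (hd : ∀ (ω ω' : ℕ → X) (n l : ℕ), (∀ k < n, ω k = ω' k) →
      (∀ k < l, f (ω (n + k)) = f (ω' (n + k))) →
      dist ω ω' ≤ Real.exp (-min (bkLin α (bkCnt ω (n + l))) (bkLin β (bkCnt ω n))))
    (K : ℕ) {s' s : ℝ} (hs' : 0 ≤ s') (hs : s' < s) :
    μH[s] (bkGood f α β K s') = 0 := by
  have hs0 : 0 < s := hs'.trans_lt hs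
  set θ : ℝ := (s - s') * c / 3 with hθ
  have hθ0 : 0 < θ := by
    have : 0 < s - s' := by linarith
    positivity
  set x : ℝ := Real.exp (-θ) with hx
  set y : ℝ := Real.exp (-(θ / (K + 1))) with hy
  have hx1 : x < 1 := by rw [hx, Real.exp_lt_one_iff]; linarith
  have hy1 : y < 1 := by
    rw [hy, Real.exp_lt_one_iff]
    have : 0 < θ / (K + 1) := by positivity
    linarith
  have hx0 : 0 < x := Real.exp_pos _
  have hy0 : 0 < y := Real.exp_pos _
  let ι := Σ nl : ℕ × ℕ, (Fin nl.1 → X) × (Fin nl.2 → Y)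
  let t : ℕ → ι → Set (ℕ → X) := fun N i =>
    {ω | N ≤ i.1.1 ∧ i.1.2 ≤ K * (i.1.1 + 1) ∧
      bkEnt (bkCnt ω i.1.1) + bkEnt (bkCnt (fun k => f (ω (i.1.1 + k))) i.1.2) ≤
      s' * min (bkLin α (bkCnt ω (i.1.1 + i.1.2))) (bkLin β (bkCnt ω i.1.1)) ∧
      i.2.1 = (fun k : Fin i.1.1 => ω k) ∧ i.2.2 = (fun k : Fin i.1.2 => f (ω (i.1.1 + k)))}
  have hdiam : ∀ N i, ediam (t N i) ≤ ENNReal.ofReal (Real.exp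
      (-((bkEnt (bkWcnt i.2.1) + bkEnt (bkWcnt i.2.2) + 3 * θ * i.1.1) / s))) := by
    intro N i
    refine ediam_le fun ω hω ω' hω' => ?_
    obtain ⟨h1, h2, h3, h4, h5⟩ := hω
    obtain ⟨h1', h2', h3', h4', h5'⟩ := hω'
    rw [edist_dist]
    refine ENNReal.ofReal_le_ofReal ((hd ω ω' i.1.1 i.1.2 ?_ ?_).trans ?_)
    · intro k hk
      have := h4.symm.trans h4'
      exact congrFun this ⟨k, hk⟩
    · intro k hk
      have := h5.symm.trans h5'
      exact congrFun this ⟨k, hk⟩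
    · rw [Real.exp_le_exp, neg_le_neg_iff, div_le_iff₀ hs0, h4, h5]
      rw [bkCnt_eq ω, bkCnt_eq (fun k => f (ω (i.1.1 + k)))] at h3
      have g1 := bk_lin_cnt_ge hα ω (i.1.1 + i.1.2)
      have g2 := bk_lin_cnt_ge hβ ω i.1.1
      rw [bkCnt_eq ω i.1.1] at g2
      rw [bkCnt_eq ω i.1.1]
      set m := min (bkLin α (bkCnt ω (i.1.1 + i.1.2)))
        (bkLin β (bkWcnt fun k : Fin i.1.1 => ω k)) with hm
      have hmc : c * i.1.1 ≤ m := by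
        refine le_min (le_trans ?_ g1) g2
        push_cast
        nlinarith [(Nat.cast_nonneg i.1.2 : (0:ℝ) ≤ (i.1.2 : ℝ))]
      have : (s - s') * (c * i.1.1) ≤ (s - s') * m :=
        mul_le_mul_of_nonneg_left hmc (by linarith)
      rw [hθ]
      linarith
  have hne : ∀ N i, (t N i).Nonempty → N ≤ i.1.1 ∧ i.1.2 ≤ K * (i.1.1 + 1) := by
    rintro N i ⟨ω, h1, h2, -⟩; exact ⟨h1, h2⟩
  let b : ℕ × ℕ → ℝ := fun nl =>
    Real.exp θ * ((((nl.1 : ℝ) + 1) ^ Fintype.card X * x ^ nl.1) *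
      (((nl.2 : ℝ) + 1) ^ Fintype.card Y * y ^ nl.2))
  have hbsum : Summable b := by
    refine Summable.mul_left _ ?_
    exact Summable.mul_of_nonneg (bk_summable _ hx0.le hx1) (bk_summable _ hy0.le hy1)
      (fun n => by positivity) (fun n => by positivity)
  have hterm : ∀ N i, ediam (t N i) ^ s ≤ ENNReal.ofReal (x ^ N) * ENNReal.ofReal
      (Real.exp θ * (x ^ i.1.1 * y ^ i.1.2) *
        (Real.exp (-bkEnt (bkWcnt i.2.1)) * Real.exp (-bkEnt (bkWcnt i.2.2)))) := by
    intro N i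
    rcases (t N i).eq_empty_or_nonempty with he | he
    · rw [he, ediam_empty, ENNReal.zero_rpow_of_pos hs0]; exact zero_le
    obtain ⟨h1, h2⟩ := hne N i he
    refine (ENNReal.rpow_le_rpow (hdiam N i) hs0.le).trans ?_
    rw [ENNReal.ofReal_rpow_of_pos (Real.exp_pos _), ← Real.exp_mul,
      ← ENNReal.ofReal_mul (by positivity)]
    refine ENNReal.ofReal_le_ofReal ?_
    rw [hx, hy, ← Real.exp_nat_mul, ← Real.exp_nat_mul, ← Real.exp_nat_mul]
    simp only [← Real.exp_add]
    rw [Real.exp_le_exp]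
    rw [neg_mul, div_mul_cancel₀ _ hs0.ne']
    have h1' : (N : ℝ) ≤ i.1.1 := by exact_mod_cast h1
    have h2' : (i.1.2 : ℝ) ≤ K * (i.1.1 + 1) := by exact_mod_cast h2
    have h3 : (i.1.2 : ℝ) * (θ / (K + 1)) ≤ θ * (i.1.1 + 1) := by
      rw [mul_div_assoc', div_le_iff₀ (by positivity)]
      have : (i.1.2 : ℝ) * θ ≤ (K * (i.1.1 + 1)) * θ := mul_le_mul_of_nonneg_right h2' hθ0.le
      have : 0 ≤ θ * ((i.1.1 : ℝ) + 1) := by positivity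
      linarith
    have h4 : θ * N ≤ θ * i.1.1 := mul_le_mul_of_nonneg_left h1' hθ0.le
    linarith
  have hsum : ∀ N, ∑' i, ediam (t N i) ^ s ≤
      ENNReal.ofReal (x ^ N) * ENNReal.ofReal (∑' nl, b nl) := by
    intro N
    calc ∑' i, ediam (t N i) ^ s ≤ ∑' i : ι, ENNReal.ofReal (x ^ N) * ENNReal.ofReal
            (Real.exp θ * (x ^ i.1.1 * y ^ i.1.2) *
            (Real.exp (-bkEnt (bkWcnt i.2.1)) * Real.exp (-bkEnt (bkWcnt i.2.2)))) :=
          ENNReal.tsum_le_tsum fun i => hterm N i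
      _ = ENNReal.ofReal (x ^ N) * ∑' nl : ℕ × ℕ, ∑' wu : (Fin nl.1 → X) × (Fin nl.2 → Y),
          ENNReal.ofReal (Real.exp θ * (x ^ nl.1 * y ^ nl.2) *
        (Real.exp (-bkEnt (bkWcnt wu.1)) * Real.exp (-bkEnt (bkWcnt wu.2)))) := by
          rw [ENNReal.tsum_mul_left, ENNReal.tsum_sigma']
      _ ≤ ENNReal.ofReal (x ^ N) * ∑' nl, ENNReal.ofReal (b nl) := by
          gcongr with nl
          rw [tsum_fintype, ← ENNReal.ofReal_sum_of_nonneg (fun _ _ => by positivity)]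
          refine ENNReal.ofReal_le_ofReal ?_
          rw [← Finset.mul_sum, Fintype.sum_prod_type]
          simp only [← Finset.mul_sum, ← Finset.sum_mul]
          have e1 := bk_count (Y := X) (n := nl.1)
          have e2 := bk_count (Y := Y) (n := nl.2)
          calc _ ≤ Real.exp θ * (x ^ nl.1 * y ^ nl.2) * ((((nl.1 : ℝ) + 1) ^ Fintype.card X) *
                (((nl.2 : ℝ) + 1) ^ Fintype.card Y)) := by
                gcongr
            _ = b nl := by simp only [b]; ring
      _ = _ := by
          rw [ENNReal.ofReal_tsum_of_nonneg (fun nl => by positivity) hbsum]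
  have hlim : Tendsto (fun N : ℕ => ENNReal.ofReal (x ^ N) * ENNReal.ofReal (∑' nl, b nl))
      atTop (nhds 0) := by
    have h1 : Tendsto (fun N : ℕ => ENNReal.ofReal (x ^ N)) atTop (nhds 0) := by
      rw [← ENNReal.ofReal_zero]
      exact ENNReal.tendsto_ofReal (tendsto_pow_atTop_nhds_zero_of_lt_one hx0.le hx1)
    have := ENNReal.Tendsto.mul_const h1 (b := ENNReal.ofReal (∑' nl, b nl))
      (Or.inr ENNReal.ofReal_ne_top)
    simpa using this
  have hmain := Measure.hausdorffMeasure_le_liminf_tsum (β := ℕ) (ι := fun _ => ι) s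
    (bkGood f α β K s') (l := atTop)
    (fun N => ENNReal.ofReal (Real.exp (-(3 * θ / s)) ^ N)) ?_ t ?_ ?_
  · refine le_antisymm (hmain.trans ?_) zero_le
    refine (liminf_le_liminf (Eventually.of_forall hsum)).trans ?_
    rw [hlim.liminf_eq]
  · rw [← ENNReal.ofReal_zero]
    refine ENNReal.tendsto_ofReal (tendsto_pow_atTop_nhds_zero_of_lt_one (Real.exp_pos _).le ?_)
    rw [Real.exp_lt_one_iff]
    have : 0 < 3 * θ / s := by positivity
    linarith
  · refine Eventually.of_forall fun N i => ?_
    rcases (t N i).eq_empty_or_nonempty with he | he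
    · rw [he, ediam_empty]; exact zero_le
    obtain ⟨h1, h2⟩ := hne N i he
    refine (hdiam N i).trans (ENNReal.ofReal_le_ofReal ?_)
    rw [← Real.exp_nat_mul, Real.exp_le_exp]
    have h1' : (N : ℝ) ≤ i.1.1 := by exact_mod_cast h1
    have e1 := bkEnt_nonneg (N := bkWcnt i.2.1) fun y =>
        Finset.sum_nonneg fun k _ => by split_ifs <;> simp
    have e2 := bkEnt_nonneg (N := bkWcnt i.2.2) fun y =>
        Finset.sum_nonneg fun k _ => by split_ifs <;> simp
    have h4 : θ * N ≤ θ * i.1.1 := mul_le_mul_of_nonneg_left h1' hθ0.le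
    have : (N : ℝ) * (3 * θ / s) ≤
        (bkEnt (bkWcnt i.2.1) + bkEnt (bkWcnt i.2.2) + 3 * θ * i.1.1) / s := by
      rw [mul_div_assoc']
      gcongr
      linarith
    linarith
  · refine Eventually.of_forall fun N ω hω => ?_
    obtain ⟨n, hn, l, hl, h⟩ := (frequently_atTop.1 hω) N
    rw [mem_iUnion]
    exact ⟨⟨(n, l), (fun k => ω k, fun k => f (ω (n + k)))⟩, hn, hl, h, rfl, rfl⟩

end




section
variable {X Y Z : Type*} [Fintype X] [Fintype Y] [Fintype Z] [DecidableEq X] [DecidableEq Y]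
  [DecidableEq Z]

/-- The inequality `g₁ ≤ M` in homogeneous form. -/
def bkBd (f : X → Y) (α β : X → ℝ) (M : ℝ) : Prop :=
  ∀ N : X → ℝ, (∀ x, 0 ≤ N x) →
    bkLin β N * bkEnt (bkPush f N) + bkLin α N * (bkEnt N - bkEnt (bkPush f N)) ≤
      M * (bkLin α N * bkLin β N)

lemma bk_lin_succ (α : X → ℝ) (ω : ℕ → X) (n : ℕ) :
    bkLin α (bkCnt ω (n + 1)) = bkLin α (bkCnt ω n) + α (ω n) := by
  rw [bkLin_cnt, bkLin_cnt, Finset.sum_range_succ]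

lemma bk_caseA (f : X → Y) (α β : X → ℝ) {c C M δ : ℝ} {K : ℕ} (hc : 0 < c)
    (hα : ∀ x, c ≤ α x) (hβ : ∀ x, c ≤ β x) (hα' : ∀ x, α x ≤ C) (hβ' : ∀ x, β x ≤ C)
    (hK : C / c ≤ K) (hK1 : 1 ≤ K) (hM : 0 ≤ M) (hδ : 0 < δ) (hbd : bkBd f α β M) (ω : ℕ → X)
    (hA : ∀ᶠ n in atTop, bkLin α (bkCnt ω n) < bkLin β (bkCnt ω (n + 1))) :
    ω ∈ bkGood f α β K (M + 2 * δ) := by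
  have hC : 0 < C := hc.trans_le ((hα (ω 0)).trans (hα' (ω 0)))
  set T1 : ℕ → ℝ := fun n => bkLin α (bkCnt ω n) with hT1
  set T2 : ℕ → ℝ := fun n => bkLin β (bkCnt ω n) with hT2
  set e : ℕ → ℝ := fun n => bkEnt (bkPush f (bkCnt ω n)) with he
  set ψ : ℕ → ℝ := fun n => e n / T1 n with hψ
  have T1ge : ∀ n, c * n ≤ T1 n := fun n => bk_lin_cnt_ge hα ω n
  have T2ge : ∀ n, c * n ≤ T2 n := fun n => bk_lin_cnt_ge hβ ω n
  have T2le : ∀ n, T2 n ≤ C * n := fun n => bk_lin_cnt_le hβ' ω n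
  have T1s : ∀ n, T1 (n + 1) = T1 n + α (ω n) := fun n => bk_lin_succ α ω n
  have T1pos : ∀ n, 0 < n → 0 < T1 n := fun n hn =>
    lt_of_lt_of_le (by positivity) (T1ge n)
  have T2pos : ∀ n, 0 < n → 0 < T2 n := fun n hn =>
    lt_of_lt_of_le (by positivity) (T2ge n)
  have e0 : ∀ n, 0 ≤ e n := fun n => bkEnt_nonneg (bkPush_nonneg f (bkCnt_nonneg ω n))
  have ele : ∀ n, e n ≤ bkEnt (bkCnt ω n) := fun n => bkEnt_push_le f (bkCnt_nonneg ω n)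
  have bd : ∀ n, T2 n * e n + T1 n * (bkEnt (bkCnt ω n) - e n) ≤ M * (T1 n * T2 n) :=
    fun n => hbd _ (bkCnt_nonneg ω n)
  have bd' : ∀ n, 0 < n → ψ n + (bkEnt (bkCnt ω n) - e n) / T2 n ≤ M := by
    intro n hn
    have h1 := T1pos n hn
    have h2 := T2pos n hn
    rw [hψ]; dsimp only
    rw [div_add_div _ _ h1.ne' h2.ne', div_le_iff₀ (by positivity)]
    linarith [bd n]
  have ψ0 : ∀ n, 0 < n → 0 ≤ ψ n := fun n hn => div_nonneg (e0 n) (T1pos n hn).le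
  have ψM : ∀ n, 0 < n → ψ n ≤ M := by
    intro n hn
    have := div_nonneg (sub_nonneg.2 (ele n)) (T2pos n hn).le
    linarith [bd' n hn]
  -- the hitting time
  have hex : ∀ n, ∃ m, T2 n ≤ T1 m := by
    intro n
    obtain ⟨m, hm⟩ := exists_nat_ge (T2 n / c)
    refine ⟨m, le_trans ?_ (T1ge m)⟩
    rw [div_le_iff₀ hc] at hm; linarith
  classical
  set m : ℕ → ℕ := fun n => Nat.find (hex n) with hm
  have m1 : ∀ n, T2 n ≤ T1 (m n) := fun n => Nat.find_spec (hex n)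
  have m2 : ∀ n k, k < m n → T1 k < T2 n := fun n k hk => not_le.1 (Nat.find_min (hex n) hk)
  have T1mono : Monotone T1 := monotone_nat_of_le_succ fun n => by
    rw [T1s]; linarith [hα (ω n)]
  obtain ⟨n0, hn0⟩ := eventually_atTop.1 hA
  have mge : ∀ n, n0 + 1 ≤ n → n ≤ m n := by
    intro n hn
    by_contra hlt
    push Not at hlt
    obtain ⟨k, rfl⟩ : ∃ k, n = k + 1 := ⟨n - 1, by omega⟩
    have h1 := hn0 k (by omega)
    have h2 := m1 (k + 1)
    have h3 : T1 (m (k + 1)) ≤ T1 k := T1mono (by omega)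
    simp only [hT1, hT2] at h1 h2 h3
    linarith
  have hfreq : ∃ᶠ n in atTop, ψ (m n) ≤ ψ n + δ := by
    by_contra hcon
    rw [not_frequently] at hcon
    obtain ⟨n1, hn1⟩ := eventually_atTop.1 hcon
    set n2 := max n1 (n0 + 1) with hn2
    have iter : ∀ k : ℕ, n2 ≤ m^[k] n2 ∧ k * δ ≤ ψ (m^[k] n2) := by
      intro k
      induction k with
      | zero => exact ⟨le_rfl, by simpa using ψ0 n2 (by omega)⟩
      | succ k ih =>
        rw [Function.iterate_succ_apply']
        refine ⟨ih.1.trans (mge _ (by omega)), ?_⟩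
        have := hn1 (m^[k] n2) (by omega)
        push_cast
        linarith [ih.2]
    obtain ⟨k, hk⟩ := exists_nat_gt (M / δ)
    rw [div_lt_iff₀ hδ] at hk
    have h1 := iter k
    linarith [ψM (m^[k] n2) (by omega)]
  have hlarge : ∀ᶠ n : ℕ in atTop, M * C ≤ δ * (c * n) := by
    obtain ⟨k, hk⟩ := exists_nat_ge (M * C / (δ * c))
    rw [div_le_iff₀ (by positivity)] at hk
    refine eventually_atTop.2 ⟨k, fun n hn => ?_⟩
    have : (k : ℝ) ≤ n := by exact_mod_cast hn
    nlinarith [mul_pos hδ hc]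
  refine (hfreq.and_eventually (hlarge.and (eventually_ge_atTop (n0 + 1)))).mono ?_
  rintro n ⟨hψn, hl, hn⟩
  have hnpos : 0 < n := by omega
  have hmn := mge n hn
  obtain ⟨l, hl'⟩ := Nat.exists_eq_add_of_le hmn
  have hmpos : 0 < m n := by omega
  have hT1m : T1 (m n) ≤ T2 n + C := by
    obtain ⟨k, hk⟩ : ∃ k, m n = k + 1 := ⟨m n - 1, by omega⟩
    rw [hk, T1s]
    linarith [m2 n k (by omega), hα' (ω k)]
  refine ⟨l, ?_, ?_⟩
  · obtain ⟨k, hk⟩ : ∃ k, m n = k + 1 := ⟨m n - 1, by omega⟩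
    have h1 := m2 n k (by omega)
    have h2 : c * k ≤ C * n := by linarith [T1ge k, T2le n]
    have h3 : (k : ℝ) ≤ K * n := by
      have : (k : ℝ) ≤ C / c * n := by
        rw [div_mul_eq_mul_div, le_div_iff₀ hc]; linarith
      refine this.trans ?_
      gcongr
    have h4 : k ≤ K * n := by exact_mod_cast h3
    have : l ≤ k + 1 := by omega
    calc l ≤ k + 1 := this
      _ ≤ K * n + K := by omega
      _ = K * (n + 1) := by ring
  · have hmin : min (bkLin α (bkCnt ω (n + l))) (bkLin β (bkCnt ω n)) = T2 n := by
      rw [← hl']; exact min_eq_right (m1 n)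
    rw [hmin]
    have hsup : e n + bkEnt (bkCnt (fun k => f (ω (n + k))) l) ≤ e (m n) := by
      have := bkEnt_superadd (N := bkCnt (fun k => f (ω k)) n)
        (N' := bkCnt (fun k => f (ω (n + k))) l) (bkCnt_nonneg _ _) (bkCnt_nonneg _ _)
      rw [← bkCnt_add (fun k => f (ω k)), ← hl'] at this
      simp only [he, bkPush_cnt]
      exact this
    have hT := T2pos n hnpos
    have h1 : e (m n) = ψ (m n) * T1 (m n) := by
      simp only [hψ]; rw [div_mul_cancel₀ _ (T1pos _ hmpos).ne']
    have h2 : e (m n) ≤ ψ (m n) * T2 n + M * C := by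
      rw [h1]
      have := ψ0 _ hmpos
      have := ψM _ hmpos
      have a1 : ψ (m n) * T1 (m n) ≤ ψ (m n) * (T2 n + C) := by gcongr
      have a2 : ψ (m n) * C ≤ M * C := by gcongr
      linarith
    have h3 : bkEnt (bkCnt ω n) - e n ≤ (M - ψ n) * T2 n := by
      rw [← div_le_iff₀ hT]; linarith [bd' n hnpos]
    have h4 : ψ (m n) * T2 n ≤ (ψ n + δ) * T2 n := by gcongr
    have h5 : M * C ≤ δ * T2 n := hl.trans (by gcongr; exact T2ge n)
    linarith

lemma bk_caseC (f : X → Y) (g : X → Z) (α β : X → ℝ) {c C M δ : ℝ} {K : ℕ} (hc : 0 < c)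
    (hα : ∀ x, c ≤ α x) (hβ : ∀ x, c ≤ β x)
    (hM : 0 ≤ M) (hδ : 0 < δ) (hbd : bkBd f α β M) (hbd' : bkBd g β α M) (ω : ℕ → X)
    (hA : ∃ᶠ n in atTop, |bkLin α (bkCnt ω n) - bkLin β (bkCnt ω n)| ≤ C) :
    ω ∈ bkGood f α β K (M + 2 * δ) := by
  have hlarge : ∀ᶠ n : ℕ in atTop, M * C ≤ δ * (c * n) := by
    obtain ⟨k, hk⟩ := exists_nat_ge (M * C / (δ * c))
    rw [div_le_iff₀ (by positivity)] at hk
    refine eventually_atTop.2 ⟨k, fun n hn => ?_⟩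
    have : (k : ℝ) ≤ n := by exact_mod_cast hn
    nlinarith [mul_pos hδ hc]
  refine (hA.and_eventually (hlarge.and (eventually_ge_atTop 1))).mono ?_
  rintro n ⟨hD, hl, hn⟩
  refine ⟨0, Nat.zero_le _, ?_⟩
  have h0 : bkEnt (bkCnt (fun k => f (ω (n + k))) 0) = 0 := by simp [bkEnt, bkCnt]
  rw [h0, add_zero, add_zero]
  have hn' : (1 : ℝ) ≤ n := by exact_mod_cast hn
  have a1 := bk_lin_cnt_ge hα ω n
  have a2 := bk_lin_cnt_ge hβ ω n
  have b1 := hbd _ (bkCnt_nonneg ω n)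
  have b2 := hbd' _ (bkCnt_nonneg ω n)
  have c1 := bkEnt_nonneg (bkPush_nonneg f (bkCnt_nonneg ω n))
  have c2 := bkEnt_nonneg (bkPush_nonneg g (bkCnt_nonneg ω n))
  set T1 := bkLin α (bkCnt ω n)
  set T2 := bkLin β (bkCnt ω n)
  set E := bkEnt (bkCnt ω n)
  have hcn : 0 < c * n := by positivity
  obtain ⟨d1, d2⟩ := abs_le.1 hD
  rcases le_total T1 T2 with h | h
  · rw [min_eq_left h]
    have hT1 : 0 < T1 := by linarith
    have : T1 * E ≤ T1 * (M * T2) := by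
      nlinarith [mul_nonneg (sub_nonneg.2 h) c1]
    have : E ≤ M * T2 := le_of_mul_le_mul_left this hT1
    have : M * T2 ≤ M * (T1 + C) := by gcongr; linarith
    have : δ * (c * n) ≤ δ * T1 := by gcongr
    nlinarith
  · rw [min_eq_right h]
    have hT2 : 0 < T2 := by linarith
    have : T2 * E ≤ T2 * (M * T1) := by
      nlinarith [mul_nonneg (sub_nonneg.2 h) c2]
    have : E ≤ M * T1 := le_of_mul_le_mul_left this hT2
    have : M * T1 ≤ M * (T2 + C) := by gcongr; linarith
    have : δ * (c * n) ≤ δ * T2 := by gcongr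
    nlinarith

lemma bk_cross {D : ℕ → ℝ} {C : ℝ} (hD : ∀ n, |D (n + 1) - D n| ≤ C)
    (h1 : ∃ᶠ n in atTop, D n < 0) (h2 : ∃ᶠ n in atTop, 0 < D n) :
    ∃ᶠ n in atTop, |D n| ≤ C := by
  rw [frequently_atTop] at *
  intro N
  obtain ⟨n1, hn1, hd1⟩ := h1 N
  have hex : ∃ n, n1 ≤ n ∧ 0 ≤ D n := by
    obtain ⟨n, hn, hd⟩ := h2 n1
    exact ⟨n, hn, hd.le⟩
  classical
  obtain ⟨hs1, hs2⟩ := Nat.find_spec hex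
  set n := Nat.find hex with hn
  have hne : n ≠ n1 := by
    intro h; rw [h] at hs2; linarith
  obtain ⟨k, hk⟩ : ∃ k, n = k + 1 := ⟨n - 1, by omega⟩
  have hmin := Nat.find_min hex (m := k) (by omega)
  have hk1 : n1 ≤ k := by omega
  have : D k < 0 := by
    by_contra hh
    exact hmin ⟨hk1, not_lt.1 hh⟩
  refine ⟨n, by omega, ?_⟩
  have h3 := (abs_le.1 (hD k)).2
  rw [abs_of_nonneg hs2, hk]
  linarith

lemma bk_all_good (f : X → Y) (g : X → Z) (α β : X → ℝ) {c C M δ : ℝ} {K : ℕ} (hc : 0 < c)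
    (hα : ∀ x, c ≤ α x) (hβ : ∀ x, c ≤ β x) (hα' : ∀ x, α x ≤ C) (hβ' : ∀ x, β x ≤ C)
    (hK : C / c ≤ K) (hK1 : 1 ≤ K) (hM : 0 ≤ M) (hδ : 0 < δ) (hbd : bkBd f α β M)
    (hbd' : bkBd g β α M) (ω : ℕ → X) :
    ω ∈ bkGood f α β K (M + 2 * δ) ∪ bkGood g β α K (M + 2 * δ) := by
  by_cases hA : ∀ᶠ n in atTop, bkLin α (bkCnt ω n) < bkLin β (bkCnt ω (n + 1))
  · exact Or.inl (bk_caseA f α β hc hα hβ hα' hβ' hK hK1 hM hδ hbd ω hA)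
  by_cases hB : ∀ᶠ n in atTop, bkLin β (bkCnt ω n) < bkLin α (bkCnt ω (n + 1))
  · exact Or.inr (bk_caseA g β α hc hβ hα hβ' hα' hK hK1 hM hδ hbd' ω hB)
  refine Or.inl (bk_caseC f g α β (C := C) hc hα hβ hM hδ hbd hbd' ω ?_)
  rw [not_eventually] at hA hB
  refine bk_cross (D := fun n => bkLin α (bkCnt ω n) - bkLin β (bkCnt ω n)) ?_ ?_ ?_
  · intro n
    simp only [bk_lin_succ]
    rw [abs_le]
    constructor <;> linarith [hα (ω n), hα' (ω n), hβ (ω n), hβ' (ω n)]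
  · refine hB.mono fun n hn => ?_
    rw [not_lt, bk_lin_succ] at hn
    linarith [hα (ω n)]
  · refine hA.mono fun n hn => ?_
    rw [not_lt, bk_lin_succ] at hn
    linarith [hβ (ω n)]

theorem bk_upper [MetricSpace (ℕ → X)] [MeasurableSpace (ℕ → X)] [BorelSpace (ℕ → X)]
    (f : X → Y) (g : X → Z) (hfg : ∀ x x', f x = f x' → g x = g x' → x = x')
    (α β : X → ℝ) {c C M : ℝ} (hc : 0 < c)
    (hα : ∀ x, c ≤ α x) (hβ : ∀ x, c ≤ β x) (hα' : ∀ x, α x ≤ C) (hβ' : ∀ x, β x ≤ C)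
    (hM : 0 ≤ M) (hbd : bkBd f α β M) (hbd' : bkBd g β α M)
    (hd : ∀ (ω ω' : ℕ → X) (m n : ℕ), (∀ k < m, f (ω k) = f (ω' k)) →
      (∀ k < n, g (ω k) = g (ω' k)) →
      dist ω ω' ≤ Real.exp (-min (bkLin α (bkCnt ω m)) (bkLin β (bkCnt ω n)))) :
    dimH (univ : Set (ℕ → X)) ≤ ENNReal.ofReal M := by
  obtain ⟨K, hK⟩ := exists_nat_ge (max (C / c) 1)
  have hK1 : 1 ≤ K := by exact_mod_cast (le_max_right _ _).trans hK
  have hK2 := (le_max_left _ _).trans hK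
  refine ENNReal.le_of_forall_pos_le_add fun ε hε _ => ?_
  set δ : ℝ := (ε : ℝ) / 3 with hδ
  have hδ0 : 0 < δ := by positivity
  have key : μH[((M.toNNReal + ε : ℝ≥0) : ℝ)] (univ : Set (ℕ → X)) = 0 := by
    have hs : M + 2 * δ < ((M.toNNReal + ε : ℝ≥0) : ℝ) := by
      rw [NNReal.coe_add, Real.coe_toNNReal _ hM]; linarith
    have h1 := bk_good_null f α β hc hα hβ (fun ω ω' n l h h' => by
      refine hd ω ω' (n + l) n ?_ fun k hk => by rw [h k hk]
      intro k hk
      by_cases hkn : k < n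
      · rw [h k hkn]
      · have := h' (k - n) (by omega)
        rwa [show n + (k - n) = k by omega] at this) K
        (by positivity : 0 ≤ M + 2 * δ) hs
    have h2 := bk_good_null g β α hc hβ hα (fun ω ω' n l h h' => by
      rw [min_comm]
      refine hd ω ω' n (n + l) (fun k hk => by rw [h k hk]) ?_
      intro k hk
      by_cases hkn : k < n
      · rw [h k hkn]
      · have := h' (k - n) (by omega)
        rwa [show n + (k - n) = k by omega] at this) K
        (by positivity : 0 ≤ M + 2 * δ) hs
    refine measure_mono_null (fun ω _ => ?_) (measure_union_null h1 h2)
    exact bk_all_good f g α β hc hα hβ hα' hβ' hK2 hK1 hM hδ0 hbd hbd' ω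
  have := dimH_le_of_hausdorffMeasure_ne_top (d := M.toNNReal + ε)
    (s := (univ : Set (ℕ → X))) (by rw [key]; simp)
  simpa [ENNReal.ofReal] using this

end




section
variable {X Y Z : Type*} [Fintype X] [Fintype Y] [Fintype Z] [DecidableEq X] [DecidableEq Y]
  [DecidableEq Z]

lemma bk_slln [MeasurableSpace X] [DiscreteMeasurableSpace X] (μ : Measure X)
    [IsProbabilityMeasure μ] (h : X → ℝ) :
    ∀ᵐ ω ∂(Measure.infinitePi fun _ : ℕ => μ),
      Tendsto (fun n : ℕ => (∑ k ∈ Finset.range n, h (ω k)) / n) atTop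
        (nhds (∑ x, μ.real {x} * h x)) := by
  have hm : Measurable h := Measurable.of_discrete
  have hmp := fun i => measurePreserving_eval_infinitePi (fun _ : ℕ => μ) i
  have h_integ : Integrable h μ := Integrable.of_finite
  have h1 := ProbabilityTheory.strong_law_ae_real
    (μ := Measure.infinitePi fun _ : ℕ => μ) (fun k (ω : ℕ → X) => h (ω k)) ?_ ?_ ?_
  · have h2 : ∫ ω, h (ω 0) ∂(Measure.infinitePi fun _ : ℕ => μ) = ∑ x, μ.real {x} * h x := by
      have := integral_map (μ := Measure.infinitePi fun _ : ℕ => μ) (φ := Function.eval 0)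
        (hmp 0).measurable.aemeasurable (f := h) (hm.aestronglyMeasurable)
      rw [(hmp 0).map_eq] at this
      rw [show (∫ ω, h (ω 0) ∂(Measure.infinitePi fun _ : ℕ => μ)) = ∫ x, h x ∂μ from this.symm,
        integral_fintype h_integ]
      simp
    rw [h2] at h1
    exact h1
  · exact (hmp 0).integrable_comp_of_integrable h_integ
  · intro i j hij
    have := ProbabilityTheory.iIndepFun_infinitePi (P := fun _ : ℕ => μ) (X := fun _ => h)
      (fun _ => hm)
    exact this.indepFun hij
  · intro i
    have hi : ∀ i, ProbabilityTheory.IdentDistrib (fun ω : ℕ → X => h (ω i)) h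
        (Measure.infinitePi fun _ : ℕ => μ) μ := by
      intro i
      refine ⟨(hm.comp (hmp i).measurable).aemeasurable, hm.aemeasurable, ?_⟩
      rw [← (hmp i).map_eq, Measure.map_map hm (hmp i).measurable, (hmp i).map_eq]
      rfl
    exact (hi i).trans (hi 0).symm

lemma bk_ev_le {u : ℕ → ℝ} {L ε : ℝ} (hε : 0 < ε)
    (h : Tendsto (fun n : ℕ => u n / n) atTop (nhds L)) :
    ∀ᶠ n : ℕ in atTop, u n ≤ (L + ε) * n := by
  filter_upwards [h.eventually (ge_mem_nhds (show L < L + ε by linarith)),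
    eventually_gt_atTop 0] with n hn hp
  rwa [div_le_iff₀ (by exact_mod_cast hp)] at hn

lemma bk_ev_ge {u : ℕ → ℝ} {L ε : ℝ} (hε : 0 < ε)
    (h : Tendsto (fun n : ℕ => u n / n) atTop (nhds L)) :
    ∀ᶠ n : ℕ in atTop, (L - ε) * n ≤ u n := by
  filter_upwards [h.eventually (le_mem_nhds (show L - ε < L by linarith)),
    eventually_gt_atTop 0] with n hn hp
  rwa [le_div_iff₀ (by exact_mod_cast hp)] at hn

lemma bk_lin_ge_mul {S h ε Λ t : ℝ} {n : ℕ} (hS0 : 0 ≤ S) (hS : (h - ε) * n ≤ S) (hΛ : 0 < Λ)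
    (ht : 0 ≤ t) (hn : t / Λ ≤ n) : t * ((h - ε) / Λ) ≤ S := by
  rcases le_total 0 (h - ε) with h0 | h0
  · refine le_trans ?_ hS
    calc t * ((h - ε) / Λ) = (h - ε) * (t / Λ) := by ring
      _ ≤ _ := by gcongr
  · refine le_trans ?_ hS0
    exact mul_nonpos_of_nonneg_of_nonpos ht (div_nonpos_of_nonpos_of_nonneg h0 hΛ.le)

lemma bk_choose_eps {s hc hq Λ1 Λ2 : ℝ} (h1 : 0 < Λ1) (h2 : 0 < Λ2)
    (hs : s < hc / Λ2 + hq / Λ1) :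
    ∃ ε > 0, s ≤ (hc - ε) / (Λ2 + ε) + (hq - ε) / (Λ1 + ε) := by
  have hcont : ContinuousAt (fun ε : ℝ => (hc - ε) / (Λ2 + ε) + (hq - ε) / (Λ1 + ε)) 0 := by
    refine ContinuousAt.add (ContinuousAt.div ?_ ?_ ?_) (ContinuousAt.div ?_ ?_ ?_)
    all_goals first | fun_prop | (simp; positivity)
  have hev := hcont.eventually (le_mem_nhds (show s < (hc - 0) / (Λ2 + 0) + (hq - 0) / (Λ1 + 0) by
    simpa using hs))
  have := (hev.filter_mono (nhdsWithin_le_nhds (s := Ioi 0))).and self_mem_nhdsWithin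
  obtain ⟨ε, he, hpos⟩ := this.exists
  exact ⟨ε, hpos, he⟩

theorem bk_frostman {E : Type*} [MetricSpace E] [MeasurableSpace E] [BorelSpace E]
    (ν : Measure E) (G B : Set E) (hG : MeasurableSet G) (s : ℝ≥0) (t0 : ℝ)
    (h : ∀ ω ∈ G, ∀ t ≥ t0, ν (closedBall ω (Real.exp (-t))) ≤ ENNReal.ofReal (Real.exp (-t)) ^ (s : ℝ))
    (hB : ν (B ∩ G) ≠ 0) : (s : ℝ≥0∞) ≤ dimH B := by
  refine le_dimH_of_hausdorffMeasure_ne_zero ?_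
  have hle : ν.restrict G ≤ μH[(s : ℝ)] := by
    refine Measure.le_hausdorffMeasure _ _ (ENNReal.ofReal (Real.exp (-t0)))
      (by simp [Real.exp_pos]) fun U hU => ?_
    rw [Measure.restrict_apply' hG]
    rcases (U ∩ G).eq_empty_or_nonempty with he | ⟨ω, hωU, hωG⟩
    · rw [he, measure_empty]; exact zero_le
    have key : ∀ t ≥ t0, ediam U ≤ ENNReal.ofReal (Real.exp (-t)) →
        ν (U ∩ G) ≤ ENNReal.ofReal (Real.exp (-t)) ^ (s : ℝ) := by
      intro t ht hUt
      refine le_trans (measure_mono ?_) (h ω hωG t ht)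
      rintro ω' ⟨hω', -⟩
      rw [mem_closedBall, ← ENNReal.ofReal_le_ofReal_iff (Real.exp_pos _).le, ← edist_dist]
      exact (edist_le_ediam_of_mem hω' hωU).trans hUt
    by_cases h0 : ediam U = 0
    · rw [h0]
      have hlim : Tendsto (fun t : ℝ => ENNReal.ofReal (Real.exp (-t)) ^ (s : ℝ)) atTop
          (nhds (0 ^ (s : ℝ))) := by
        have h1 : Tendsto (fun t : ℝ => ENNReal.ofReal (Real.exp (-t))) atTop (nhds 0) := by
          rw [← ENNReal.ofReal_zero]
          exact ENNReal.tendsto_ofReal (Real.tendsto_exp_neg_atTop_nhds_zero)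
        exact (ENNReal.continuous_rpow_const.tendsto 0).comp h1
      refine ge_of_tendsto hlim ?_
      filter_upwards [eventually_ge_atTop t0] with t ht
      exact key t ht (by rw [h0]; exact zero_le)
    · have htop : ediam U ≠ ⊤ := (hU.trans_lt ENNReal.ofReal_lt_top).ne
      have hpos : 0 < (ediam U).toReal := ENNReal.toReal_pos h0 htop
      have heq : ediam U = ENNReal.ofReal (Real.exp (-(-Real.log (ediam U).toReal))) := by
        rw [neg_neg, Real.exp_log hpos, ENNReal.ofReal_toReal htop]
      have ht : -Real.log (ediam U).toReal ≥ t0 := by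
        have : (ediam U).toReal ≤ Real.exp (-t0) := by
          rw [← ENNReal.toReal_ofReal (Real.exp_pos (-t0)).le]
          exact ENNReal.toReal_mono ENNReal.ofReal_ne_top hU
        have := (Real.log_le_log hpos this)
        rw [Real.log_exp] at this
        linarith
      have := key _ ht heq.le
      rwa [← heq] at this
  intro h0
  have := hle B
  rw [h0, Measure.restrict_apply' hG] at this
  exact hB (le_antisymm this zero_le)

set_option maxHeartbeats 1000000 in
theorem bk_lower [MeasurableSpace X] [DiscreteMeasurableSpace X] [MetricSpace (ℕ → X)]
    [BorelSpace (ℕ → X)] (f : X → Y) (g : X → Z)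
    (hfg : ∀ x x', f x = f x' → g x = g x' → x = x')
    (α β : X → ℝ) (hα : ∀ x, 0 < α x) (hβ : ∀ x, 0 < β x)
    (q : X → ℝ) (hq : ∀ x, 0 < q x) (hq1 : ∑ x, q x = 1)
    (μ : Measure X) [IsProbabilityMeasure μ] (hμ : ∀ x, μ {x} = ENNReal.ofReal (q x))
    (hΛ : bkLin α q ≤ bkLin β q)
    (hball : ∀ (ω ω' : ℕ → X) (t : ℝ), dist ω ω' ≤ Real.exp (-t) →
      (∀ m, bkLin α (bkCnt ω m) < t → f (ω m) = f (ω' m)) ∧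
      (∀ m, bkLin β (bkCnt ω m) < t → g (ω m) = g (ω' m)))
    (s : ℝ≥0) (hs : (s : ℝ) < (bkEnt q - bkEnt (bkPush f q)) / bkLin β q +
      bkEnt (bkPush f q) / bkLin α q)
    (B : Set (ℕ → X)) (hB : (Measure.infinitePi fun _ : ℕ => μ) B = 1) (hBm : MeasurableSet B) :
    (s : ℝ≥0∞) ≤ dimH B := by
  set ν := Measure.infinitePi fun _ : ℕ => μ with hν
  have hX : Nonempty X := by
    by_contra hne
    rw [not_nonempty_iff] at hne
    simp at hq1
  set P : X → ℝ := fun x => bkPush f q (f x) with hP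
  have hPge : ∀ x, q x ≤ P x := fun x => bkPush_ge f (fun x => (hq x).le) x
  have hPpos : ∀ x, 0 < P x := fun x => (hq x).trans_le (hPge x)
  have hPle : ∀ x, P x ≤ 1 := by
    intro x
    rw [← hq1, ← bkPush_sum f q]
    exact Finset.single_le_sum (f := bkPush f q)
      (fun y _ => bkPush_nonneg f (fun x => (hq x).le) y) (Finset.mem_univ (f x))
  set fc : X → ℝ := fun x => Real.log (P x) - Real.log (q x) with hfc
  set fq : X → ℝ := fun x => - Real.log (P x) with hfq
  have fc0 : ∀ x, 0 ≤ fc x := fun x => sub_nonneg.2 (Real.log_le_log (hq x) (hPge x))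
  have fq0 : ∀ x, 0 ≤ fq x := fun x => neg_nonneg.2 (Real.log_nonpos (hPpos x).le (hPle x))
  have hreal : ∀ x, μ.real {x} = q x := fun x => by
    rw [Measure.real, hμ, ENNReal.toReal_ofReal (hq x).le]
  have hμpre : ∀ y, μ (f ⁻¹' {y}) = ENNReal.ofReal (bkPush f q y) := by
    intro y
    have : (f ⁻¹' {y}) = ((Finset.univ.filter fun x => f x = y : Finset X) : Set X) := by
      ext x; simp
    rw [this, ← MeasureTheory.sum_measure_singleton]
    simp only [hμ]
    rw [← ENNReal.ofReal_sum_of_nonneg (fun x _ => (hq x).le), Finset.sum_filter]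
    rfl
  have h_lam_one_pos : 0 < bkLin α q := Finset.sum_pos (fun x _ => mul_pos (hq x) (hα x))
    Finset.univ_nonempty
  have h_lam_two_pos : 0 < bkLin β q := Finset.sum_pos (fun x _ => mul_pos (hq x) (hβ x))
    Finset.univ_nonempty
  set Λ1 := bkLin α q with hΛ1
  set Λ2 := bkLin β q with hΛ2
  set hQ := bkEnt (bkPush f q) with hQd
  set hC := bkEnt q - bkEnt (bkPush f q) with hCd
  have mQ : ∑ x, q x * fq x = hQ := by
    rw [hQd, bkEnt, bkEnt_push_eq, bkPush_sum, hq1]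
    simp [hfq, hP]
  have mC : ∑ x, q x * fc x = hC := by
    have : bkEnt q = - ∑ x, q x * Real.log (q x) := by
      simp [bkEnt, hq1, Real.negMulLog]
    rw [hCd, this, ← hQd, ← mQ]
    simp only [hfc, hfq, mul_sub, mul_neg, Finset.sum_sub_distrib, Finset.sum_neg_distrib]
    ring
  obtain ⟨ε, hε, hse⟩ := bk_choose_eps h_lam_one_pos h_lam_two_pos hs
  have hs1 : (s : ℝ) ≤ (hC - ε) / (Λ2 + ε) + (hQ - ε) / (Λ1 + ε) := hse
  let S : (X → ℝ) → (ℕ → X) → ℕ → ℝ := fun h ω n => ∑ k ∈ Finset.range n, h (ω k)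
  have Smeas : ∀ h n, Measurable fun ω => S h ω n := by
    intro h n
    refine Finset.measurable_sum _ fun k _ => ?_
    exact (Measurable.of_discrete (f := h)).comp (measurable_pi_apply k)
  let G : ℕ → Set (ℕ → X) := fun N => {ω | ∀ n ≥ N, S α ω n ≤ (Λ1 + ε) * n ∧
    S β ω n ≤ (Λ2 + ε) * n ∧ (hC - ε) * n ≤ S fc ω n ∧ (hQ - ε) * n ≤ S fq ω n}
  have Gmeas : ∀ N, MeasurableSet (G N) := by
    intro N
    simp only [G, setOf_forall]
    refine MeasurableSet.iInter fun n => MeasurableSet.iInter fun _ => ?_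
    refine (measurableSet_le (Smeas _ _) measurable_const).inter
      ((measurableSet_le (Smeas _ _) measurable_const).inter
      ((measurableSet_le measurable_const (Smeas _ _)).inter
      (measurableSet_le measurable_const (Smeas _ _))))
  have hae : ∀ᵐ ω ∂ν, ω ∈ ⋃ N, G N := by
    have a1 := bk_slln μ α
    have a2 := bk_slln μ β
    have a3 := bk_slln μ fc
    have a4 := bk_slln μ fq
    simp only [hreal] at a1 a2 a3 a4
    rw [mC] at a3
    rw [mQ] at a4
    filter_upwards [a1, a2, a3, a4] with ω b1 b2 b3 b4
    have := (bk_ev_le hε b1).and ((bk_ev_le hε b2).and ((bk_ev_ge hε b3).and (bk_ev_ge hε b4)))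
    obtain ⟨N, hN⟩ := eventually_atTop.1 this
    exact mem_iUnion.2 ⟨N, fun n hn => hN n hn⟩
  obtain ⟨N, hN⟩ : ∃ N, ν (B ∩ G N) ≠ 0 := by
    by_contra hcon
    push Not at hcon
    have h1 : ν (B ∩ ⋃ N, G N) = 0 := by
      rw [inter_iUnion]; exact measure_iUnion_null hcon
    have h2 : ν B = ν (B ∩ ⋃ N, G N) := by
      refine measure_congr ?_
      filter_upwards [hae] with ω hω
      exact propext ⟨fun h => ⟨h, hω⟩, fun h => h.1⟩
    rw [h1, hB] at h2
    exact one_ne_zero h2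
  refine bk_frostman ν (G N) B (Gmeas N) s ((Λ2 + ε) * (N + 1)) ?_ hN
  intro ω hω t ht
  have L1 : 0 < Λ1 + ε := by linarith
  have L2 : 0 < Λ2 + ε := by linarith
  have ht0 : 0 ≤ t := le_trans (by positivity) ht
  set n1 := ⌈t / (Λ1 + ε)⌉₊ with hn1
  set n2 := ⌈t / (Λ2 + ε)⌉₊ with hn2
  have hn12 : n2 ≤ n1 := Nat.ceil_mono (by gcongr)
  have hNn2 : N ≤ n2 := by
    have : (N : ℝ) ≤ t / (Λ2 + ε) := by
      rw [le_div_iff₀ L2]; nlinarith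
    exact_mod_cast this.trans (Nat.le_ceil _)
  have agree : ∀ (h : X → ℝ) (hh : ∀ x, 0 < h x) (L : ℝ), 0 < L → L * (N + 1) ≤ t →
      (∀ n ≥ N, S h ω n ≤ L * n) → ∀ k < ⌈t / L⌉₊, bkLin h (bkCnt ω k) < t := by
    intro h hh L hL hLt hb k hk
    rw [Nat.lt_ceil, lt_div_iff₀ hL] at hk
    rw [bkLin_cnt]
    have hmono : S h ω k ≤ S h ω (max k N) := by
      refine Finset.sum_le_sum_of_subset_of_nonneg ?_ fun i _ _ => (hh _).le
      exact Finset.range_mono (le_max_left _ _)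
    have h2 := hb (max k N) (le_max_right _ _)
    have h3 : L * ((max k N : ℕ) : ℝ) < t := by
      rcases le_total k N with h | h
      · rw [max_eq_right h]; linarith
      · rw [max_eq_left h]; linarith
    exact lt_of_le_of_lt (hmono.trans h2) h3
  have hLN : (Λ1 + ε) * (N + 1) ≤ t := le_trans (by gcongr) ht
  have ag1 := agree α hα (Λ1 + ε) L1 hLN (fun n hn => (hω n hn).1)
  have ag2 := agree β hβ (Λ2 + ε) L2 ht (fun n hn => (hω n hn).2.1)
  let U : ℕ → Set X := fun k => if k < n2 then {ω k} else f ⁻¹' {f (ω k)}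
  let hk : ℕ → ℝ := fun k => fq (ω k) + if k < n2 then fc (ω k) else 0
  have hsub : closedBall ω (Real.exp (-t)) ⊆ ((Finset.range n1 : Finset ℕ) : Set ℕ).pi U := by
    intro ω' hω' k hk
    rw [Finset.coe_range, mem_Iio] at hk
    rw [mem_closedBall, dist_comm] at hω'
    obtain ⟨b1, b2⟩ := hball ω ω' t hω'
    have c1 := b1 k (ag1 k hk)
    by_cases hk2 : k < n2
    · have c2 := b2 k (ag2 k hk2)
      simp only [U, if_pos hk2, mem_singleton_iff]
      exact (hfg _ _ c1 c2).symm
    · simp only [U, if_neg hk2, mem_preimage, mem_singleton_iff]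
      exact c1.symm
  have hUm : ∀ k, μ (U k) = ENNReal.ofReal (Real.exp (-hk k)) := by
    intro k
    by_cases hk2 : k < n2
    · simp only [U, hk, if_pos hk2, hμ, hfq, hfc]
      congr 1
      rw [show -(-Real.log (P (ω k)) + (Real.log (P (ω k)) - Real.log (q (ω k)))) =
        Real.log (q (ω k)) by ring, Real.exp_log (hq _)]
    · simp only [U, hk, if_neg hk2, hμpre, hfq, add_zero, neg_neg]
      rw [Real.exp_log (hPpos _)]
  have hsumk : ∑ k ∈ Finset.range n1, hk k = S fq ω n1 + S fc ω n2 := by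
    simp only [hk, Finset.sum_add_distrib, S]
    congr 1
    rw [← Finset.sum_filter]
    congr 1
    ext k; simp; omega
  calc ν (closedBall ω (Real.exp (-t))) ≤ ν (((Finset.range n1 : Finset ℕ) : Set ℕ).pi U) :=
        measure_mono hsub
    _ = ∏ k ∈ Finset.range n1, μ (U k) := by
        rw [hν, Measure.infinitePi_pi _ (fun _ _ => MeasurableSet.of_discrete)]
    _ = ENNReal.ofReal (Real.exp (-(S fq ω n1 + S fc ω n2))) := by
        simp only [hUm]
        rw [← ENNReal.ofReal_prod_of_nonneg (fun _ _ => (Real.exp_pos _).le), ← Real.exp_sum,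
          Finset.sum_neg_distrib, hsumk]
    _ ≤ ENNReal.ofReal (Real.exp (-(t * s))) := by
        refine ENNReal.ofReal_le_ofReal (Real.exp_le_exp.2 (neg_le_neg ?_))
        have d1 := bk_lin_ge_mul (S := S fq ω n1) (Finset.sum_nonneg fun k _ => fq0 _)
          (hω n1 (hNn2.trans hn12)).2.2.2 L1 ht0 (Nat.le_ceil _)
        have d2 := bk_lin_ge_mul (S := S fc ω n2) (Finset.sum_nonneg fun k _ => fc0 _)
          (hω n2 hNn2).2.2.1 L2 ht0 (Nat.le_ceil _)
        have : t * s ≤ t * ((hC - ε) / (Λ2 + ε) + (hQ - ε) / (Λ1 + ε)) := by gcongr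
        linarith
    _ = _ := by
        rw [ENNReal.ofReal_rpow_of_pos (Real.exp_pos _), ← Real.exp_mul, neg_mul]

end




section
variable {X Y Z : Type*} [Fintype X] [Fintype Y] [Fintype Z] [DecidableEq X] [DecidableEq Y]
  [DecidableEq Z]

lemma bk_pi_eq_cyl (n : ℕ) (w : Fin n → X) [Nonempty X] :
    {ω : ℕ → X | ∀ k : Fin n, ω k.val = w k} = ((Finset.range n : Finset ℕ) : Set ℕ).pi
      (fun k => {if h : k < n then w ⟨k, h⟩ else Classical.arbitrary X}) := by
  ext ω
  simp only [mem_setOf_eq, Finset.coe_range, Set.mem_pi, mem_Iio, mem_singleton_iff]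
  constructor
  · intro h k hk
    rw [dif_pos hk]; exact h ⟨k, hk⟩
  · intro h k
    have := h k k.2
    rwa [dif_pos k.2] at this

lemma bk_borel [MetricSpace (ℕ → X)] [mX : MeasurableSpace X] [DiscreteMeasurableSpace X]
    (f : X → Y) (g : X → Z) (hfg : ∀ x x', f x = f x' → g x = g x' → x = x')
    (α β : X → ℝ) {c : ℝ} (hc : 0 < c) (hα : ∀ x, c ≤ α x) (hβ : ∀ x, c ≤ β x)
    (hd : ∀ (ω ω' : ℕ → X) (m n : ℕ), (∀ k < m, f (ω k) = f (ω' k)) →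
      (∀ k < n, g (ω k) = g (ω' k)) →
      dist ω ω' ≤ Real.exp (-min (bkLin α (bkCnt ω m)) (bkLin β (bkCnt ω n))))
    (hball : ∀ (ω ω' : ℕ → X) (t : ℝ), dist ω ω' ≤ Real.exp (-t) →
      (∀ m, bkLin α (bkCnt ω m) < t → f (ω m) = f (ω' m)) ∧
      (∀ m, bkLin β (bkCnt ω m) < t → g (ω m) = g (ω' m))) :
    borel (ℕ → X) = MeasurableSpace.pi := by
  apply le_antisymm
  · refine MeasurableSpace.generateFrom_le fun U hU => ?_
    have hUeq : U = ⋃ (i : Σ n : ℕ, (Fin n → X)),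
        ⋃ (_ : {ω : ℕ → X | ∀ k : Fin i.1, ω k.val = i.2 k} ⊆ U),
          {ω : ℕ → X | ∀ k : Fin i.1, ω k.val = i.2 k} := by
      apply Subset.antisymm
      · intro ω hω
        obtain ⟨r, hr, hrU⟩ := Metric.isOpen_iff.1 hU ω hω
        obtain ⟨n, hn⟩ := exists_nat_gt (-Real.log r / c)
        rw [div_lt_iff₀ hc] at hn
        refine mem_iUnion.2 ⟨⟨n, fun k => ω k⟩, mem_iUnion.2 ⟨?_, fun k => rfl⟩⟩
        intro ω' hω'
        apply hrU
        rw [mem_ball, dist_comm]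
        have hag : ∀ k < n, ω k = ω' k := fun k hk => (hω' ⟨k, hk⟩).symm
        refine (hd ω ω' n n (fun k hk => by rw [hag k hk])
          (fun k hk => by rw [hag k hk])).trans_lt ?_
        rw [← Real.lt_log_iff_exp_lt hr]
        have := le_min (bk_lin_cnt_ge hα ω n) (bk_lin_cnt_ge hβ ω n)
        linarith
      · exact iUnion_subset fun i => iUnion_subset fun h => h
    rw [hUeq]
    refine MeasurableSet.iUnion fun i => MeasurableSet.iUnion fun _ => ?_
    have : {ω : ℕ → X | ∀ k : Fin i.1, ω k.val = i.2 k} =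
        ⋂ k : Fin i.1, (fun ω : ℕ → X => ω k.val) ⁻¹' {i.2 k} := by
      ext ω; simp
    rw [this]
    exact MeasurableSet.iInter fun k => (measurable_pi_apply _) (MeasurableSet.of_discrete)
  · refine iSup_le fun k => ?_
    rintro S ⟨s, -, rfl⟩
    refine MeasurableSpace.measurableSet_generateFrom ?_
    refine Metric.isOpen_iff.2 fun ω hω => ?_
    refine ⟨Real.exp (-(max (bkLin α (bkCnt ω k)) (bkLin β (bkCnt ω k)) + 1)), Real.exp_pos _,
      fun ω' hω' => ?_⟩
    rw [mem_ball, dist_comm] at hω'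
    obtain ⟨h1, h2⟩ := hball ω ω' _ hω'.le
    have e1 := h1 k (by linarith [le_max_left (bkLin α (bkCnt ω k)) (bkLin β (bkCnt ω k))])
    have e2 := h2 k (by linarith [le_max_right (bkLin α (bkCnt ω k)) (bkLin β (bkCnt ω k))])
    have := hfg _ _ e1 e2
    simp only [mem_preimage, Function.eval] at hω ⊢
    rwa [← this]

lemma bk_infinitePi_cyl [Nonempty X] [MeasurableSpace X] [DiscreteMeasurableSpace X] (μ : Measure X)
    [IsProbabilityMeasure μ] (q : X → ℝ) (hq : ∀ x, 0 ≤ q x)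
    (hμ : ∀ x, μ {x} = ENNReal.ofReal (q x)) (n : ℕ) (w : Fin n → X) :
    (Measure.infinitePi fun _ : ℕ => μ) {ω : ℕ → X | ∀ k : Fin n, ω k.val = w k} =
      ENNReal.ofReal (∏ k, q (w k)) := by
  rw [bk_pi_eq_cyl, Measure.infinitePi_pi _ (fun _ _ => MeasurableSet.of_discrete),
    ENNReal.ofReal_prod_of_nonneg (fun _ _ => hq _), Finset.prod_range]
  refine Finset.prod_congr rfl fun k _ => ?_
  rw [dif_pos k.2, hμ]

lemma bk_bern_unique [Nonempty X] [MeasurableSpace X] [DiscreteMeasurableSpace X] (μ : Measure X)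
    [IsProbabilityMeasure μ] (q : X → ℝ) (hq : ∀ x, 0 ≤ q x)
    (hμ : ∀ x, μ {x} = ENNReal.ofReal (q x)) (ν : Measure (ℕ → X))
    (hν : ∀ (n : ℕ) (w : Fin n → X), ν {ω : ℕ → X | ∀ k : Fin n, ω k.val = w k} =
      ENNReal.ofReal (∏ k, q (w k))) :
    ν = Measure.infinitePi fun _ : ℕ => μ := by
  refine Measure.eq_infinitePi _ fun s t ht => ?_
  rw [← Measure.infinitePi_pi (fun _ : ℕ => μ) (fun i _ => ht i)]
  -- both measures agree on finite unions of cylinders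
  obtain ⟨n, hn⟩ : ∃ n, s ⊆ Finset.range n := s.exists_nat_subset_range
  set W : Set (Fin n → X) := {w | ∀ k : Fin n, k.val ∈ s → w k ∈ t k}
  have hset : (s : Set ℕ).pi t = ⋃ w ∈ W, {ω : ℕ → X | ∀ k : Fin n, ω k.val = w k} := by
    ext ω
    simp only [Set.mem_pi, Finset.mem_coe, mem_iUnion, mem_setOf_eq, exists_prop, W]
    constructor
    · intro h
      exact ⟨fun k => ω k, fun k hk => h k hk, fun k => rfl⟩
    · rintro ⟨w, hw, hω⟩ k hk
      have hkn : k < n := Finset.mem_range.1 (hn hk)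
      have := hw ⟨k, hkn⟩ hk
      rwa [← hω ⟨k, hkn⟩] at this
  have hdisj : W.PairwiseDisjoint fun w => {ω : ℕ → X | ∀ k : Fin n, ω k.val = w k} := by
    intro w _ w' _ hne
    refine Set.disjoint_left.2 fun ω h h' => hne ?_
    funext k
    rw [← h k, ← h' k]
  have hmeas : ∀ w ∈ W, MeasurableSet {ω : ℕ → X | ∀ k : Fin n, ω k.val = w k} := by
    intro w _
    rw [bk_pi_eq_cyl]
    exact MeasurableSet.pi (Finset.countable_toSet _) fun _ _ => MeasurableSet.of_discrete
  rw [hset, measure_biUnion W.to_countable hdisj hmeas, measure_biUnion W.to_countable hdisj hmeas]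
  refine tsum_congr fun w => ?_
  rw [hν, bk_infinitePi_cyl μ q hq hμ]

lemma bk_exists_mu [MeasurableSpace X] [DiscreteMeasurableSpace X] (q : X → ℝ)
    (hq : ∀ x, 0 ≤ q x) (hq1 : ∑ x, q x = 1) :
    ∃ μ : Measure X, IsProbabilityMeasure μ ∧ ∀ x, μ {x} = ENNReal.ofReal (q x) := by
  refine ⟨∑ x, ENNReal.ofReal (q x) • Measure.dirac x, ⟨?_⟩, fun x => ?_⟩
  · simp only [Measure.coe_finset_sum, Finset.sum_apply, Measure.smul_apply, measure_univ,
      smul_eq_mul, mul_one]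
    rw [← ENNReal.ofReal_sum_of_nonneg (fun x _ => hq x), hq1, ENNReal.ofReal_one]
  · simp only [Measure.coe_finset_sum, Finset.sum_apply, Measure.smul_apply, smul_eq_mul,
      Measure.dirac_apply' _ (MeasurableSet.of_discrete)]
    rw [Finset.sum_eq_single x]
    · simp
    · intro y _ hy; simp [hy]
    · simp

/-- dimension functional -/
def bkG (f : X → Y) (α β : X → ℝ) (p : X → ℝ) : ℝ :=
  (bkEnt p - bkEnt (bkPush f p)) / bkLin β p + bkEnt (bkPush f p) / bkLin α p

lemma bkLin_pos {α : X → ℝ} (hα : ∀ x, 0 < α x) {p : X → ℝ} (hp : ∀ x, 0 ≤ p x)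
    (hp1 : ∑ x, p x = 1) : 0 < bkLin α p := by
  refine lt_of_le_of_ne (Finset.sum_nonneg fun x _ => mul_nonneg (hp x) (hα x).le) fun h => ?_
  have h2 := (Finset.sum_eq_zero_iff_of_nonneg fun x _ => mul_nonneg (hp x) (hα x).le).1 h.symm
  have : ∑ x, p x = 0 := Finset.sum_eq_zero fun x hx => by
    rcases mul_eq_zero.1 (h2 x hx) with h | h
    · exact h
    · exact absurd h (hα x).ne'
  linarith

lemma bkG_le (f : X → Y) (g : X → Z) (hfg : ∀ x x', f x = f x' → g x = g x' → x = x')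
    {α β : X → ℝ} (hα : ∀ x, 0 < α x) (hβ : ∀ x, 0 < β x)
    {p : X → ℝ} (hp : ∀ x, 0 ≤ p x) (hp1 : ∑ x, p x = 1) (h : bkLin α p ≤ bkLin β p) :
    bkG g β α p ≤ bkG f α β p := by
  have h1 := bkLin_pos hα hp hp1
  have h2 := bkLin_pos hβ hp hp1
  have h3 := bkEnt_subadd f g hfg hp
  have h4 : bkG f α β p - bkG g β α p =
      ((bkLin α p)⁻¹ - (bkLin β p)⁻¹) *
        (bkEnt (bkPush f p) + bkEnt (bkPush g p) - bkEnt p) := by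
    unfold bkG; field_simp; ring
  have h5 : (bkLin β p)⁻¹ ≤ (bkLin α p)⁻¹ := inv_anti₀ h1 h
  have := mul_nonneg (sub_nonneg.2 h5) (sub_nonneg.2 h3)
  linarith

lemma bk_bd_of_le (f : X → Y) {α β : X → ℝ} (hα : ∀ x, 0 < α x) (hβ : ∀ x, 0 < β x) {M : ℝ}
    (h : ∀ p : X → ℝ, (∀ x, 0 ≤ p x) → ∑ x, p x = 1 → bkG f α β p ≤ M) : bkBd f α β M := by
  intro N hN
  have h0 : 0 ≤ ∑ x, N x := Finset.sum_nonneg fun x _ => hN x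
  rcases h0.eq_or_lt with h0 | h0
  · have : N = 0 := by
      funext x
      exact (Finset.sum_eq_zero_iff_of_nonneg fun x _ => hN x).1 h0.symm x (Finset.mem_univ x)
    subst this; simp [bkEnt, bkPush, bkLin]
  set n := ∑ x, N x with hn
  obtain ⟨p, hp⟩ : ∃ p : X → ℝ, p = n⁻¹ • N := ⟨_, rfl⟩
  have hNp : N = n • p := by rw [hp, smul_smul, mul_inv_cancel₀ h0.ne', one_smul]
  have hp0 : ∀ x, 0 ≤ p x := fun x => by
    simp only [hp, Pi.smul_apply, smul_eq_mul]; have := hN x; positivity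
  have hp1 : ∑ x, p x = 1 := by
    simp only [hp, Pi.smul_apply, smul_eq_mul, ← Finset.mul_sum, ← hn]
    exact inv_mul_cancel₀ h0.ne'
  have h1 := bkLin_pos hα hp0 hp1
  have h2 := bkLin_pos hβ hp0 hp1
  have h3 := h p hp0 hp1
  rw [bkG, div_add_div _ _ h2.ne' h1.ne', div_le_iff₀ (by positivity)] at h3
  rw [hNp, bkPush_smul, bkEnt_smul, bkEnt_smul, bkLin_smul, bkLin_smul]
  have : 0 ≤ n * n := by positivity
  nlinarith [mul_le_mul_of_nonneg_left h3 this]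

set_option maxHeartbeats 1000000 in
lemma bk_interior (f : X → Y) {α β : X → ℝ} (hα : ∀ x, 0 < α x) (hβ : ∀ x, 0 < β x) {M : ℝ}
    (hM : 0 ≤ M) (hbd : bkBd f α β M) {p : X → ℝ} (hp : ∀ x, 0 ≤ p x) (hp1 : ∑ x, p x = 1)
    (hΛ : bkLin α p ≤ bkLin β p) (hpM : bkG f α β p = M) (x₀ : X) : 0 < p x₀ := by
  by_contra hcon
  have hx0 : p x₀ = 0 := le_antisymm (not_lt.1 hcon) (hp x₀)
  have h1 := bkLin_pos hα hp hp1
  have h2 := bkLin_pos hβ hp hp1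
  set Λ1 := bkLin α p
  set Λ2 := bkLin β p
  set e0 := bkEnt (bkPush f p) with he0
  set E0 := bkEnt p with hE0
  have heq : Λ2 * e0 + Λ1 * (E0 - e0) = M * (Λ1 * Λ2) := by
    have hh : (E0 - e0) / Λ2 + e0 / Λ1 = M := hpM
    rw [← hh]; field_simp; ring
  have e0nn : 0 ≤ e0 := bkEnt_nonneg (bkPush_nonneg f hp)
  set a0 := α x₀
  set b0 := β x₀
  have a0p : 0 < a0 := hα x₀
  have b0p : 0 < b0 := hβ x₀
  set R := M * (Λ1 + a0) with hR
  set K := (a0 + b0) * R + M * (a0 * Λ2 + b0 * Λ1 + a0 * b0) with hK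
  have hR0 : 0 ≤ R := by positivity
  have hK0 : 0 ≤ K := by positivity
  set ε := Real.exp (-(K / Λ1 + 1)) with hε
  have ε0 : 0 < ε := Real.exp_pos _
  have ε1 : ε ≤ 1 := by
    rw [hε, Real.exp_le_one_iff]
    have : 0 ≤ K / Λ1 := by positivity
    linarith
  set d : X → ℝ := ε • Pi.single x₀ 1 with hd
  have hd0 : ∀ x, 0 ≤ d x := by
    intro x
    simp only [hd, Pi.smul_apply, smul_eq_mul]
    refine mul_nonneg ε0.le ?_
    by_cases h : x = x₀
    · subst h; simp
    · simp [h]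
  set N := p + d with hN
  have hN0 : ∀ x, 0 ≤ N x := fun x => add_nonneg (hp x) (hd0 x)
  have la : bkLin α N = Λ1 + ε * a0 := by
    rw [hN, bkLin_add, hd, bkLin_smul]
    simp [bkLin, Pi.single_apply, Λ1, a0]
  have lb : bkLin β N = Λ2 + ε * b0 := by
    rw [hN, bkLin_add, hd, bkLin_smul]
    simp [bkLin, Pi.single_apply, Λ2, b0]
  have hsumN : ∑ x, N x = 1 + ε := by
    simp [hN, hd, Finset.sum_add_distrib, hp1, Pi.single_apply]
  have hEN : E0 + ε * (K / Λ1 + 1) ≤ bkEnt N := by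
    have hs : ∑ x, Real.negMulLog (N x) = ∑ x, Real.negMulLog (p x) + Real.negMulLog ε := by
      have : ∀ x, Real.negMulLog (N x) = Real.negMulLog (p x) +
          if x = x₀ then Real.negMulLog ε else 0 := by
        intro x
        by_cases h : x = x₀
        · subst h; simp [hN, hd, hx0]
        · simp [hN, hd, h]
      simp [this, Finset.sum_add_distrib]
    have h3 : Real.negMulLog (1 + ε) ≤ 0 := by
      rw [Real.negMulLog]
      have := Real.log_nonneg (show (1 : ℝ) ≤ 1 + ε by linarith)
      nlinarith
    have h4 : Real.negMulLog ε = ε * (K / Λ1 + 1) := by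
      rw [Real.negMulLog, show Real.log ε = -(K / Λ1 + 1) by rw [hε, Real.log_exp]]; ring
    rw [hE0, bkEnt, bkEnt, hs, hsumN, hp1, h4]
    simp
    linarith
  have heN : e0 ≤ bkEnt (bkPush f N) := by
    have := bkEnt_superadd (bkPush_nonneg f hp) (bkPush_nonneg f hd0)
    rw [← bkPush_add] at this
    have h3 := bkEnt_nonneg (bkPush_nonneg f hd0)
    linarith
  have hbN := hbd N hN0
  have hEe := bkEnt_push_le f hN0
  rw [la, lb] at hbN
  set eN := bkEnt (bkPush f N)
  set EN := bkEnt N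
  have la0 : 0 < Λ1 + ε * a0 := by positivity
  have lb0 : 0 < Λ2 + ε * b0 := by positivity
  have heR : eN ≤ R := by
    have : (Λ2 + ε * b0) * eN ≤ (Λ2 + ε * b0) * (M * (Λ1 + ε * a0)) := by
      nlinarith [mul_nonneg la0.le (sub_nonneg.2 hEe)]
    have := le_of_mul_le_mul_left this lb0
    refine this.trans ?_
    rw [hR]; gcongr
    exact mul_le_of_le_one_left a0p.le ε1
  have eN0 : 0 ≤ eN := e0nn.trans heN
  have i1 : (Λ2 - Λ1) * e0 ≤ (Λ2 - Λ1) * eN := mul_le_mul_of_nonneg_left heN (sub_nonneg.2 hΛ)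
  have i2 : ε * (a0 + b0) * eN ≤ ε * (a0 + b0) * R := by gcongr
  have i3 : Λ1 * (E0 + ε * (K / Λ1 + 1)) ≤ Λ1 * EN := by gcongr
  have i4 : Λ1 * (E0 + ε * (K / Λ1 + 1)) = Λ1 * E0 + ε * K + ε * Λ1 := by
    field_simp
    ring
  have i5 : 0 ≤ ε * a0 * EN := mul_nonneg (by positivity) (eN0.trans hEe)
  have i6 : ε * ε * (M * (a0 * b0)) ≤ ε * (M * (a0 * b0)) := by
    have : ε * ε ≤ ε := mul_le_of_le_one_left ε0.le ε1
    gcongr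
  have i7 : 0 < ε * Λ1 := by positivity
  have i8 : 0 ≤ ε * b0 * eN := by positivity
  have i9 : ε * K = ε * (a0 + b0) * R + ε * (M * (a0 * Λ2 + b0 * Λ1)) + ε * (M * (a0 * b0)) := by
    rw [hK]; ring
  linarith

lemma bkG_continuousOn (f : X → Y) {α β : X → ℝ} (hα : ∀ x, 0 < α x) (hβ : ∀ x, 0 < β x) :
    ContinuousOn (bkG f α β) (stdSimplex ℝ X) := by
  have cE : ∀ {W : Type _} [Fintype W], Continuous (bkEnt (Y := W)) := by
    intro W _
    unfold bkEnt
    refine Continuous.sub (continuous_finset_sum _ fun y _ => ?_) ?_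
    · exact Real.continuous_negMulLog.comp (continuous_apply y)
    · exact Real.continuous_negMulLog.comp (continuous_finset_sum _ fun y _ => continuous_apply y)
  have cE' : Continuous (bkEnt (Y := Y)) := by
    unfold bkEnt
    refine Continuous.sub (continuous_finset_sum _ fun y _ => ?_) ?_
    · exact Real.continuous_negMulLog.comp (continuous_apply y)
    · exact Real.continuous_negMulLog.comp (continuous_finset_sum _ fun y _ => continuous_apply y)
  have cP : Continuous (bkPush f) := by
    refine continuous_pi fun y => continuous_finset_sum _ fun x _ => ?_
    split_ifs
    · exact continuous_apply x
    · exact continuous_const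
  have cL : ∀ γ : X → ℝ, Continuous (bkLin γ) := fun γ =>
    continuous_finset_sum _ fun x _ => (continuous_apply x).mul continuous_const
  unfold bkG
  refine ContinuousOn.add (ContinuousOn.div ?_ (cL β).continuousOn ?_)
    (ContinuousOn.div ?_ (cL α).continuousOn ?_)
  · exact (cE.sub (cE'.comp cP)).continuousOn
  · exact fun p hp => (bkLin_pos hβ hp.1 hp.2).ne'
  · exact (cE'.comp cP).continuousOn
  · exact fun p hp => (bkLin_pos hα hp.1 hp.2).ne'

theorem bk_max [Nonempty X] (f : X → Y) (g : X → Z)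
    (hfg : ∀ x x', f x = f x' → g x = g x' → x = x')
    {α β : X → ℝ} (hα : ∀ x, 0 < α x) (hβ : ∀ x, 0 < β x) :
    ∃ (q : X → ℝ) (M : ℝ), (∀ x, 0 < q x) ∧ ∑ x, q x = 1 ∧ 0 ≤ M ∧
      (∀ p : X → ℝ, (∀ x, 0 ≤ p x) → ∑ x, p x = 1 → bkG f α β p ≤ M) ∧
      (∀ p : X → ℝ, (∀ x, 0 ≤ p x) → ∑ x, p x = 1 → bkG g β α p ≤ M) ∧
      ((bkLin α q ≤ bkLin β q ∧ bkG f α β q = M) ∨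
        (bkLin β q < bkLin α q ∧ bkG g β α q = M)) := by
  have hgf : ∀ x x', g x = g x' → f x = f x' → x = x' := fun x x' h h' => hfg x x' h' h
  have hne : (stdSimplex ℝ X).Nonempty := ⟨_, single_mem_stdSimplex ℝ (Classical.arbitrary X)⟩
  obtain ⟨q, hq, hmax⟩ := (isCompact_stdSimplex ℝ X).exists_isMaxOn hne
    ((bkG_continuousOn f hα hβ).sup (bkG_continuousOn g hβ hα))
  set M := bkG f α β q ⊔ bkG g β α q with hM
  have b1 : ∀ p : X → ℝ, (∀ x, 0 ≤ p x) → ∑ x, p x = 1 → bkG f α β p ≤ M := fun p h h' =>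
    le_trans le_sup_left (hmax (a := p) ⟨h, h'⟩)
  have b2 : ∀ p : X → ℝ, (∀ x, 0 ≤ p x) → ∑ x, p x = 1 → bkG g β α p ≤ M := fun p h h' =>
    le_trans le_sup_right (hmax (a := p) ⟨h, h'⟩)
  have hM0 : 0 ≤ M := by
    refine le_trans ?_ (b1 q hq.1 hq.2)
    refine add_nonneg (div_nonneg ?_ (bkLin_pos hβ hq.1 hq.2).le)
      (div_nonneg ?_ (bkLin_pos hα hq.1 hq.2).le)
    · exact sub_nonneg.2 (bkEnt_push_le f hq.1)
    · exact bkEnt_nonneg (bkPush_nonneg f hq.1)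
  rcases le_or_gt (bkLin α q) (bkLin β q) with h | h
  · have hG : bkG f α β q = M := (sup_eq_left.2 (bkG_le f g hfg hα hβ hq.1 hq.2 h)).symm
    exact ⟨q, M, bk_interior f hα hβ hM0 (bk_bd_of_le f hα hβ b1) hq.1 hq.2 h hG, hq.2, hM0,
      b1, b2, Or.inl ⟨h, hG⟩⟩
  · have hG : bkG g β α q = M := (sup_eq_right.2 (bkG_le g f hgf hβ hα hq.1 hq.2 h.le)).symm
    exact ⟨q, M, bk_interior g hβ hα hM0 (bk_bd_of_le g hβ hα b2) hq.1 hq.2 h.le hG, hq.2, hM0,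
      b1, b2, Or.inr ⟨h, hG⟩⟩

end


section
variable {X Y Z : Type*} [Fintype X] [Fintype Y] [Fintype Z] [DecidableEq X] [DecidableEq Y]
  [DecidableEq Z]

theorem bk_main [Nonempty X] [MetricSpace (ℕ → X)] [mΩ : MeasurableSpace (ℕ → X)]
    [BorelSpace (ℕ → X)]
    (f : X → Y) (g : X → Z) (hfg : ∀ x x', f x = f x' → g x = g x' → x = x')
    (α β : X → ℝ) (hα : ∀ x, 0 < α x) (hβ : ∀ x, 0 < β x)
    (hd : ∀ (ω ω' : ℕ → X) (m n : ℕ), (∀ k < m, f (ω k) = f (ω' k)) →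
      (∀ k < n, g (ω k) = g (ω' k)) →
      dist ω ω' ≤ Real.exp (-min (bkLin α (bkCnt ω m)) (bkLin β (bkCnt ω n))))
    (hball : ∀ (ω ω' : ℕ → X) (t : ℝ), dist ω ω' ≤ Real.exp (-t) →
      (∀ m, bkLin α (bkCnt ω m) < t → f (ω m) = f (ω' m)) ∧
      (∀ m, bkLin β (bkCnt ω m) < t → g (ω m) = g (ω' m))) :
    ∃ (q : X → ℝ) (M : ℝ), (∀ x, 0 < q x) ∧ ∑ x, q x = 1 ∧
      (∀ p : X → ℝ, (∀ x, 0 ≤ p x) → ∑ x, p x = 1 → bkG f α β p ≤ M) ∧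
      (∀ p : X → ℝ, (∀ x, 0 ≤ p x) → ∑ x, p x = 1 → bkG g β α p ≤ M) ∧
      ((bkLin α q ≤ bkLin β q ∧ bkG f α β q = M) ∨
        (bkLin β q < bkLin α q ∧ bkG g β α q = M)) ∧
      dimH (univ : Set (ℕ → X)) = ENNReal.ofReal M ∧
      ∀ ν : Measure (ℕ → X), (∀ (n : ℕ) (w : Fin n → X),
        ν {ω : ℕ → X | ∀ k : Fin n, ω k.val = w k} = ENNReal.ofReal (∏ k, q (w k))) →
        ∀ B : Set (ℕ → X), MeasurableSet B → ν B = 1 → ENNReal.ofReal M ≤ dimH B := by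
  letI mX : MeasurableSpace X := ⊤
  haveI : DiscreteMeasurableSpace X := ⟨fun _ => trivial⟩
  obtain ⟨x1, hx1⟩ := Finite.exists_min α
  obtain ⟨x2, hx2⟩ := Finite.exists_min β
  obtain ⟨x3, hx3⟩ := Finite.exists_max α
  obtain ⟨x4, hx4⟩ := Finite.exists_max β
  have hc : 0 < min (α x1) (β x2) := lt_min (hα _) (hβ _)
  have c1 : ∀ x, min (α x1) (β x2) ≤ α x := fun x => (min_le_left _ _).trans (hx1 x)
  have c2 : ∀ x, min (α x1) (β x2) ≤ β x := fun x => (min_le_right _ _).trans (hx2 x)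
  have c3 : ∀ x, α x ≤ max (α x3) (β x4) := fun x => (hx3 x).trans (le_max_left _ _)
  have c4 : ∀ x, β x ≤ max (α x3) (β x4) := fun x => (hx4 x).trans (le_max_right _ _)
  have hm : mΩ = MeasurableSpace.pi :=
    (BorelSpace.measurable_eq (α := ℕ → X)).trans (bk_borel f g hfg α β hc c1 c2 hd hball)
  subst hm
  have hgf : ∀ x x', g x = g x' → f x = f x' → x = x' := fun x x' h h' => hfg x x' h' h
  obtain ⟨q, M, hq, hq1, hM, b1, b2, hcase⟩ := bk_max f g hfg hα hβ
  obtain ⟨μ, hμp, hμ⟩ := bk_exists_mu q (fun x => (hq x).le) hq1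
  have hup := bk_upper f g hfg α β hc c1 c2 c3 c4 hM (bk_bd_of_le f hα hβ b1)
    (bk_bd_of_le g hβ hα b2) hd
  have hlow : ∀ B : Set (ℕ → X), MeasurableSet B →
      (Measure.infinitePi fun _ : ℕ => μ) B = 1 → ENNReal.ofReal M ≤ dimH B := by
    intro B hBm hB
    refine ENNReal.le_of_forall_nnreal_lt fun s hs => ?_
    have hs' : (s : ℝ) < M := by
      rw [ENNReal.lt_ofReal_iff_toReal_lt ENNReal.coe_ne_top] at hs
      simpa using hs
    rcases hcase with ⟨h, hG⟩ | ⟨h, hG⟩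
    · exact bk_lower f g hfg α β hα hβ q hq hq1 μ hμ h hball s (by rw [← hG] at hs'; exact hs')
        B hB hBm
    · exact bk_lower g f hgf β α hβ hα q hq hq1 μ hμ h.le
        (fun ω ω' t ht => (hball ω ω' t ht).symm) s (by rw [← hG] at hs'; exact hs') B hB hBm
  refine ⟨q, M, hq, hq1, b1, b2, hcase, le_antisymm hup ?_, ?_⟩
  · exact hlow univ MeasurableSet.univ measure_univ
  · intro ν hν B hBm hB
    rw [bk_bern_unique μ q (fun x => (hq x).le) hμ ν hν] at hB
    exact hlow B hBm hB

end

lemma bk_rho_spec {Γ : Type*} (val : List Γ → ℝ) {u v : ℕ → Γ} (h : u ≠ v) :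
    ∃ L : ℕ, (∀ k < L, u k = v k) ∧ u L ≠ v L ∧
      rhoDist val u v = val (List.ofFn fun k : Fin L => u k.val) := by
  classical
  refine ⟨Nat.find (Function.ne_iff.mp h), fun k hk => ?_, Nat.find_spec (Function.ne_iff.mp h), ?_⟩
  · exact not_not.1 (Nat.find_min (Function.ne_iff.mp h) hk)
  · unfold rhoDist
    rw [dif_neg h]

lemma bk_val_eq {Γ : Type*} {a : Γ → ℝ} (ha : ∀ i, a i ∈ Set.Ioo (0:ℝ) 1) (u : ℕ → Γ) (L : ℕ) :
    ((List.ofFn fun k : Fin L => u k.val).map a).prod =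
      Real.exp (-∑ k ∈ Finset.range L, -Real.log (a (u k))) := by
  rw [List.map_ofFn, List.prod_ofFn, Finset.sum_neg_distrib, neg_neg, Real.exp_sum,
    Finset.prod_range]
  refine Finset.prod_congr rfl fun k _ => ?_
  rw [Real.exp_log (ha _).1]; rfl

lemma bk_neglog_pos {x : ℝ} (h : x ∈ Set.Ioo (0:ℝ) 1) : 0 < -Real.log x := by
  have := Real.log_neg h.1 h.2
  linarith

lemma bk_rho_le {Γ : Type*} {a : Γ → ℝ} (ha : ∀ i, a i ∈ Set.Ioo (0:ℝ) 1) (u v : ℕ → Γ) (m : ℕ)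
    (h : ∀ k < m, u k = v k) :
    rhoDist (fun L => (L.map a).prod) u v ≤
      Real.exp (-∑ k ∈ Finset.range m, -Real.log (a (u k))) := by
  by_cases huv : u = v
  · unfold rhoDist
    rw [dif_pos huv]
    exact (Real.exp_pos _).le
  · obtain ⟨L, h1, h2, h3⟩ := bk_rho_spec (fun L => (L.map a).prod) huv
    rw [h3, bk_val_eq ha, Real.exp_le_exp, neg_le_neg_iff]
    refine Finset.sum_le_sum_of_subset_of_nonneg (Finset.range_subset_range.2 ?_)
      fun k _ _ => (bk_neglog_pos (ha _)).le
    by_contra hlt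
    exact h2 (h L (not_le.1 hlt))

lemma bk_rho_agree {Γ : Type*} {a : Γ → ℝ} (ha : ∀ i, a i ∈ Set.Ioo (0:ℝ) 1) (u v : ℕ → Γ)
    (t : ℝ) (h : rhoDist (fun L => (L.map a).prod) u v ≤ Real.exp (-t)) (m : ℕ)
    (hm : ∑ k ∈ Finset.range m, -Real.log (a (u k)) < t) : u m = v m := by
  by_cases huv : u = v
  · rw [huv]
  · obtain ⟨L, h1, h2, h3⟩ := bk_rho_spec (fun L => (L.map a).prod) huv
    rw [h3, bk_val_eq ha, Real.exp_le_exp, neg_le_neg_iff] at h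
    refine h1 m ?_
    by_contra hlt
    have : ∑ k ∈ Finset.range L, -Real.log (a (u k)) ≤
        ∑ k ∈ Finset.range m, -Real.log (a (u k)) :=
      Finset.sum_le_sum_of_subset_of_nonneg (Finset.range_subset_range.2 (not_lt.1 hlt))
      fun k _ _ => (bk_neglog_pos (ha _)).le
    linarith

section
open scoped Classical
variable {Γ₁ Γ₂ : Type*} [Fintype Γ₁] [Fintype Γ₂]

lemma bk_sum_sub (A : Set (Γ₁ × Γ₂)) (F : Γ₁ × Γ₂ → ℝ) (h : ∀ ij ∉ A, F ij = 0) :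
    ∑ ij, F ij = ∑ x : ↥A, F x.1 := by
  rw [← Finset.sum_filter_of_ne (p := (· ∈ A))]
  · refine Finset.sum_subtype _ (fun x => ?_) F
    simp
  · intro x _ hx
    by_contra hA
    exact hx (h x hA)

lemma bk_col (A : Set (Γ₁ × Γ₂)) (p : Γ₁ × Γ₂ → ℝ) (h : ∀ ij ∉ A, p ij = 0) (i : Γ₁) :
    colSum p i = bkPush (fun x : ↥A => x.1.1) (fun x : ↥A => p x.1) i := by
  unfold colSum bkPush
  rw [← bk_sum_sub A (fun ij => if ij.1 = i then p ij else 0) (fun ij hij => by simp [h ij hij]),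
    Fintype.sum_prod_type, Finset.sum_eq_single i]
  · simp
  · intro j _ hj; simp [hj]
  · simp

lemma bk_row (A : Set (Γ₁ × Γ₂)) (p : Γ₁ × Γ₂ → ℝ) (h : ∀ ij ∉ A, p ij = 0) (j : Γ₂) :
    rowSum p j = bkPush (fun x : ↥A => x.1.2) (fun x : ↥A => p x.1) j := by
  unfold rowSum bkPush
  rw [← bk_sum_sub A (fun ij => if ij.2 = j then p ij else 0) (fun ij hij => by simp [h ij hij]),
    Fintype.sum_prod_type]
  simp

lemma bk_gFun (A : Set (Γ₁ × Γ₂)) (a : Γ₁ → ℝ) (b : Γ₂ → ℝ) (p : Γ₁ × Γ₂ → ℝ)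
    (hp : IsProbVec A p) :
    gFun p a b =
      if bkLin (fun x : ↥A => -Real.log (a x.1.1)) (fun x : ↥A => p x.1) ≤
        bkLin (fun x : ↥A => -Real.log (b x.1.2)) (fun x : ↥A => p x.1) then
        bkG (fun x : ↥A => x.1.1) (fun x : ↥A => -Real.log (a x.1.1))
          (fun x : ↥A => -Real.log (b x.1.2)) (fun x : ↥A => p x.1)
      else bkG (fun x : ↥A => x.1.2) (fun x : ↥A => -Real.log (b x.1.2))
          (fun x : ↥A => -Real.log (a x.1.1)) (fun x : ↥A => p x.1) := by
  obtain ⟨h0, hz, h1⟩ := hp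
  have l1 : lyap1 p a = -bkLin (fun x : ↥A => -Real.log (a x.1.1)) (fun x : ↥A => p x.1) := by
    unfold lyap1 bkLin
    rw [bk_sum_sub A _ (fun ij hij => by simp [hz ij hij])]
    simp
  have l2 : lyap2 p b = -bkLin (fun x : ↥A => -Real.log (b x.1.2)) (fun x : ↥A => p x.1) := by
    unfold lyap2 bkLin
    rw [bk_sum_sub A _ (fun ij hij => by simp [hz ij hij])]
    simp
  have hs : ∑ x : ↥A, p x.1 = 1 := by rw [← bk_sum_sub A p hz, h1]
  have e0 : ∑ ij, p ij * Real.log (p ij) = -bkEnt (fun x : ↥A => p x.1) := by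
    unfold bkEnt
    rw [bk_sum_sub A _ (fun ij hij => by simp [hz ij hij]), hs]
    simp [Real.negMulLog]
  have e1 : ∑ ij, p ij * Real.log (colSum p ij.1) =
      -bkEnt (bkPush (fun x : ↥A => x.1.1) (fun x : ↥A => p x.1)) := by
    unfold bkEnt
    rw [bk_sum_sub A _ (fun ij hij => by simp [hz ij hij]), bkPush_sum, hs, bkEnt_push_eq]
    simp [bk_col A p hz]
  have e2 : ∑ ij, p ij * Real.log (rowSum p ij.2) =
      -bkEnt (bkPush (fun x : ↥A => x.1.2) (fun x : ↥A => p x.1)) := by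
    unfold bkEnt
    rw [bk_sum_sub A _ (fun ij hij => by simp [hz ij hij]), bkPush_sum, hs, bkEnt_push_eq]
    simp [bk_row A p hz]
  unfold gFun gOne gTwo bkG
  rw [l1, l2, e0, e1, e2]
  simp only [neg_le_neg_iff]
  split_ifs <;> simp only [neg_sub_neg, div_neg, neg_div, neg_neg] <;> ring

end

/-- The Hausdorff dimension of a symbolic Barański carpet is the maximum of
`g(p,a,b)` over probability vectors on `Γ`; moreover the maximum is attained at a strictly
positive probability vector whose Bernoulli measure has full Hausdorff dimension. -/
theorem stmt14 {Γ₁ Γ₂ : Type} [Fintype Γ₁] [Fintype Γ₂] [Nonempty Γ₁] [Nonempty Γ₂]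
    (A : Set (Γ₁ × Γ₂)) (hA : A.Nonempty)
    (a : Γ₁ → ℝ) (b : Γ₂ → ℝ) (ha : ∀ i, a i ∈ Set.Ioo (0:ℝ) 1) (hb : ∀ j, b j ∈ Set.Ioo (0:ℝ) 1)
    [MetricSpace (ℕ → ↥A)]
    (hdist : ∀ ω₁ ω₂ : ℕ → ↥A, dist ω₁ ω₂ = baranskiDist A a b ω₁ ω₂)
    [MeasurableSpace (ℕ → ↥A)] [BorelSpace (ℕ → ↥A)] :
    (∃ p, IsProbVec A p ∧ (∀ p', IsProbVec A p' → gFun p' a b ≤ gFun p a b) ∧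
      dimH (univ : Set (ℕ → ↥A)) = ENNReal.ofReal (gFun p a b)) ∧
    ∃ q, IsProbVec A q ∧ (∀ ij ∈ A, 0 < q ij) ∧
      dimH (univ : Set (ℕ → ↥A)) = ENNReal.ofReal (gFun q a b) ∧
      ∀ ν : Measure (ℕ → ↥A), IsProbabilityMeasure ν → IsBernoulli A q ν →
        dimHMeasure ν = dimH (univ : Set (ℕ → ↥A)) := by
  classical
  haveI : Nonempty ↥A := hA.to_subtype
  set f : ↥A → Γ₁ := fun x => x.1.1 with hf
  set g : ↥A → Γ₂ := fun x => x.1.2 with hg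
  set α : ↥A → ℝ := fun x => -Real.log (a x.1.1) with hα
  set β : ↥A → ℝ := fun x => -Real.log (b x.1.2) with hβ
  obtain ⟨q, M, hq, hq1, b1, b2, hcase, hdim, hlow⟩ := bk_main f g
    (fun x x' h h' => Subtype.ext (Prod.ext h h')) α β (fun x => bk_neglog_pos (ha _))
    (fun x => bk_neglog_pos (hb _))
    (by
      intro ω ω' m n h h'
      rw [hdist, bkLin_cnt, bkLin_cnt]
      refine max_le ?_ ?_
      · refine (bk_rho_le ha _ _ m h).trans ?_
        rw [Real.exp_le_exp, neg_le_neg_iff]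
        exact min_le_left _ _
      · refine (bk_rho_le hb _ _ n h').trans ?_
        rw [Real.exp_le_exp, neg_le_neg_iff]
        exact min_le_right _ _)
    (by
      intro ω ω' t ht
      rw [hdist] at ht
      simp only [bkLin_cnt]
      exact ⟨bk_rho_agree ha _ _ t ((le_max_left _ _).trans ht),
        bk_rho_agree hb _ _ t ((le_max_right _ _).trans ht)⟩)
  set q' : Γ₁ × Γ₂ → ℝ := fun ij => if h : ij ∈ A then q ⟨ij, h⟩ else 0 with hq'
  have hq'x : (fun x : ↥A => q' x.1) = q := by
    funext x
    simp [hq']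
  have hz : ∀ ij ∉ A, q' ij = 0 := fun ij h => dif_neg h
  have hq'P : IsProbVec A q' := by
    refine ⟨fun ij => ?_, hz, ?_⟩
    · by_cases h : ij ∈ A
      · rw [hq']; simp only [dif_pos h]; exact (hq _).le
      · rw [hz ij h]
    · rw [bk_sum_sub A q' hz, ← hq1, ← hq'x]
  have hgq : gFun q' a b = M := by
    rw [bk_gFun A a b q' hq'P, hq'x]
    rcases hcase with ⟨h, hG⟩ | ⟨h, hG⟩
    · rw [if_pos h]; exact hG
    · rw [if_neg (not_le.2 h)]; exact hG
  have hgp : ∀ p', IsProbVec A p' → gFun p' a b ≤ gFun q' a b := by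
    intro p' hp'
    have hs : ∑ x : ↥A, p' x.1 = 1 := by rw [← bk_sum_sub A p' hp'.2.1, hp'.2.2]
    rw [hgq, bk_gFun A a b p' hp']
    split_ifs
    · exact b1 _ (fun x => hp'.1 _) hs
    · exact b2 _ (fun x => hp'.1 _) hs
  refine ⟨⟨q', hq'P, hgp, by rw [hgq, hdim]⟩, q', hq'P, ?_, by rw [hgq, hdim], ?_⟩
  · intro ij hij
    have := hq ⟨ij, hij⟩
    rw [← hq'x] at this
    exact this
  · intro ν hν hB
    refine le_antisymm (sInf_le ⟨univ, MeasurableSet.univ, measure_univ, rfl⟩) ?_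
    refine le_sInf ?_
    rintro s ⟨B, hBm, hB1, rfl⟩
    rw [hdim]
    refine hlow ν (fun n w => ?_) B hBm hB1
    rw [hB n w, ← hq'x]

end
end
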